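/- Assume R is unmixed of dimension d ≥ 2. Then N(R) ∈ Ξ_1(R) (i.e., there exists a C-parameter ideal q of R with e_1(q :_R m, R) = N(R)) if and only if R is Cohen-Macaulay. -/

import Mathlib

/-! Preliminary definitions: lengths, dimensions, (C-)systems of parameters, Hilbert
coefficients, irreducible multiplicities, local cohomology invariants, stable values,
unmixedness, the unmixed component, and the g-invariant. -/

open CategoryTheory CategoryTheory.Limits Opposite IsLocalRing

universe u

noncomputable section

section Definitions

variable (R : Type u) [CommRing R]

/-- The length of an `R`-module, defined as the Krull dimension of its submodule lattice. -/
def moduleLength (M : Type u) [AddCommGroup M] [Module R M] : WithBot ℕ∞ :=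
  Order.krullDim (Submodule R M)

/-- The Krull dimension of an `R`-module `M`, i.e. `dim (R / Ann M)`. -/
def moduleDim (M : Type u) [AddCommGroup M] [Module R M] : WithBot ℕ∞ :=
  ringKrullDim (R ⧸ Module.annihilator R M)

/-- The colon submodule `(N :_M I) = {x : M | I • x ⊆ N}`. -/
def modColon {M : Type u} [AddCommGroup M] [Module R M] (N : Submodule R M) (I : Ideal R) :
    Submodule R M where
  carrier := {x | ∀ r ∈ I, r • x ∈ N}
  add_mem' := by
    intro a b ha hb r hr
    simpa [smul_add] using N.add_mem (ha r hr) (hb r hr)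
  zero_mem' := by
    intro r hr
    simpa using N.zero_mem
  smul_mem' := by
    intro c a ha r hr
    rw [smul_comm]
    exact N.smul_mem c (ha r hr)

/-- `x : Fin s → R` is a system of parameters of the module `M`:
`s = dim M`, the `x i` are nonunits, and `M/(x)M` has finite length. -/
def IsSOP (M : Type u) [AddCommGroup M] [Module R M] {s : ℕ} (x : Fin s → R) : Prop :=
  moduleDim R M = (s : WithBot ℕ∞) ∧ (∀ i, x i ∈ nonunits R) ∧
    IsFiniteLength R (M ⧸ (Ideal.span (Set.range x) • (⊤ : Submodule R M)))

/-- The ideal `b(M)`: the intersection, over all systems of parameters `x` of `M` and all `i`,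
of `Ann_R ((0) :_{M/(x_1,...,x_{i-1})M} x_i)`. -/
def bIdeal (M : Type u) [AddCommGroup M] [Module R M] : Ideal R :=
  ⨅ (s : ℕ) (x : Fin s → R) (_ : IsSOP R M x) (i : Fin s),
    (Submodule.torsionBy R
      (M ⧸ (Ideal.span (x '' {j | j < i}) • (⊤ : Submodule R M))) (x i)).annihilator

/-- `x` is a C-system of parameters of `M`: a system of parameters such that
`x i ∈ b(M/(x_{i+1},...,x_s)M)^3` for every `i` (for `i = s` the quotient is `M` itself). -/
def IsCSOP (M : Type u) [AddCommGroup M] [Module R M] {s : ℕ} (x : Fin s → R) : Prop :=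
  IsSOP R M x ∧ ∀ i : Fin s,
    x i ∈ (bIdeal R (M ⧸ (Ideal.span (x '' {j | i < j}) • (⊤ : Submodule R M)))) ^ 3

/-- A parameter ideal of `R`. -/
def IsParamIdeal (q : Ideal R) : Prop :=
  ∃ (s : ℕ) (x : Fin s → R), IsSOP R R x ∧ q = Ideal.span (Set.range x)

/-- A C-parameter ideal of `R`: an ideal generated by a C-system of parameters of `R`. -/
def IsCParamIdeal (q : Ideal R) : Prop :=
  ∃ (s : ℕ) (x : Fin s → R), IsCSOP R R x ∧ q = Ideal.span (Set.range x)

/-- A C-parameter ideal of a module `M`. -/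
def IsCParamIdealMod (M : Type u) [AddCommGroup M] [Module R M] (q : Ideal R) : Prop :=
  ∃ (s : ℕ) (x : Fin s → R), IsCSOP R M x ∧ q = Ideal.span (Set.range x)

/-- `e` is the family of Hilbert coefficients of `M` (of dimension `s`) with respect to `I`:
`ℓ(M/I^{n+1}M) = ∑_{i=0}^{s} (-1)^i (e i) binom(n+s-i, s-i)` for all large `n`. -/
def IsHilbCoeffMod (I : Ideal R) (M : Type u) [AddCommGroup M] [Module R M] (s : ℕ)
    (e : ℕ → ℤ) : Prop :=
  ∃ N : ℕ, ∀ n ≥ N, ∃ L : ℕ,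
    moduleLength R (M ⧸ (I ^ (n + 1) • (⊤ : Submodule R M))) = (L : WithBot ℕ∞) ∧
    (L : ℤ) = ∑ i ∈ Finset.range (s + 1),
      (-1) ^ i * e i * ((n + s - i).choose (s - i) : ℤ)

/-- `e` is the family of Hilbert coefficients of `R` (of dimension `d`) with respect to `I`;
`e 1` is the Chern number of `I`. -/
def IsHilbCoeff (I : Ideal R) (d : ℕ) (e : ℕ → ℤ) : Prop :=
  IsHilbCoeffMod R I R d e

variable [IsLocalRing R]

/-- The colon ideal `(q :_R m)`. -/
def colonIdeal (q : Ideal R) : Ideal R :=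
  modColon R q (maximalIdeal R)

/-- The index of reducibility `ir_M(q) = ℓ((qM :_M m)/qM)`. -/
def irMod (M : Type u) [AddCommGroup M] [Module R M] (q : Ideal R) : WithBot ℕ∞ :=
  moduleLength R
    ↥(Submodule.map (q • (⊤ : Submodule R M)).mkQ
      (modColon R (q • (⊤ : Submodule R M)) (maximalIdeal R)))

/-- `NN` is the stable value `𝒩(M)` of `M`: the common index of reducibility of all
C-parameter ideals of `M`. -/
def IsStableValueMod (M : Type u) [AddCommGroup M] [Module R M] (NN : ℕ) : Prop :=
  ∀ q : Ideal R, IsCParamIdealMod R M q → irMod R M q = (NN : WithBot ℕ∞)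

/-- `NN` is the stable value `𝒩(R)` of `R`. -/
def IsStableValue (NN : ℕ) : Prop :=
  ∀ q : Ideal R, IsCParamIdeal R q → irMod R R q = (NN : WithBot ℕ∞)

/-- `f` is the family of coefficients of the polynomial giving the index of reducibility,
`ir_M(I^{n+1}) = ℓ((I^{n+1}M :_M m)/I^{n+1}M) = ∑_{i=0}^{s-1} (-1)^i (f i) binom(n+s-1-i, s-1-i)`
for all large `n`; `f 0` is the irreducible multiplicity of `M` with respect to `I`. -/
def IsIrrCoeffMod (I : Ideal R) (M : Type u) [AddCommGroup M] [Module R M] (s : ℕ)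
    (f : ℕ → ℤ) : Prop :=
  ∃ N : ℕ, ∀ n ≥ N, ∃ L : ℕ,
    irMod R M (I ^ (n + 1)) = (L : WithBot ℕ∞) ∧
    (L : ℤ) = ∑ i ∈ Finset.range s,
      (-1) ^ i * f i * ((n + s - 1 - i).choose (s - 1 - i) : ℤ)

/-- Ring version of `IsIrrCoeffMod`. -/
def IsIrrCoeff (I : Ideal R) (d : ℕ) (f : ℕ → ℤ) : Prop :=
  IsIrrCoeffMod R I R d f

/-- The local cohomology module `H^i_m(M)`. -/
def Hmod (M : Type u) [AddCommGroup M] [Module R M] (i : ℕ) : ModuleCat.{u} R :=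
  (localCohomology (maximalIdeal R) i).obj (ModuleCat.of R M)

/-- `r_i(M) = ℓ((0) :_{H^i_m(M)} m)`, the length of the socle of `H^i_m(M)`. -/
def rLengthMod (M : Type u) [AddCommGroup M] [Module R M] (i : ℕ) : WithBot ℕ∞ :=
  moduleLength R ↥(Submodule.torsionBySet R ↥(Hmod R M i) ((maximalIdeal R : Ideal R) : Set R))

/-- `r_i(R)`. -/
def rLength (i : ℕ) : WithBot ℕ∞ := rLengthMod R R i

/-- `M` is a Cohen-Macaulay `R`-module: `H^i_m(M) = 0` for all `i < dim M`. -/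
def IsCMMod (M : Type u) [AddCommGroup M] [Module R M] : Prop :=
  ∀ i : ℕ, (i : WithBot ℕ∞) < moduleDim R M → Subsingleton ↥(Hmod R M i)

/-- `R` is a Cohen-Macaulay local ring: `H^i_m(R) = 0` for all `i < dim R`. -/
def IsCMLocal : Prop :=
  ∀ i : ℕ, (i : WithBot ℕ∞) < ringKrullDim R → Subsingleton ↥(Hmod R R i)

/-- `R` is a generalized Cohen-Macaulay local ring:
`H^i_m(R)` has finite length for all `i < dim R`. -/
def IsGeneralizedCM : Prop :=
  ∀ i : ℕ, (i : WithBot ℕ∞) < ringKrullDim R → IsFiniteLength R ↥(Hmod R R i)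

/-- `R` is a Gorenstein local ring: Cohen-Macaulay of type `r_d(R) = 1`, `d = dim R`. -/
def IsGorensteinLocal : Prop :=
  IsCMLocal R ∧ ∀ d : ℕ, ringKrullDim R = (d : WithBot ℕ∞) → rLength R d = (1 : WithBot ℕ∞)

/-- `R` is unmixed: `dim R̂/p = dim R̂` for every associated prime `p` of the
`m`-adic completion `R̂` of `R`. -/
def IsUnmixedRing : Prop :=
  ∀ p ∈ associatedPrimes (AdicCompletion (maximalIdeal R) R) (AdicCompletion (maximalIdeal R) R),
    ringKrullDim ((AdicCompletion (maximalIdeal R) R) ⧸ p) =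
      ringKrullDim (AdicCompletion (maximalIdeal R) R)

/-- `M` is unmixed: `dim R̂/p = dim M̂` for every associated prime `p` of the
`m`-adic completion `M̂` of `M`, viewed over `R̂`. -/
def IsUnmixedMod (M : Type u) [AddCommGroup M] [Module R M] : Prop :=
  ∀ p ∈ associatedPrimes (AdicCompletion (maximalIdeal R) R) (AdicCompletion (maximalIdeal R) M),
    ringKrullDim ((AdicCompletion (maximalIdeal R) R) ⧸ p) =
      moduleDim (AdicCompletion (maximalIdeal R) R) (AdicCompletion (maximalIdeal R) M)

/-- `H^0_m(M)`, described as the submodule of elements killed by a power of `m`. -/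
def H0Sub (M : Type u) [AddCommGroup M] [Module R M] : Submodule R M :=
  ⨆ n : ℕ, Submodule.torsionBySet R M (((maximalIdeal R) ^ n : Ideal R) : Set R)

/-- The unmixed component `u = U_R(0)` of `R`: the largest ideal of dimension `< dim R`. -/
def unmixedComponent : Ideal R := sSup {J : Ideal R | moduleDim R ↥J < ringKrullDim R}

end Definitions

section CMImage

/-- `R` is a homomorphic image of a Cohen-Macaulay (Noetherian) local ring. -/
def IsHomImageOfCM (R : Type u) [CommRing R] : Prop :=
  ∃ (A : Type u) (_ : CommRing A) (_ : IsLocalRing A) (_ : IsNoetherianRing A),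
    IsCMLocal A ∧ ∃ f : A →+* R, Function.Surjective f

end CMImage

section GInvariant

variable (R : Type u) [CommRing R] [IsLocalRing R] [IsNoetherianRing R]

/-- The canonical homomorphism from `Ext^p(R/q, R)` (the term of the directed system indexed by
the ideal `q` with `J ≤ rad q`) into the local cohomology module `H^p_J(R)`, given by the
structure of `H^p_J(R)` as an inductive limit. -/
def canonicalToLocalCohomology (J q : Ideal R) (h : J ≤ q.radical) (p : ℕ) :
    ((localCohomology.diagram (localCohomology.selfLERadicalDiagram J) p).obj
        (op (⟨q, h⟩ : localCohomology.SelfLERadical J))).obj (ModuleCat.of R R) ⟶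
      (localCohomology J p).obj (ModuleCat.of R R) :=
  haveI := localCohomology.hasColimitDiagram.{u, u} (localCohomology.selfLERadicalDiagram J) p
  (colimit.ι (localCohomology.diagram (localCohomology.selfLERadicalDiagram J) p)
      (op (⟨q, h⟩ : localCohomology.SelfLERadical J))).app (ModuleCat.of R R) ≫
    (localCohomology.isoSelfLERadical J p).hom.app (ModuleCat.of R R)

/-- A map of `R`-modules is surjective on socles. -/
def SurjectiveOnSocles {A B : ModuleCat.{u} R} (φ : A ⟶ B) : Prop :=
  ∀ y ∈ Submodule.torsionBySet R ↥B ((maximalIdeal R : Ideal R) : Set R),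
    ∃ z ∈ Submodule.torsionBySet R ↥A ((maximalIdeal R : Ideal R) : Set R), φ z = y

/-- The defining property of the g-invariant: for every system of parameters `x` of `R`
contained in `m^(n₀)` and every `p`, the canonical homomorphism into the local cohomology
module `H^p_m(R)` is surjective on the socles. -/
def GProperty (n₀ : ℕ) : Prop :=
  ∀ (s : ℕ) (x : Fin s → R), IsSOP R R x → (∀ i, x i ∈ maximalIdeal R ^ n₀) →
    ∀ (h : maximalIdeal R ≤ (Ideal.span (Set.range x)).radical) (p : ℕ),
      SurjectiveOnSocles R
        (canonicalToLocalCohomology R (maximalIdeal R) (Ideal.span (Set.range x)) h p)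

/-- The g-invariant `g(R)`: the least `n₀` satisfying `GProperty`. -/
def gInvariant : ℕ := sInf {n₀ : ℕ | GProperty R n₀}

end GInvariant

end

section AnnihilatesColons

variable {R : Type u} [CommRing R]

/-- The ideal generated by the powers `x a ^ e a`, `a ∈ S`. -/
def powSpan (x : ℕ → R) (S : Set ℕ) (e : ℕ → ℕ) : Ideal R :=
  Ideal.span (Set.image (fun a => x a ^ e a) S)

/-- The ideal generated by `x 0, …, x (j - 1)`. -/
def headSpan (x : ℕ → R) (j : ℕ) : Ideal R := Ideal.span (Set.image x (Set.Iio j))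

/-- The ideal generated by `x l, …, x (d - 1)`. -/
def tailSpan (x : ℕ → R) (d l : ℕ) : Ideal R := Ideal.span (Set.image x (Set.Ico l d))

/-- The consequences of the definition of a C-system of parameters that are used in
ideal-theoretic arguments. -/
structure AnnihilatesColons (d : ℕ) (x : ℕ → R) (b : ℕ → Ideal R) : Prop where
  mem : ∀ l < d, x l ∈ b (l + 1)
  ax : ∀ l ≤ d, ∀ S : Set ℕ, S ⊆ Set.Iio l → ∀ i < l, i ∉ S → ∀ e : ℕ → ℕ, (∀ a, e a ≠ 0) →
    ∀ n : ℕ, n ≠ 0 → ∀ β ∈ b l, ∀ c : R,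
      x i ^ n * c ∈ powSpan x S e ⊔ tailSpan x d l → β * c ∈ powSpan x S e ⊔ tailSpan x d l

theorem headSpan_mono (x : ℕ → R) {i j : ℕ} (h : i ≤ j) : headSpan x i ≤ headSpan x j :=
  Ideal.span_mono (Set.image_mono (Set.Iio_subset_Iio h))

theorem mem_headSpan (x : ℕ → R) {i j : ℕ} (h : i < j) : x i ∈ headSpan x j :=
  Ideal.subset_span ⟨i, h, rfl⟩

theorem headSpan_zero (x : ℕ → R) : headSpan x 0 = ⊥ := by
  simp [headSpan]

theorem headSpan_succ (x : ℕ → R) (j : ℕ) :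
    headSpan x (j + 1) = headSpan x j ⊔ Ideal.span {x j} := by
  have : Set.Iio (j + 1) = Set.Iio j ∪ {j} := by
    ext a; simp only [Set.mem_Iio, Set.mem_union, Set.mem_singleton_iff]; omega
  rw [headSpan, this, Set.image_union, Ideal.span_union, Set.image_singleton, headSpan]

theorem mem_sup_span_singleton' {I : Ideal R} {y c : R} :
    c ∈ I ⊔ Ideal.span {y} ↔ ∃ p ∈ I, ∃ r, c = p + y * r := by
  rw [Submodule.mem_sup]
  constructor
  · rintro ⟨p, hp, z, hz, rfl⟩
    obtain ⟨r, rfl⟩ := Ideal.mem_span_singleton'.1 hz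
    exact ⟨p, hp, r, by ring⟩
  · rintro ⟨p, hp, r, rfl⟩
    exact ⟨p, hp, y * r, Ideal.mul_mem_right _ _ (Ideal.mem_span_singleton_self y), rfl⟩

theorem mem_headSpan_succ {x : ℕ → R} {j : ℕ} {c : R} :
    c ∈ headSpan x (j + 1) ↔ ∃ p ∈ headSpan x j, ∃ r, c = p + x j * r := by
  rw [headSpan_succ, mem_sup_span_singleton']

theorem powSpan_one (x : ℕ → R) (j : ℕ) :
    powSpan x (Set.Iio j) (fun _ => 1) = headSpan x j := by
  simp [powSpan, headSpan]

theorem powSpan_update (x : ℕ → R) (j n : ℕ) :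
    powSpan x (Set.Iio (j + 1)) (Function.update (fun _ => 1) j n) =
      headSpan x j ⊔ Ideal.span {x j ^ n} := by
  have : Set.Iio (j + 1) = Set.Iio j ∪ {j} := by
    ext a; simp only [Set.mem_Iio, Set.mem_union, Set.mem_singleton_iff]; omega
  rw [powSpan, this, Set.image_union, Ideal.span_union, Set.image_singleton, headSpan]
  congr 2
  · apply Set.image_congr
    intro a ha
    have : a ≠ j := by simp at ha; omega
    simp [Function.update_of_ne this]
  · simp

theorem tailSpan_self (x : ℕ → R) (d : ℕ) : tailSpan x d d = ⊥ := by simp [tailSpan]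

theorem tailSpan_succ (x : ℕ → R) {d t : ℕ} (h : t < d) :
    tailSpan x d t = tailSpan x d (t + 1) ⊔ Ideal.span {x t} := by
  have : Set.Ico t d = Set.Ico (t + 1) d ∪ {t} := by
    ext a; simp only [Set.mem_Ico, Set.mem_union, Set.mem_singleton_iff]; omega
  rw [tailSpan, this, Set.image_union, Ideal.span_union, Set.image_singleton, tailSpan]

theorem tailSpan_last (x : ℕ → R) (d : ℕ) : tailSpan x (d + 1) d = Ideal.span {x d} := by
  rw [tailSpan_succ x (Nat.lt_succ_self d), tailSpan_self, bot_sup_eq]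

namespace AnnihilatesColons

variable {d : ℕ} {x : ℕ → R} {b : ℕ → Ideal R}

theorem ax_tail (H : AnnihilatesColons d x b) {l t : ℕ} (hlt : l ≤ t) (htd : t ≤ d) {S : Set ℕ}
    (hS : S ⊆ Set.Iio l) {i : ℕ} (hi : i < l) (hiS : i ∉ S) {e : ℕ → ℕ} (he : ∀ a, e a ≠ 0)
    {n : ℕ} (hn : n ≠ 0) {β : R} (hβ : β ∈ b l) {c : R}
    (hc : x i ^ n * c ∈ powSpan x S e ⊔ tailSpan x d t) :
    β * c ∈ powSpan x S e ⊔ tailSpan x d t := by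
  induction t, hlt using Nat.le_induction with
  | base => exact H.ax l htd S hS i hi hiS e he n hn β hβ c hc
  | succ t hlt ih =>
    have htail := tailSpan_succ x (show t < d by omega)
    have h1 := ih (by omega) ((sup_le_sup_left (htail ▸ le_sup_left) _ :
      powSpan x S e ⊔ tailSpan x d (t + 1) ≤ _) hc)
    rw [htail, ← sup_assoc, mem_sup_span_singleton'] at h1
    obtain ⟨q, hq, r, hr⟩ := h1
    have hS' : S ⊆ Set.Iio (t + 1) := fun a ha => by have := hS ha; simp at this ⊢; omega
    have hxt := H.mem t (by omega)
    have h2 := H.ax (t + 1) htd S hS' i (by omega) hiS e he n hn _ hxt c hc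
    have h3 : x t ^ 2 * r ∈ powSpan x S e ⊔ tailSpan x d (t + 1) := by
      have : x t ^ 2 * r = β * (x t * c) - x t * q := by linear_combination (-x t) * hr
      rw [this]
      exact sub_mem (Ideal.mul_mem_left _ _ h2) (Ideal.mul_mem_left _ _ hq)
    have h4 := H.ax (t + 1) htd S hS' t (by omega)
      (fun h => by have := hS h; simp at this; omega) e he 2 (by norm_num) _ hxt r h3
    rw [hr]
    exact add_mem hq h4

theorem ax_bot (H : AnnihilatesColons d x b) {l : ℕ} (hld : l ≤ d) {S : Set ℕ}
    (hS : S ⊆ Set.Iio l) {i : ℕ} (hi : i < l) (hiS : i ∉ S) {e : ℕ → ℕ} (he : ∀ a, e a ≠ 0)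
    {n : ℕ} (hn : n ≠ 0) {β : R} (hβ : β ∈ b l) {c : R}
    (hc : x i ^ n * c ∈ powSpan x S e) :
    β * c ∈ powSpan x S e := by
  have := H.ax_tail hld le_rfl hS hi hiS he hn hβ (c := c)
  rw [tailSpan_self, sup_bot_eq] at this
  exact this hc

theorem ax_head (H : AnnihilatesColons d x b) {j i k : ℕ} (hji : j ≤ i) (hik : i ≤ k) (hk : k < d)
    {n : ℕ} (hn : n ≠ 0) {β : R} (hβ : β ∈ b (k + 1)) {c : R}
    (hc : x i ^ n * c ∈ headSpan x j) : β * c ∈ headSpan x j := by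
  rw [← powSpan_one] at hc ⊢
  exact H.ax_bot (l := k + 1) hk (fun a ha => by simp at ha ⊢; omega) (by omega) (by simp; omega)
    (by simp) hn hβ hc

theorem ax_head_pow (H : AnnihilatesColons d x b) {j k : ℕ} (hjk : j < k) (hk : k < d)
    {n m : ℕ} (hn : n ≠ 0) (hm : m ≠ 0) {c : R}
    (hc : x k ^ m * c ∈ headSpan x j ⊔ Ideal.span {x j ^ n}) :
    x k * c ∈ headSpan x j ⊔ Ideal.span {x j ^ n} := by
  rw [← powSpan_update] at hc ⊢
  refine H.ax_bot (l := k + 1) hk (fun a ha => by simp at ha ⊢; omega) (by omega)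
    (by simp; omega) (fun a => ?_) hm (H.mem k hk) hc
  rcases eq_or_ne a j with rfl | h
  · simpa
  · simp [h]

theorem ax_head_last {d : ℕ} (H : AnnihilatesColons (d + 1) x b) {j i k : ℕ} (hji : j ≤ i) (hik : i ≤ k)
    (hk : k < d) {n : ℕ} (hn : n ≠ 0) {c : R}
    (hc : x i ^ n * c ∈ headSpan x j ⊔ Ideal.span {x d}) :
    x k * c ∈ headSpan x j ⊔ Ideal.span {x d} := by
  rw [← powSpan_one, ← tailSpan_last] at hc ⊢
  exact H.ax_tail (l := k + 1) (by omega) (by omega) (fun a ha => by simp at ha ⊢; omega)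
    (by omega) (by simp; omega) (by simp) hn (H.mem k (by omega)) hc

end AnnihilatesColons

end AnnihilatesColons

section AnnihilatesColons
variable {R : Type u} [CommRing R]

/-- The ideal `I :_R a`. -/
def colonElem (I : Ideal R) (a : R) : Ideal R := Submodule.comap (LinearMap.lsmul R R a) I

theorem mem_colonElem {I : Ideal R} {a c : R} : c ∈ colonElem I a ↔ a * c ∈ I := Iff.rfl

theorem le_colonElem (I : Ideal R) (a : R) : I ≤ colonElem I a :=
  fun _ hc => Ideal.mul_mem_left _ _ hc

namespace AnnihilatesColons

variable {d : ℕ} {x : ℕ → R} {b : ℕ → Ideal R}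

theorem colon_last_le (H : AnnihilatesColons (d + 1) x b) (hreg : ∀ c, x d * c = 0 → c = 0) {j k : ℕ}
    (hjk : j ≤ k) (hk : k ≤ d) {c : R} (hc : x d * c ∈ headSpan x j) :
    x k * c ∈ headSpan x j := by
  induction j generalizing c k with
  | zero =>
    rw [headSpan_zero, Ideal.mem_bot] at hc ⊢
    rw [hreg c hc, mul_zero]
  | succ j ih =>
    rcases hk.eq_or_lt with rfl | hkd
    · exact hc
    obtain ⟨p, hp, e, he⟩ := mem_headSpan_succ.1 hc
    have h1 : x j ^ 1 * e ∈ headSpan x j ⊔ Ideal.span {x d} := by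
      rw [mem_sup_span_singleton']
      exact ⟨-p, neg_mem hp, c, by linear_combination -he⟩
    have h2 := H.ax_head_last le_rfl (by omega : j ≤ k) hkd one_ne_zero h1
    obtain ⟨p', hp', f, hf⟩ := mem_sup_span_singleton'.1 h2
    have h3 : x d * (x k * c - x j * f) ∈ headSpan x j := by
      have : x d * (x k * c - x j * f) = x k * p + x j * p' := by
        linear_combination x k * he + x j * hf
      rw [this]
      exact add_mem (Ideal.mul_mem_left _ _ hp) (Ideal.mul_mem_left _ _ hp')
    have h4 := ih (by omega : j ≤ k) hk h3
    refine H.ax_head hjk le_rfl (by omega) (n := 2) two_ne_zero (H.mem k (by omega)) ?_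
    rw [mem_headSpan_succ]
    exact ⟨_, h4, x k * f, by ring⟩

theorem mem_colon_iff (H : AnnihilatesColons (d + 1) x b) (hreg : ∀ c, x d * c = 0 → c = 0) {j k n : ℕ}
    (hjk : j ≤ k) (hk : k ≤ d) (hn : n ≠ 0) {c : R} :
    x k ^ n * c ∈ headSpan x j ↔ c ∈ colonElem (headSpan x j) (x d) := by
  constructor
  · exact fun h => H.ax_head hjk hk (Nat.lt_succ_self d) hn (H.mem d (Nat.lt_succ_self d)) h
  · intro h
    have := H.colon_last_le hreg hjk hk h
    obtain ⟨n, rfl⟩ := Nat.exists_eq_succ_of_ne_zero hn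
    rw [pow_succ, mul_assoc]
    exact Ideal.mul_mem_left _ _ this

theorem mul_mem_of_colon (H : AnnihilatesColons (d + 1) x b) (hreg : ∀ c, x d * c = 0 → c = 0) {j k : ℕ}
    (hjk : j ≤ k) (hk : k ≤ d) {c : R} (hc : c ∈ colonElem (headSpan x j) (x d)) :
    x k * c ∈ headSpan x j := H.colon_last_le hreg hjk hk hc

theorem colon_of_mul (H : AnnihilatesColons (d + 1) x b) (hreg : ∀ c, x d * c = 0 → c = 0) {j k : ℕ}
    (hjk : j ≤ k) (hk : k ≤ d) {c : R} (hc : x k * c ∈ headSpan x j) :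
    c ∈ colonElem (headSpan x j) (x d) :=
  (H.mem_colon_iff hreg hjk hk one_ne_zero).1 (by rwa [pow_one])

theorem colon_of_mul_colon (H : AnnihilatesColons (d + 1) x b) (hreg : ∀ c, x d * c = 0 → c = 0) {j k : ℕ}
    (hjk : j ≤ k) (hk : k ≤ d) {c : R} (hc : x k * c ∈ colonElem (headSpan x j) (x d)) :
    c ∈ colonElem (headSpan x j) (x d) :=
  (H.mem_colon_iff hreg hjk hk two_ne_zero).1 (by
    rw [pow_two, mul_assoc]; exact H.mul_mem_of_colon hreg hjk hk hc)

theorem colon_inf_le (H : AnnihilatesColons (d + 1) x b) (hreg : ∀ c, x d * c = 0 → c = 0) {j : ℕ}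
    (hj : j ≤ d + 1) {a : R} (ha : a ∈ colonElem (headSpan x j) (x d))
    (haq : a ∈ headSpan x (d + 1)) : a ∈ headSpan x j := by
  suffices ∀ k ≤ d + 1, j ≤ k → a ∈ headSpan x k → a ∈ headSpan x j from
    this _ le_rfl hj haq
  intro k hk hjk
  induction k, hjk using Nat.le_induction with
  | base => exact id
  | succ k hjk ih =>
    intro hak
    refine ih (by omega) ?_
    obtain ⟨p, hp, r, hr⟩ := mem_headSpan_succ.1 hak
    have h1 := H.mul_mem_of_colon hreg hjk (by omega) ha
    have h2 : x k * (x k * r) ∈ headSpan x k := by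
      have : x k * (x k * r) = x k * a - x k * p := by rw [hr]; ring
      rw [this]
      exact sub_mem (headSpan_mono x hjk h1) (Ideal.mul_mem_left _ _ hp)
    have h3 := H.ax_head le_rfl le_rfl (by omega : k < d + 1) (n := 2) two_ne_zero
      (H.mem k (by omega)) (c := r) (by rw [pow_two, mul_assoc]; exact h2)
    rw [hr]
    exact add_mem hp h3

theorem mem_sup_mul_span {I q : Ideal R} {y c : R} (h : c ∈ (I ⊔ Ideal.span {y}) * q) :
    ∃ p ∈ I * q, ∃ g ∈ q, c = p + y * g := by
  rw [Ideal.sup_mul, Submodule.mem_sup] at h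
  obtain ⟨p, hp, z, hz, rfl⟩ := h
  obtain ⟨g, hg, rfl⟩ := Ideal.mem_span_singleton_mul.1 hz
  exact ⟨p, hp, g, hg, rfl⟩

theorem headSpan_inf_pow (H : AnnihilatesColons (d + 1) x b) (hreg : ∀ c, x d * c = 0 → c = 0) {j : ℕ}
    (hj : j ≤ d + 1) (n : ℕ) {a : R} (ha : a ∈ headSpan x j)
    (haq : a ∈ headSpan x (d + 1) ^ (n + 1)) : a ∈ headSpan x j * headSpan x (d + 1) ^ n := by
  set q := headSpan x (d + 1) with hq
  revert n a
  induction hj using Nat.decreasingInduction with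
  | self => intro n a _ haq; rwa [← pow_succ']
  | of_succ j hj ih =>
    intro n
    induction n with
    | zero => intro a ha _; simpa using ha
    | succ n ihn =>
      intro a ha haq
      have h1 := ih (n + 1) (headSpan_mono x (Nat.le_succ j) ha) haq
      rw [headSpan_succ] at h1
      obtain ⟨p, hp, g, hg, rfl⟩ := mem_sup_mul_span h1
      have h2 : x j * g ∈ headSpan x j := by
        have := sub_mem ha (Ideal.mul_le_left hp)
        rwa [add_sub_cancel_left] at this
      have h3 : g ∈ headSpan x j :=
        H.colon_inf_le hreg (by omega) (H.colon_of_mul hreg le_rfl (by omega) h2)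
          (Ideal.pow_le_self (Nat.succ_ne_zero n) hg)
      have h4 := ihn h3 hg
      refine add_mem hp ?_
      have h5 := Ideal.mul_mem_mul h4 (mem_headSpan x (by omega : j < d + 1))
      rwa [mul_assoc, ← pow_succ, mul_comm g] at h5

theorem colon_add_pow (H : AnnihilatesColons (d + 1) x b) (hreg : ∀ c, x d * c = 0 → c = 0) {j : ℕ}
    (hj : j ≤ d) (n : ℕ) :
    colonElem (headSpan x j ⊔ headSpan x (d + 1) ^ (n + 1)) (x j) =
      colonElem (headSpan x j) (x d) ⊔ headSpan x (d + 1) ^ n := by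
  apply le_antisymm
  · intro c hc
    rw [mem_colonElem] at hc
    obtain ⟨p, hp, s, hs, hps⟩ := Submodule.mem_sup.1 hc
    have h1 : s ∈ headSpan x (j + 1) :=
      mem_headSpan_succ.2 ⟨-p, neg_mem hp, c, by linear_combination hps⟩
    have h2 := H.headSpan_inf_pow hreg (by omega) n h1 hs
    rw [headSpan_succ] at h2
    obtain ⟨p', hp', g, hg, rfl⟩ := mem_sup_mul_span h2
    have h3 : x j * (c - g) ∈ headSpan x j := by
      have : x j * (c - g) = p + p' := by linear_combination -hps
      rw [this]
      exact add_mem hp (Ideal.mul_le_left hp')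
    have := H.colon_of_mul hreg le_rfl hj h3
    rw [← sub_add_cancel c g]
    exact Submodule.add_mem_sup this hg
  · refine sup_le (fun c hc => ?_) (fun c hc => ?_)
    · exact Ideal.mem_sup_left (H.mul_mem_of_colon hreg le_rfl hj hc)
    · refine Ideal.mem_sup_right ?_
      rw [pow_succ']
      exact Ideal.mul_mem_mul (mem_headSpan x (by omega)) hc

theorem lift_colon {B m P Q : Ideal R} {y e : R} (hB : ∀ β ∈ B, ∀ c, y * c ∈ Q → β * c ∈ P)
    (he : ∀ α ∈ m, ∃ r, α * e - y * r ∈ Q) {y' : R} (hy' : y' ∈ B * m) :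
    ∃ a, ∀ α ∈ m, ∀ r, α * e - y * r ∈ Q → α * a - y' * r ∈ P := by
  induction hy' using Submodule.mul_induction_on' with
  | mem_mul_mem β hβ β' hβ' =>
    obtain ⟨s, hs⟩ := he β' hβ'
    refine ⟨β * s, fun α _ r hr => ?_⟩
    have : α * (β * s) - β * β' * r = β * (α * s - β' * r) := by ring
    rw [this]
    refine hB β hβ _ ?_
    have : y * (α * s - β' * r) = β' * (α * e - y * r) - α * (β' * e - y * s) := by ring
    rw [this]
    exact sub_mem (Ideal.mul_mem_left _ _ hr) (Ideal.mul_mem_left _ _ hs)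
  | add y₁ _ y₂ _ h₁ h₂ =>
    obtain ⟨a₁, h₁⟩ := h₁
    obtain ⟨a₂, h₂⟩ := h₂
    refine ⟨a₁ + a₂, fun α hα r hr => ?_⟩
    have : α * (a₁ + a₂) - (y₁ + y₂) * r = (α * a₁ - y₁ * r) + (α * a₂ - y₂ * r) := by ring
    rw [this]
    exact add_mem (h₁ α hα r hr) (h₂ α hα r hr)

/-- Socles of `R / (q + U)` lift to socles of `R / q`. -/
theorem socle_lift (H : AnnihilatesColons (d + 1) x b) (hreg : ∀ c, x d * c = 0 → c = 0) {m I : Ideal R}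
    (hxm : ∀ l ≤ d, x l ∈ m) (hb : ∀ l ≤ d, x l ∈ b (l + 1) * m)
    (hI : ∀ c, (∀ α ∈ m, α * c ∈ headSpan x (d + 1)) → c ∈ I) {k : ℕ} (hk : k ≤ d) {e : R}
    (he : ∀ α ∈ m, α * e ∈ colonElem (headSpan x k) (x d) ⊔ headSpan x (d + 1)) :
    e ∈ I ⊔ colonElem (headSpan x k) (x d) := by
  set U := colonElem (headSpan x k) (x d)
  suffices ∀ l, k ≤ l → l ≤ d + 1 → ∀ e, (∀ α ∈ m, α * e ∈ U ⊔ headSpan x l) → e ∈ I ⊔ U from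
    this (d + 1) (by omega) le_rfl e he
  intro l hkl
  induction l, hkl using Nat.le_induction with
  | base =>
    intro _ e he
    have hPU : U ⊔ headSpan x k = U := sup_eq_left.2 (le_colonElem _ _)
    rw [hPU] at he
    exact Ideal.mem_sup_right (H.colon_of_mul_colon hreg le_rfl hk (he _ (hxm k hk)))
  | succ l hkl ih =>
    intro hl e he
    have hld : l ≤ d := by omega
    have he' : ∀ α ∈ m, ∃ r, α * e - x l * r ∈ U ⊔ headSpan x l := by
      intro α hα
      have := he α hα
      rw [headSpan_succ, ← sup_assoc, mem_sup_span_singleton'] at this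
      obtain ⟨p, hp, r, hr⟩ := this
      exact ⟨r, by rw [hr, add_sub_cancel_right]; exact hp⟩
    have hB : ∀ β ∈ b (l + 1), ∀ c, x l * c ∈ U ⊔ headSpan x l → β * c ∈ headSpan x l := by
      intro β hβ c hc
      refine H.ax_head le_rfl le_rfl (by omega) (n := 2) two_ne_zero hβ ?_
      rw [pow_two, mul_assoc]
      obtain ⟨u, hu, p, hp, hup⟩ := Submodule.mem_sup.1 hc
      rw [← hup, mul_add]
      exact add_mem (headSpan_mono x hkl (H.mul_mem_of_colon hreg hkl hld hu))
        (Ideal.mul_mem_left _ _ hp)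
    obtain ⟨a, ha⟩ := lift_colon hB he' (hb l hld)
    have haI : a ∈ I := by
      refine hI a fun α hα => ?_
      obtain ⟨r, hr⟩ := he' α hα
      rw [← sub_add_cancel (α * a) (x l * r)]
      exact add_mem (headSpan_mono x (by omega) (ha α hα r hr))
        (Ideal.mul_mem_right _ _ (mem_headSpan x (by omega)))
    have h1 := ih (by omega) (e - a) fun α hα => by
      obtain ⟨r, hr⟩ := he' α hα
      have : α * (e - a) = (α * e - x l * r) - (α * a - x l * r) := by ring
      rw [this]
      exact sub_mem hr (Ideal.mem_sup_right (ha α hα r hr))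
    rw [← sub_add_cancel e a]
    exact add_mem h1 (Ideal.mem_sup_left haI)

theorem mem_headSpan_mul_socle (H : AnnihilatesColons (d + 1) x b) (hreg : ∀ c, x d * c = 0 → c = 0)
    {m I : Ideal R}
    (hxm : ∀ l ≤ d, x l ∈ m) (hb : ∀ l ≤ d, x l ∈ b (l + 1) * m)
    (hI : ∀ c, c ∈ I ↔ ∀ α ∈ m, α * c ∈ headSpan x (d + 1)) {k : ℕ} (hk : k ≤ d + 1) {t : R}
    (ht : t ∈ headSpan x k) (hmt : ∀ α ∈ m, α * t ∈ headSpan x k * headSpan x (d + 1)) :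
    t ∈ headSpan x k * I := by
  set q := headSpan x (d + 1) with hq
  induction k generalizing t with
  | zero =>
    rw [headSpan_zero, Ideal.mem_bot] at ht
    rw [ht]; exact zero_mem _
  | succ k ih =>
    obtain ⟨t', ht', c, rfl⟩ := mem_headSpan_succ.1 ht
    have hc : c ∈ I ⊔ colonElem (headSpan x k) (x d) := by
      refine H.socle_lift hreg hxm hb (fun c hc => (hI c).2 hc) (by omega) fun α hα => ?_
      have := hmt α hα
      rw [headSpan_succ] at this
      obtain ⟨p, hp, g, hg, h⟩ := mem_sup_mul_span this
      have h1 : x k * (α * c - g) ∈ headSpan x k := by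
        have : x k * (α * c - g) = p - α * t' := by linear_combination h
        rw [this]
        exact sub_mem (Ideal.mul_le_left hp) (Ideal.mul_mem_left _ _ ht')
      have h2 := H.colon_of_mul hreg le_rfl (by omega) h1
      rw [← sub_add_cancel (α * c) g]
      exact Submodule.add_mem_sup h2 hg
    obtain ⟨i, hi, u, hu, rfl⟩ := Submodule.mem_sup.1 hc
    have hxk : x k ∈ headSpan x (k + 1) := mem_headSpan x (Nat.lt_succ_self k)
    have h1 : t' + x k * u ∈ headSpan x k := by
      exact add_mem ht' (H.mul_mem_of_colon hreg le_rfl (by omega) hu)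
    have h2 := ih (by omega) h1 fun α hα => by
      have h3 : α * (t' + x k * u) ∈ q ^ (1 + 1) := by
        have : α * (t' + x k * u) = α * (t' + x k * (i + u)) - x k * (α * i) := by ring
        rw [this, pow_two]
        exact sub_mem (Ideal.mul_mono_left (headSpan_mono x hk) (hmt α hα))
          (Ideal.mul_mem_mul (headSpan_mono x hk hxk) ((hI i).1 hi α hα))
      have := H.headSpan_inf_pow hreg (by omega) 1 (Ideal.mul_mem_left _ α h1) h3
      rwa [pow_one] at this
    have : t' + x k * (i + u) = (t' + x k * u) + x k * i := by ring
    rw [this]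
    exact add_mem (Ideal.mul_mono_left (headSpan_mono x (Nat.le_succ k)) h2)
      (Ideal.mul_mem_mul hxk hi)

theorem socle_sq_le (H : AnnihilatesColons (d + 1) x b) (hreg : ∀ c, x d * c = 0 → c = 0)
    {m I : Ideal R} (hIm : I ≤ m)
    (hxm : ∀ l ≤ d, x l ∈ m) (hb : ∀ l ≤ d, x l ∈ b (l + 1) * m)
    (hI : ∀ c, c ∈ I ↔ ∀ α ∈ m, α * c ∈ headSpan x (d + 1))
    (hmI : m * I ≤ m * headSpan x (d + 1)) : I ^ 2 ≤ headSpan x (d + 1) * I := by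
  have hqm : headSpan x (d + 1) ≤ m := by
    rw [headSpan, Ideal.span_le]
    rintro _ ⟨a, ha, rfl⟩
    exact hxm a (Nat.lt_succ_iff.1 ha)
  rw [pow_two, Ideal.mul_le]
  intro a ha c hc
  refine H.mem_headSpan_mul_socle hreg hxm hb hI le_rfl ((hI c).1 hc a (hIm ha)) fun α hα => ?_
  have h1 : α * a * c ∈ m * headSpan x (d + 1) * I :=
    Ideal.mul_mem_mul (hmI (Ideal.mul_mem_mul hα ha)) hc
  rw [mul_assoc, mul_comm, mul_assoc, mul_comm I] at h1
  rw [← mul_assoc]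
  refine Ideal.mul_mono_right (fun z hz => ?_) h1
  have := hmI hz
  exact Ideal.mul_le_right this

end AnnihilatesColons

end AnnihilatesColons

section AnnihilatesColons
variable {R : Type u} [CommRing R]

theorem exists_eq_unit_mul_pow [IsLocalRing R] [IsNoetherianRing R] {T : Ideal R} {α a : R}
    (hαm : α ∈ maximalIdeal R) (hα : maximalIdeal R ≤ T ⊔ Ideal.span {α}) (ha : a ∉ T) :
    ∃ s : ℕ, ∃ v : R, IsUnit v ∧ a - α ^ s * v ∈ T := by
  classical
  have hex : ∃ n : ℕ, a ∉ T ⊔ Ideal.span {α ^ (n + 1)} := by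
    by_contra! h
    apply ha
    have hHaus : IsHausdorff (maximalIdeal R) (R ⧸ T) :=
      IsHausdorff.of_isLocalRing _ _ Ideal.IsPrime.ne_top'
    rw [← Submodule.Quotient.mk_eq_zero]
    refine hHaus.haus _ fun n => ?_
    rw [SModEq.zero]
    obtain ⟨p, hp, r, hr⟩ := mem_sup_span_singleton'.1 (h n)
    have h1 : (Submodule.Quotient.mk a : R ⧸ T) = (α ^ (n + 1)) • Submodule.Quotient.mk r := by
      rw [← Submodule.Quotient.mk_smul, Submodule.Quotient.eq, hr]
      simpa using hp
    rw [h1]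
    exact Submodule.smul_mem_smul (Ideal.pow_le_pow_right (Nat.le_succ n)
      (Ideal.pow_mem_pow hαm _)) trivial
  have hmin : ∀ m < Nat.find hex, a ∈ T ⊔ Ideal.span {α ^ (m + 1)} := fun m hm => by
    simpa using Nat.find_min hex hm
  have hspec := Nat.find_spec hex
  set s := Nat.find hex
  have h1 : a ∈ T ⊔ Ideal.span {α ^ s} := by
    rcases Nat.eq_zero_or_pos s with h0 | h0
    · simp [h0]
    · have := hmin (s - 1) (by omega)
      rwa [Nat.sub_add_cancel h0] at this
  obtain ⟨p, hp, v, hv⟩ := mem_sup_span_singleton'.1 h1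
  refine ⟨s, v, ?_, by rw [hv]; simpa using hp⟩
  by_contra hu
  have h2 := hα ((mem_maximalIdeal v).2 hu)
  obtain ⟨p', hp', r, hr⟩ := mem_sup_span_singleton'.1 h2
  apply hspec
  rw [mem_sup_span_singleton']
  exact ⟨p + α ^ s * p', add_mem hp (Ideal.mul_mem_left _ _ hp'), r, by rw [hv, hr]; ring⟩

theorem mem_mul_span_or [IsLocalRing R] {x : ℕ → R} {S : Finset ℕ} {c : R}
    (hc : c ∈ Ideal.span (x '' S)) : c ∈ maximalIdeal R * Ideal.span (x '' S) ∨
      ∃ j ∈ S, ∃ v, IsUnit v ∧ c - v * x j ∈ Ideal.span (x '' (S \ {j})) := by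
  classical
  obtain ⟨f, hf⟩ := (Submodule.mem_span_image_finset_iff_exists_fun' R).1 hc
  by_cases h : ∃ j ∈ S, IsUnit (f j)
  · obtain ⟨j, hj, hu⟩ := h
    refine Or.inr ⟨j, hj, f j, hu, ?_⟩
    rw [← hf, ← Finset.add_sum_erase S _ hj, smul_eq_mul, add_sub_cancel_left]
    refine sum_mem fun i hi => Ideal.mul_mem_left _ _ (Ideal.subset_span ⟨i, ?_, rfl⟩)
    simpa [and_comm] using hi
  · push Not at h
    left
    rw [← hf]
    exact sum_mem fun i hi => Ideal.mul_mem_mul ((mem_maximalIdeal _).2 (h i hi))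
      (Ideal.subset_span ⟨i, hi, rfl⟩)

theorem pow_sub_pow_mem {I : Ideal R} {a c : R} (h : a - c ∈ I) (n : ℕ) : a ^ n - c ^ n ∈ I :=
  I.mem_of_dvd (sub_dvd_pow_sub_pow a c n) h

namespace AnnihilatesColons

variable {d : ℕ} {x : ℕ → R} {b : ℕ → Ideal R}

theorem mem_colon_sup_of_sq (H : AnnihilatesColons (d + 1) x b) {i : ℕ} (hi : i < d) {u : R}
    (hu : x d ^ 2 * u ∈ headSpan x i ⊔ Ideal.span {x i ^ 2}) :
    u ∈ colonElem (headSpan x i) (x d) ⊔ Ideal.span {x i} := by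
  have h1 := H.ax_head_pow hi (Nat.lt_succ_self d) two_ne_zero two_ne_zero hu
  obtain ⟨p, hp, k, hk⟩ := mem_sup_span_singleton'.1 h1
  have h2 : x i ^ 2 * k ∈ headSpan x i ⊔ Ideal.span {x d} :=
    mem_sup_span_singleton'.2 ⟨-p, neg_mem hp, u, by linear_combination -hk⟩
  have h3 := H.ax_head_last le_rfl le_rfl hi two_ne_zero h2
  obtain ⟨p', hp', l, hl⟩ := mem_sup_span_singleton'.1 h3
  refine mem_sup_span_singleton'.2 ⟨u - x i * l, ?_, l, by ring⟩
  have : x d * (u - x i * l) = p + x i * p' := by linear_combination hk + x i * hl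
  rw [mem_colonElem, this]
  exact add_mem hp (Ideal.mul_mem_left _ _ hp')

theorem colon_mono {i j : ℕ} (h : i ≤ j) :
    colonElem (headSpan x i) (x d) ≤ colonElem (headSpan x j) (x d) :=
  fun _ hc => headSpan_mono x h hc

theorem colon_le_descend (H : AnnihilatesColons (d + 1) x b) (hreg : ∀ c, x d * c = 0 → c = 0) {i : ℕ}
    (hi : i + 1 < d)
    (h : colonElem (headSpan x (i + 2)) (x d) ≤
      colonElem (headSpan x (i + 1)) (x d) ⊔ Ideal.span {x (i + 1)}) :
    colonElem (headSpan x (i + 1)) (x d) ≤ colonElem (headSpan x i) (x d) ⊔ Ideal.span {x i} := by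
  intro u hu
  obtain ⟨p, hp, f, hf⟩ := mem_headSpan_succ.1 (mem_colonElem.1 hu)
  obtain ⟨p', hp', g, hg⟩ := mem_headSpan_succ.1 (H.mul_mem_of_colon hreg le_rfl hi.le hu)
  have h1 : x (i + 1) * f - x d * g ∈ colonElem (headSpan x i) (x d) := by
    refine H.colon_of_mul hreg (k := i) le_rfl (by omega) ?_
    have : x i * (x (i + 1) * f - x d * g) = x d * p' - x (i + 1) * p := by
      linear_combination x d * hg - x (i + 1) * hf
    rw [this]
    exact sub_mem (Ideal.mul_mem_left _ _ hp') (Ideal.mul_mem_left _ _ hp)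
  have hgU : g ∈ colonElem (headSpan x (i + 2)) (x d) := by
    refine (H.mem_colon_iff hreg (k := d) (n := 2) (by omega) le_rfl two_ne_zero).1 ?_
    have : x d ^ 2 * g = x (i + 1) * (x d * f) - x d * (x (i + 1) * f - x d * g) := by ring
    rw [this]
    exact sub_mem (Ideal.mul_mem_right _ _ (mem_headSpan x (by omega)))
      (headSpan_mono x (by omega) h1)
  obtain ⟨u', hu', r, rfl⟩ := mem_sup_span_singleton'.1 (h hgU)
  obtain ⟨p₂, hp₂, f', hf'⟩ := mem_headSpan_succ.1 (mem_colonElem.1 hu')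
  set u₁ := u - x i * r with hu₁
  set f₁ := f - x d * r with hf₁
  have e1 : x (i + 1) * u₁ = x i * u' + p' := by rw [hu₁]; linear_combination hg
  have e2 : x d * u₁ = x i * f₁ + p := by rw [hu₁, hf₁]; linear_combination hf
  have h2 : x (i + 1) * f₁ - x i * f' ∈ colonElem (headSpan x i) (x d) := by
    refine H.colon_of_mul hreg (k := i) le_rfl (by omega) ?_
    have : x i * (x (i + 1) * f₁ - x i * f') = x d * p' + x i * p₂ - x (i + 1) * p := by
      linear_combination (-x (i + 1)) * e2 + x d * e1 + x i * hf'
    rw [this]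
    exact sub_mem (add_mem (Ideal.mul_mem_left _ _ hp') (Ideal.mul_mem_left _ _ hp₂))
      (Ideal.mul_mem_left _ _ hp)
  have hf₁U : f₁ ∈ colonElem (headSpan x (i + 1)) (x d) := by
    refine (H.mem_colon_iff hreg (k := i + 1) (n := 2) le_rfl hi.le two_ne_zero).1 ?_
    have : x (i + 1) ^ 2 * f₁ =
      x (i + 1) * (x (i + 1) * f₁ - x i * f') + x i * (x (i + 1) * f') := by ring
    rw [this]
    exact add_mem (headSpan_mono x (Nat.le_succ i) (H.mul_mem_of_colon hreg (by omega) hi.le h2))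
      (Ideal.mul_mem_right _ _ (mem_headSpan x (Nat.lt_succ_self i)))
  obtain ⟨p₃, hp₃, k, hk⟩ := mem_headSpan_succ.1 (mem_colonElem.1 hf₁U)
  have h3 : u₁ ∈ colonElem (headSpan x i) (x d) ⊔ Ideal.span {x i} := by
    refine H.mem_colon_sup_of_sq (by omega) (mem_sup_span_singleton'.2
      ⟨x i * p₃ + x d * p, add_mem (Ideal.mul_mem_left _ _ hp₃) (Ideal.mul_mem_left _ _ hp), k, ?_⟩)
    linear_combination x d * e2 + x i * hk
  rw [← sub_add_cancel u (x i * r)]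
  exact add_mem h3 (Ideal.mem_sup_right (Ideal.mul_mem_right _ _ (Ideal.mem_span_singleton_self _)))

theorem colon_eq_of_le (H : AnnihilatesColons (d + 2) x b) (hreg : ∀ c, x (d + 1) * c = 0 → c = 0)
    (h : colonElem (headSpan x (d + 1)) (x (d + 1)) ≤
      colonElem (headSpan x d) (x (d + 1)) ⊔ Ideal.span {x d}) {j : ℕ} (hj : j ≤ d + 1) :
    colonElem (headSpan x j) (x (d + 1)) = headSpan x j := by
  have hstep : ∀ i ≤ d, colonElem (headSpan x (i + 1)) (x (d + 1)) ≤
      colonElem (headSpan x i) (x (d + 1)) ⊔ Ideal.span {x i} := by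
    intro i hi
    induction hi using Nat.decreasingInduction with
    | self => exact h
    | of_succ k hk ih => exact H.colon_le_descend hreg (by omega) ih
  refine le_antisymm ?_ (le_colonElem _ _)
  induction j with
  | zero =>
    intro c hc
    rw [mem_colonElem, headSpan_zero, Ideal.mem_bot] at hc
    rw [hreg c hc]; exact zero_mem _
  | succ j ih =>
    refine (hstep j (by omega)).trans ?_
    rw [headSpan_succ]
    exact sup_le_sup_right (ih (by omega)) _

variable [IsLocalRing R] [IsNoetherianRing R]

theorem mul_mem_of_mul_mem_headSpan (H : AnnihilatesColons (d + 1) x b)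
    (hxd : x d ∈ maximalIdeal R) (hdim : ∀ n, x d ^ n ∉ headSpan x d) {e : R}
    (he : ∀ α ∈ maximalIdeal R, α * e ∈ headSpan x d) {α : R} (hα : α ∈ maximalIdeal R) :
    α * e ∈ maximalIdeal R * headSpan x d := by
  have hP : headSpan x d = Ideal.span (x '' (Finset.range d : Set ℕ)) := by
    simp [headSpan]
  by_contra hcon
  have := he α hα
  rw [hP] at this hcon
  obtain ⟨j, hj, v, hv, hz⟩ := (mem_mul_span_or this).resolve_left hcon
  set S : Set ℕ := (Finset.range d : Set ℕ) \ {j} with hS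
  have hjd : j < d := by simpa using hj
  have hPS : headSpan x d = powSpan x S (fun _ => 1) ⊔ Ideal.span {x j} := by
    rw [powSpan, headSpan, ← Set.image_singleton (f := x), ← Ideal.span_union]
    simp only [pow_one]
    rw [← Set.image_union]
    congr 2
    ext a
    simp only [hS, Set.mem_Iio, Set.mem_union, Set.mem_sdiff, Finset.coe_range,
      Set.mem_singleton_iff]
    by_cases h : a = j
    · simp [h, hjd]
    · simp [h]
  have hz' : α * e - v * x j ∈ powSpan x S (fun _ => 1) := by simpa [powSpan] using hz
  set Z := powSpan x S (fun _ => 1) with hZ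
  have hZP : Z ≤ headSpan x d := hPS ▸ le_sup_left
  have key : ∀ c, x j * c ∈ Z → x d * c ∈ Z := fun c hc =>
    H.ax_bot (l := d + 1) le_rfl (S := S) (fun a ha => by
      simp only [hS, Set.mem_sdiff, Finset.coe_range, Set.mem_Iio] at ha ⊢; omega)
      (i := j) (by omega) (by simp [hS]) (by simp) (n := 1) one_ne_zero (H.mem d (by omega))
      (by rwa [pow_one])
  set T := colonElem Z (x d) with hT
  have hαT : maximalIdeal R ≤ T ⊔ Ideal.span {α} := by
    intro γ hγ
    have h1 := he γ hγ
    rw [hPS, mem_sup_span_singleton'] at h1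
    obtain ⟨z, hzZ, g, hg⟩ := h1
    obtain ⟨v', hv'⟩ := hv.exists_right_inv
    have h2 : (v * γ - α * g) * e ∈ Z := by
      have : (v * γ - α * g) * e = v * z - g * (α * e - v * x j) := by linear_combination v * hg
      rw [this]
      exact sub_mem (Ideal.mul_mem_left _ _ hzZ) (Ideal.mul_mem_left _ _ hz')
    have h3 : x j * (v * γ - α * g) ∈ Z := by
      have : x j * (v * γ - α * g) = v' * (α * ((v * γ - α * g) * e) -
          (v * γ - α * g) * (α * e - v * x j)) := by
        linear_combination (-x j * (v * γ - α * g)) * hv'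
      rw [this]
      exact Ideal.mul_mem_left _ _ (sub_mem (Ideal.mul_mem_left _ _ h2)
        (Ideal.mul_mem_left _ _ hz'))
    refine mem_sup_span_singleton'.2 ⟨v' * (v * γ - α * g), Ideal.mul_mem_left _ _ (key _ h3),
      v' * g, ?_⟩
    linear_combination (-γ) * hv'
  have hwT : x d ∉ T := fun h => hdim 2 (hZP (by rw [pow_two]; exact h))
  have hjT : x j ∉ T := fun h => hwT (key _ (by
    rw [mul_comm]; exact h))
  obtain ⟨s, a, ha, has⟩ := exists_eq_unit_mul_pow hα hαT hwT
  obtain ⟨s', a', ha', has'⟩ := exists_eq_unit_mul_pow hα hαT hjT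
  have hs0 : s ≠ 0 := by
    rintro rfl
    have hu : IsUnit (x d - a) := by
      by_contra hu
      refine (mem_maximalIdeal a).1 ?_ ha
      rw [← sub_sub_cancel (x d) a]
      exact sub_mem hxd ((mem_maximalIdeal _).2 hu)
    rw [pow_zero, one_mul] at has
    exact hwT ((Ideal.eq_top_of_isUnit_mem _ has hu) ▸ trivial)
  have h4 : x d ^ s' * a' ^ s - x j ^ s * a ^ s' ∈ T := by
    rw [← Ideal.Quotient.eq] at has has' ⊢
    simp only [map_mul, map_pow] at has has' ⊢
    rw [has, has']
    ring
  rw [hT, mem_colonElem] at h4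
  have h5 : x d ^ (s' + 1) * a' ^ s ∈ headSpan x d := by
    obtain ⟨t, rfl⟩ := Nat.exists_eq_succ_of_ne_zero hs0
    have : x d ^ (s' + 1) * a' ^ (t + 1) = x d * (x d ^ s' * a' ^ (t + 1) - x j ^ (t + 1) * a ^ s')
      + x j * (x d * x j ^ t * a ^ s') := by ring
    rw [this]
    exact add_mem (hZP h4) (Ideal.mul_mem_right _ _ (mem_headSpan x hjd))
  exact hdim _ ((Ideal.mul_unit_mem_iff_mem _ (ha'.pow s)).1 h5)

theorem colon_le_of_unit (H : AnnihilatesColons (d + 2) x b) (hreg : ∀ c, x (d + 1) * c = 0 → c = 0)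
    (hdim : ∀ n, x (d + 1) ^ n ∉ headSpan x (d + 1)) {a α r : R}
    (ha : ∀ γ ∈ maximalIdeal R, γ * a ∈ headSpan x (d + 2)) (hα : α ∈ maximalIdeal R)
    (hr : IsUnit r) (har : α * a - x (d + 1) * r ∈ headSpan x (d + 1)) :
    colonElem (headSpan x (d + 1)) (x (d + 1)) ≤
      colonElem (headSpan x d) (x (d + 1)) ⊔ Ideal.span {x d} := by
  set z := x (d + 1) with hz
  set y := x d with hy
  set W := colonElem (headSpan x (d + 1)) z with hW
  have hαW : maximalIdeal R ≤ W ⊔ Ideal.span {α} := by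
    intro γ hγ
    obtain ⟨p, hp, s, hs⟩ := mem_headSpan_succ.1 (ha γ hγ)
    obtain ⟨r', hr'⟩ := hr.exists_right_inv
    refine mem_sup_span_singleton'.2 ⟨r' * (γ * r - α * s), Ideal.mul_mem_left _ _ ?_, r' * s, ?_⟩
    · have : z * (γ * r - α * s) = α * p - γ * (α * a - z * r) := by
        linear_combination α * hs
      rw [hW, mem_colonElem, this]
      exact sub_mem (Ideal.mul_mem_left _ _ hp) (Ideal.mul_mem_left _ _ har)
    · linear_combination (-γ) * hr'
  have hzW : z ∉ W := fun h => hdim 2 (by rw [pow_two]; exact h)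
  have hunit : ∀ v, IsUnit v → v ∉ W := fun v hv hvW =>
    hzW ((Ideal.eq_top_of_isUnit_mem _ hvW hv) ▸ trivial)
  have hzreg : ∀ c, z * c ∈ W → c ∈ W := fun c hc =>
    H.colon_of_mul_colon hreg (j := d + 1) (k := d + 1) le_rfl le_rfl hc
  intro u hu
  obtain ⟨p, hp, f, hf⟩ := mem_headSpan_succ.1 (mem_colonElem.1 hu)
  have hfW : f ∈ W ⊔ Ideal.span {z} := by
    by_cases hfW : f ∈ W
    · exact Ideal.mem_sup_left hfW
    obtain ⟨s, v, hv, hvs⟩ := exists_eq_unit_mul_pow hα hαW hfW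
    obtain ⟨t, v', hv', hvt⟩ := exists_eq_unit_mul_pow hα hαW hzW
    rcases le_or_gt t s with hts | hst
    · obtain ⟨w', hw'⟩ := hv'.exists_right_inv
      obtain ⟨k, rfl⟩ := Nat.exists_eq_add_of_le hts
      refine mem_sup_span_singleton'.2 ⟨(f - α ^ (t + k) * v) - α ^ k * v * w' * (z - α ^ t * v'),
        sub_mem hvs (Ideal.mul_mem_left _ _ hvt), α ^ k * v * w', ?_⟩
      linear_combination (-α ^ (t + k) * v) * hw'
    · exfalso
      have hαreg : ∀ c, α * c ∈ W → c ∈ W := by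
        intro c hc
        apply hzreg
        obtain ⟨k, rfl⟩ := Nat.exists_eq_add_of_lt hst
        have : z * c = c * (z - α ^ (s + k + 1) * v') + α ^ (s + k) * v' * (α * c) := by ring
        rw [this]
        exact add_mem (Ideal.mul_mem_left _ _ hvt) (Ideal.mul_mem_left _ _ hc)
      have hαreg' : ∀ k c, α ^ k * c ∈ W → c ∈ W := by
        intro k
        induction k with
        | zero => intro c hc; simpa using hc
        | succ k ih => intro c hc; exact hαreg c (ih _ (by rwa [← mul_assoc, ← pow_succ]))
      have h1 : (z * u) ^ (s + 2) - (y * f) ^ (s + 2) ∈ headSpan x d :=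
        pow_sub_pow_mem (by rw [hf, add_sub_cancel_right]; exact hp) _
      have h2 : z ^ (s + 2) * u ^ (s + 2) ∈ headSpan x d ⊔ Ideal.span {y ^ (s + 2)} :=
        mem_sup_span_singleton'.2 ⟨_, h1, f ^ (s + 2), by ring⟩
      have h3 := H.ax_head_pow (j := d) (k := d + 1) (by omega) (by omega) (by omega) (by omega) h2
      obtain ⟨p', hp', g, hg⟩ := mem_sup_span_singleton'.1 h3
      have h4 : f ^ (s + 2) - z ^ (s + 1) * g ∈ W := by
        refine colon_mono (Nat.le_succ d) ((H.mem_colon_iff hreg (j := d) (k := d) (n := s + 2)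
          le_rfl (by omega) (by omega)).1 ?_)
        have : x d ^ (s + 2) * (f ^ (s + 2) - z ^ (s + 1) * g) = z ^ (s + 1) * p' -
            ((z * u) ^ (s + 2) - (y * f) ^ (s + 2)) := by
          rw [← hy, ← hz] at *
          linear_combination z ^ (s + 1) * hg
        rw [this]
        exact sub_mem (Ideal.mul_mem_left _ _ hp') h1
      obtain ⟨k, rfl⟩ := Nat.exists_eq_add_of_lt hst
      have h5 : α ^ (s * (s + 2)) * (v ^ (s + 2) - α * (α ^ (k * (s + 1)) * v' ^ (s + 1) * g))
          ∈ W := by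
        rw [← Ideal.Quotient.eq_zero_iff_mem] at h4 ⊢
        rw [← Ideal.Quotient.eq] at hvs hvt
        simp only [map_mul, map_pow, map_sub] at hvs hvt h4 ⊢
        rw [hvs, hvt] at h4
        rw [← h4]
        ring
      have h6 := hαreg' _ _ h5
      refine hunit _ ?_ h6
      by_contra hcon
      have h7 := (mem_maximalIdeal _).2 hcon
      have h8 := add_mem h7 (Ideal.mul_mem_right (α ^ (k * (s + 1)) * v' ^ (s + 1) * g) _ hα)
      rw [sub_add_cancel] at h8
      exact (mem_maximalIdeal _).1 h8 (hv.pow _)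
  obtain ⟨u', hu', r', rfl⟩ := mem_sup_span_singleton'.1 hfW
  obtain ⟨p', hp', f', hf'⟩ := mem_headSpan_succ.1 (mem_colonElem.1 hu')
  have h3 : u - y * r' ∈ colonElem (headSpan x d) z ⊔ Ideal.span {y} := by
    refine H.mem_colon_sup_of_sq (by omega) (mem_sup_span_singleton'.2
      ⟨z * p + y * p', add_mem (Ideal.mul_mem_left _ _ hp) (Ideal.mul_mem_left _ _ hp'), f', ?_⟩)
    linear_combination z * hf + y * hf'
  rw [← sub_add_cancel u (y * r')]
  exact add_mem h3 (Ideal.mem_sup_right (Ideal.mul_mem_right _ _ (Ideal.mem_span_singleton_self _)))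

theorem mul_socle_le_or (H : AnnihilatesColons (d + 2) x b) (hreg : ∀ c, x (d + 1) * c = 0 → c = 0)
    (hxm : ∀ l ≤ d + 1, x l ∈ maximalIdeal R)
    (hdim : ∀ n, x (d + 1) ^ n ∉ headSpan x (d + 1)) (hbm : b (d + 2) ≤ maximalIdeal R)
    (hb3 : x (d + 1) ∈ b (d + 2) ^ 3) {I : Ideal R}
    (hI : ∀ c ∈ I, ∀ α ∈ maximalIdeal R, α * c ∈ headSpan x (d + 2)) :
    maximalIdeal R * I ≤ maximalIdeal R * headSpan x (d + 2) ∨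
    colonElem (headSpan x (d + 1)) (x (d + 1)) ≤
      colonElem (headSpan x d) (x (d + 1)) ⊔ Ideal.span {x d} := by
  by_cases h : ∃ a ∈ I, ∃ α ∈ maximalIdeal R, ∃ r, IsUnit r ∧
      α * a - x (d + 1) * r ∈ headSpan x (d + 1)
  · obtain ⟨a, ha, α, hα, r, hr, har⟩ := h
    exact Or.inr (H.colon_le_of_unit hreg hdim (hI a ha) hα hr har)
  push Not at h
  left
  rw [Ideal.mul_le]
  intro α₀ hα₀ a ha
  have he : ∀ α ∈ maximalIdeal R, ∃ r, α * a - x (d + 1) * r ∈ headSpan x (d + 1) := by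
    intro α hα
    obtain ⟨p, hp, r, hr⟩ := mem_headSpan_succ.1 (hI a ha α hα)
    exact ⟨r, by rw [hr, add_sub_cancel_right]; exact hp⟩
  have hB : ∀ β ∈ b (d + 2) * b (d + 2), ∀ c, x (d + 1) * c ∈ headSpan x (d + 1) →
      β * c ∈ maximalIdeal R * headSpan x (d + 1) := by
    intro β hβ c hc
    induction hβ using Submodule.mul_induction_on' with
    | mem_mul_mem β hβ β' hβ' =>
      rw [mul_assoc]
      exact Ideal.mul_mem_mul (hbm hβ) (H.ax_head le_rfl le_rfl (by omega) one_ne_zero hβ'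
        (by rwa [pow_one]))
    | add _ _ _ _ h₁ h₂ => rw [add_mul]; exact add_mem h₁ h₂
  have hmem : x (d + 1) ∈ b (d + 2) * b (d + 2) * maximalIdeal R := by
    rw [pow_succ, pow_two] at hb3
    exact Ideal.mul_mono_right hbm hb3
  obtain ⟨a', ha'⟩ := lift_colon hB he hmem
  have h1 : ∀ α ∈ maximalIdeal R, α * (a - a') ∈ headSpan x (d + 1) := by
    intro α hα
    obtain ⟨r, hr⟩ := he α hα
    have : α * (a - a') = (α * a - x (d + 1) * r) - (α * a' - x (d + 1) * r) := by ring
    rw [this]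
    exact sub_mem hr (Ideal.mul_le_right (ha' α hα r hr))
  have h2 := H.mul_mem_of_mul_mem_headSpan (hxm _ le_rfl) hdim h1 hα₀
  obtain ⟨r, hr⟩ := he α₀ hα₀
  have hrm : r ∈ maximalIdeal R := by
    rw [mem_maximalIdeal, mem_nonunits_iff]
    exact fun hru => h a ha α₀ hα₀ r hru hr
  have : α₀ * a = (α₀ * (a - a') + (α₀ * a' - x (d + 1) * r)) + r * x (d + 1) := by ring
  rw [this]
  exact add_mem (Ideal.mul_mono_right (headSpan_mono x (by omega)) (add_mem h2 (ha' _ hα₀ r hr)))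
    (Ideal.mul_mem_mul hrm (mem_headSpan x (by omega)))

end AnnihilatesColons

end AnnihilatesColons

section Lengths

variable {R : Type u} [CommRing R] [IsLocalRing R]

/-- An ideal containing a power of the maximal ideal. -/
def IsCofin (K : Ideal R) : Prop := ∃ t, maximalIdeal R ^ t ≤ K

/-- The length of `R ⧸ K` as a natural number. -/
noncomputable def colength (K : Ideal R) : ℕ := (Module.length R (R ⧸ K)).toNat

theorem IsCofin.mono {K K' : Ideal R} (h : IsCofin K) (hle : K ≤ K') : IsCofin K' :=
  h.imp fun _ ht => ht.trans hle

theorem IsCofin.mul {K K' : Ideal R} (h : IsCofin K) (h' : IsCofin K') : IsCofin (K * K') := by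
  obtain ⟨s, hs⟩ := h
  obtain ⟨t, ht⟩ := h'
  exact ⟨s + t, by rw [pow_add]; exact Ideal.mul_mono hs ht⟩

theorem IsCofin.pow {K : Ideal R} (h : IsCofin K) (n : ℕ) : IsCofin (K ^ n) := by
  obtain ⟨s, hs⟩ := h
  exact ⟨s * n, by rw [pow_mul]; exact Ideal.pow_right_mono hs n⟩

theorem IsCofin.inf {K K' : Ideal R} (h : IsCofin K) (h' : IsCofin K') : IsCofin (K ⊓ K') :=
  (h.mul h').mono Ideal.mul_le_inf

theorem isCofin_of_isFiniteLength {K : Ideal R} (h : IsFiniteLength R (R ⧸ K)) : IsCofin K := by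
  have : IsArtinianRing (R ⧸ K) := by
    rw [← Module.length_ne_top_iff, Module.length_eq_of_surjective (R := R ⧸ K) (S := R)
      (M := R ⧸ K) Ideal.Quotient.mk_surjective, Module.length_ne_top_iff] at h
    exact (isFiniteLength_iff_isNoetherian_isArtinian.1 h).2
  exact exists_maximalIdeal_pow_le_of_isArtinianRing_quotient K

variable [IsNoetherianRing R]

theorem IsCofin.isFiniteLength {K : Ideal R} (h : IsCofin K) : IsFiniteLength R (R ⧸ K) := by
  by_cases hK : K = ⊤
  · subst hK
    have : Subsingleton (R ⧸ (⊤ : Ideal R)) := Ideal.Quotient.subsingleton_iff.2 rfl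
    exact .of_subsingleton
  have : Nontrivial (R ⧸ K) := Ideal.Quotient.nontrivial_iff.mpr hK
  have := IsLocalRing.of_surjective' (Ideal.Quotient.mk K) Ideal.Quotient.mk_surjective
  have hmap : (maximalIdeal R).map (Ideal.Quotient.mk K) = maximalIdeal (R ⧸ K) := by
    have := IsLocalHom.of_surjective (Ideal.Quotient.mk K) Ideal.Quotient.mk_surjective
    ext x
    obtain ⟨x, rfl⟩ := Ideal.Quotient.mk_surjective x
    simp [sup_eq_left.mpr (le_maximalIdeal hK)]
  have hart : IsArtinianRing (R ⧸ K) := by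
    rw [isArtinianRing_iff_isNilpotent_maximalIdeal, ← hmap]
    obtain ⟨t, ht⟩ := h
    refine ⟨t, ?_⟩
    rw [← Ideal.map_pow, Ideal.zero_eq_bot, Ideal.map_eq_bot_iff_le_ker, Ideal.mk_ker]
    exact ht
  rw [← Module.length_ne_top_iff, Module.length_eq_of_surjective (R := R ⧸ K) (S := R) (M := R ⧸ K)
    Ideal.Quotient.mk_surjective]
  exact Module.length_ne_top

theorem IsCofin.length_eq {K : Ideal R} (h : IsCofin K) :
    Module.length R (R ⧸ K) = colength K :=
  (ENat.natCast_toNat (Module.length_ne_top_iff.2 h.isFiniteLength)).symm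

theorem colength_sup_add_colength_inf {A B : Ideal R} (hA : IsCofin A) (hB : IsCofin B) :
    colength (A ⊓ B) + colength (A ⊔ B) = colength A + colength B := by
  let f : (R ⧸ (A ⊓ B)) →ₗ[R] (R ⧸ A) × (R ⧸ B) :=
    LinearMap.prod (Submodule.factor inf_le_left) (Submodule.factor inf_le_right)
  let g : ((R ⧸ A) × (R ⧸ B)) →ₗ[R] (R ⧸ (A ⊔ B)) :=
    LinearMap.coprod (Submodule.factor le_sup_left) (-(Submodule.factor le_sup_right))
  have hf : Function.Injective f := by
    rw [injective_iff_map_eq_zero]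
    intro a ha
    obtain ⟨a, rfl⟩ := Submodule.Quotient.mk_surjective _ a
    have h1 : (Submodule.Quotient.mk a : R ⧸ A) = 0 := congrArg Prod.fst ha
    have h2 : (Submodule.Quotient.mk a : R ⧸ B) = 0 := congrArg Prod.snd ha
    rw [Submodule.Quotient.mk_eq_zero] at h1 h2 ⊢
    exact ⟨h1, h2⟩
  have hg : Function.Surjective g := by
    intro a
    obtain ⟨a, rfl⟩ := Submodule.Quotient.mk_surjective _ a
    exact ⟨(Submodule.Quotient.mk a, 0), by simp [g]⟩
  have hfg : Function.Exact f g := by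
    rintro ⟨a, b⟩
    obtain ⟨a, rfl⟩ := Submodule.Quotient.mk_surjective _ a
    obtain ⟨b, rfl⟩ := Submodule.Quotient.mk_surjective _ b
    constructor
    · intro h
      have h' : (Submodule.Quotient.mk (a - b) : R ⧸ (A ⊔ B)) = 0 := by
        rw [Submodule.Quotient.mk_sub, sub_eq_add_neg]; exact h
      rw [Submodule.Quotient.mk_eq_zero, Submodule.mem_sup] at h'
      obtain ⟨p, hp, r, hr, hpr⟩ := h'
      refine ⟨Submodule.Quotient.mk (a - p), Prod.ext ?_ ?_⟩
      · refine (Submodule.Quotient.eq A).2 ?_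
        simpa using hp
      · refine (Submodule.Quotient.eq B).2 ?_
        have : a - p - b = r := by linear_combination -hpr
        change a - p - b ∈ B
        rw [this]; exact hr
    · rintro ⟨c, hc⟩
      obtain ⟨c, rfl⟩ := Submodule.Quotient.mk_surjective _ c
      rw [← hc]
      change (Submodule.Quotient.mk c : R ⧸ (A ⊔ B)) + -(Submodule.Quotient.mk c) = 0
      simp
  have := Module.length_eq_add_of_exact f g hf hg hfg
  rw [Module.length_prod, hA.length_eq, hB.length_eq, (hA.inf hB).length_eq,
    (hA.mono le_sup_left).length_eq] at this
  exact_mod_cast this.symm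

theorem colength_eq_add_colonElem {K : Ideal R} (hK : IsCofin K) (y : R) :
    colength K = colength (K ⊔ Ideal.span {y}) + colength (colonElem K y) := by
  let f : (R ⧸ colonElem K y) →ₗ[R] R ⧸ K :=
    Submodule.mapQ _ _ (LinearMap.lsmul R R y) le_rfl
  let g : (R ⧸ K) →ₗ[R] R ⧸ (K ⊔ Ideal.span {y}) := Submodule.factor le_sup_left
  have hf : Function.Injective f := by
    rw [injective_iff_map_eq_zero]
    intro a ha
    obtain ⟨a, rfl⟩ := Submodule.Quotient.mk_surjective _ a
    have h1 : (Submodule.Quotient.mk (y * a) : R ⧸ K) = 0 := ha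
    rw [Submodule.Quotient.mk_eq_zero] at h1 ⊢
    exact h1
  have hg : Function.Surjective g := Submodule.factor_surjective le_sup_left
  have hfg : Function.Exact f g := by
    intro a
    obtain ⟨a, rfl⟩ := Submodule.Quotient.mk_surjective _ a
    constructor
    · intro h
      have h' : (Submodule.Quotient.mk a : R ⧸ (K ⊔ Ideal.span {y})) = 0 := h
      rw [Submodule.Quotient.mk_eq_zero, mem_sup_span_singleton'] at h'
      obtain ⟨p, hp, r, rfl⟩ := h'
      refine ⟨Submodule.Quotient.mk r, ?_⟩
      refine (Submodule.Quotient.eq K).2 ?_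
      have : y • r - (p + y * r) = -p := by simp
      change y • r - (p + y * r) ∈ K
      rw [this]; exact neg_mem hp
    · rintro ⟨c, hc⟩
      obtain ⟨c, rfl⟩ := Submodule.Quotient.mk_surjective _ c
      rw [← hc]
      change (Submodule.Quotient.mk (y * c) : R ⧸ (K ⊔ Ideal.span {y})) = 0
      rw [Submodule.Quotient.mk_eq_zero]
      exact Submodule.mem_sup_right (Ideal.mul_mem_right _ _ (Ideal.mem_span_singleton_self y))
  have := Module.length_eq_add_of_exact f g hf hg hfg
  rw [hK.length_eq, (hK.mono le_sup_left).length_eq, (hK.mono (le_colonElem K y)).length_eq] at this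
  rw [add_comm]
  exact_mod_cast this

theorem colength_mono {K K' : Ideal R} (hK : IsCofin K) (h : K ≤ K') :
    colength K' ≤ colength K := by
  have := Module.length_le_of_surjective (Submodule.factor h) (Submodule.factor_surjective h)
  rw [hK.length_eq, (hK.mono h).length_eq] at this
  exact_mod_cast this

theorem eq_of_colength_le {K K' : Ideal R} (hK : IsCofin K) (h : K ≤ K')
    (hle : colength K ≤ colength K') : K = K' := by
  refine le_antisymm h fun y hy => ?_
  have h1 := colength_eq_add_colonElem hK y
  have h2 := colength_mono (hK.mono le_sup_left)
    (sup_le h ((Ideal.span_singleton_le_iff_mem _).2 hy))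
  have h3 : colength (colonElem K y) = 0 := by omega
  have h4 := (hK.mono (le_colonElem K y)).length_eq
  rw [h3, Nat.cast_zero, Module.length_eq_zero_iff, Ideal.Quotient.subsingleton_iff] at h4
  have : (1 : R) ∈ colonElem K y := h4 ▸ Submodule.mem_top
  simpa [mem_colonElem] using this

theorem colength_inf_sup {A A' G : Ideal R} (hA : IsCofin A) (h : A ≤ A') :
    colength A' + colength (A ⊔ G) ≤ colength A + colength (A' ⊔ G) := by
  have h1 := colength_sup_add_colength_inf (A := A') (B := A ⊔ G) (hA.mono h) (hA.mono le_sup_left)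
  have h2 : A' ⊔ (A ⊔ G) = A' ⊔ G := by rw [← sup_assoc, sup_eq_left.2 h]
  have h3 := colength_mono hA (le_inf h (le_sup_left : A ≤ A ⊔ G))
  rw [h2] at h1
  omega

theorem colength_add_le_of_colonElem {E E' G : Ideal R} {y : R} (hE' : IsCofin E)
    (hE : IsCofin E') (h : E' ≤ colonElem E y) :
    colength E + colength (E' ⊔ G) ≤ colength E' + colength (E ⊔ Ideal.span {y} * G) := by
  have h1 := colength_eq_add_colonElem hE' y
  have h2 := colength_eq_add_colonElem (hE'.mono (le_sup_left : E ≤ E ⊔ Ideal.span {y} * G)) y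
  have h3 : E ⊔ Ideal.span {y} * G ⊔ Ideal.span {y} = E ⊔ Ideal.span {y} := by
    rw [sup_assoc, sup_eq_right.2 (Ideal.mul_le_left : Ideal.span {y} * G ≤ Ideal.span {y})]
  have h4 : colonElem (E ⊔ Ideal.span {y} * G) y ≤ colonElem E y ⊔ G := by
    intro a ha
    obtain ⟨p, hp, r, hr, hpr⟩ := Submodule.mem_sup.1 (mem_colonElem.1 ha)
    obtain ⟨g, hg, rfl⟩ := Ideal.mem_span_singleton_mul.1 hr
    refine Submodule.mem_sup.2 ⟨a - g, ?_, g, hg, by ring⟩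
    rw [mem_colonElem]
    have : y * (a - g) = p := by linear_combination -hpr
    rw [this]; exact hp
  have h5 := colength_mono (hE'.mono (le_sup_left.trans (le_colonElem _ y))) h4
  have h6 := colength_inf_sup (G := G) hE h
  rw [h3] at h2
  omega

end Lengths

section Counting

variable {R : Type u} [CommRing R]

theorem sup_pow_succ (A B : Ideal R) (n : ℕ) :
    (A ⊔ B) ^ (n + 1) = A ^ (n + 1) ⊔ B * (A ⊔ B) ^ n := by
  have key : A * (A ⊔ B) ^ n ≤ A ^ (n + 1) ⊔ B * (A ⊔ B) ^ n := by
    induction n with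
    | zero => simp
    | succ n ih =>
      calc A * (A ⊔ B) ^ (n + 1) = (A * (A ⊔ B) ^ n) * (A ⊔ B) := by rw [pow_succ, mul_assoc]
        _ ≤ (A ^ (n + 1) ⊔ B * (A ⊔ B) ^ n) * (A ⊔ B) := Ideal.mul_mono_left ih
        _ = A ^ (n + 2) ⊔ A ^ (n + 1) * B ⊔ B * (A ⊔ B) ^ (n + 1) := by
          rw [Ideal.sup_mul, Ideal.mul_sup, pow_succ A (n + 1), mul_assoc B, ← pow_succ (A ⊔ B)]
        _ ≤ _ := by
          refine sup_le (sup_le le_sup_left ?_) le_sup_right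
          rw [mul_comm]
          exact (Ideal.mul_mono_right (Ideal.pow_right_mono le_sup_left _)).trans le_sup_right
  apply le_antisymm
  · rw [pow_succ', Ideal.sup_mul]
    exact sup_le key le_sup_right
  · refine sup_le (Ideal.pow_right_mono le_sup_left _) ?_
    rw [pow_succ']
    exact Ideal.mul_mono_left le_sup_right

variable [IsLocalRing R] [IsNoetherianRing R]

theorem colength_pow_mul_le_aux (x : ℕ → R) {D : ℕ} {K K' : Ideal R} (hK' : IsCofin K') (hle : K' ≤ K)
    (hq : IsCofin (headSpan x D)) {r : ℕ} (hr : colength K' ≤ colength K + r) :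
    ∀ k ≤ D, ∀ n, colength (headSpan x D ^ n * K') ≤
      colength (headSpan x k ^ n * K ⊔ headSpan x D ^ n * K') + Nat.multichoose k n * r := by
  have hF : ∀ n, IsCofin (headSpan x D ^ n * K') := fun n => (hq.pow n).mul hK'
  have zero : ∀ k, colength (headSpan x D ^ 0 * K') ≤
      colength (headSpan x k ^ 0 * K ⊔ headSpan x D ^ 0 * K') + Nat.multichoose k 0 * r := by
    intro k
    simp only [pow_zero, Ideal.one_eq_top, Ideal.top_mul, Nat.multichoose_zero_right, one_mul]
    rwa [sup_eq_left.2 hle]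
  intro k
  induction k with
  | zero =>
    intro _ n
    cases n with
    | zero => exact zero 0
    | succ n => simp [headSpan_zero]
  | succ k ihk =>
    intro hk n
    induction n with
    | zero => exact zero _
    | succ n ihn =>
      have h1 := ihk (by omega) (n + 1)
      have h2 := colength_add_le_of_colonElem
        (E := headSpan x k ^ (n + 1) * K ⊔ headSpan x D ^ (n + 1) * K') (y := x k)
        (G := headSpan x (k + 1) ^ n * K) ((hF (n + 1)).mono le_sup_right) (hF n) (by
          intro a ha
          refine Submodule.mem_sup_right ?_
          rw [pow_succ', mul_assoc]
          exact Ideal.mul_mem_mul (mem_headSpan x (by omega)) ha)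
      have h3 : headSpan x k ^ (n + 1) * K ⊔ headSpan x D ^ (n + 1) * K' ⊔
          Ideal.span {x k} * (headSpan x (k + 1) ^ n * K) =
          headSpan x (k + 1) ^ (n + 1) * K ⊔ headSpan x D ^ (n + 1) * K' := by
        conv_rhs => rw [headSpan_succ, sup_pow_succ, ← headSpan_succ, Ideal.sup_mul]
        rw [mul_assoc, sup_assoc, sup_assoc, sup_comm (headSpan x D ^ (n + 1) * K')]
      rw [h3] at h2
      rw [sup_comm (headSpan x D ^ n * K')] at h2
      rw [Nat.multichoose_succ_succ, add_mul]
      omega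

theorem colength_pow_mul_le (x : ℕ → R) {D : ℕ} {K K' : Ideal R} (hK' : IsCofin K')
    (hle : K' ≤ K)
    (hq : IsCofin (headSpan x D)) {r : ℕ} (hr : colength K' ≤ colength K + r) (n : ℕ) :
    colength (headSpan x D ^ n * K') ≤
      colength (headSpan x D ^ n * K) + Nat.multichoose D n * r := by
  have := colength_pow_mul_le_aux x hK' hle hq hr D le_rfl n
  rwa [sup_eq_left.2 (Ideal.mul_mono_right hle)] at this

end Counting

section Numerics

theorem choose_add_le {n k l : ℕ} (h : k ≤ l) : (n + k).choose k ≤ (n + l).choose l := by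
  rw [← Nat.choose_symm_add, ← Nat.choose_symm_add]
  exact Nat.choose_le_choose n (by omega)

/-- A combination of binomial polynomials with eventually nonnegative values has a
nonnegative leading coefficient. -/
theorem leading_nonneg {D N : ℕ} {a : ℕ → ℤ}
    (h : ∀ n ≥ N, 0 ≤ ∑ i ∈ Finset.range (D + 1), a i * ((n + D - i).choose (D - i) : ℤ)) :
    0 ≤ a 0 := by
  by_contra hneg
  obtain rfl | ⟨D, rfl⟩ : D = 0 ∨ ∃ D', D = D' + 1 := by
    rcases D with _ | D
    · exact Or.inl rfl
    · exact Or.inr ⟨D, rfl⟩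
  · have := h N le_rfl
    simp at this
    omega
  set A : ℕ := ∑ i ∈ Finset.range (D + 1), (a (i + 1)).natAbs with hA
  set n := N + A * (D + 1) with hn
  have h1 := h n (by omega)
  rw [Finset.sum_range_succ'] at h1
  have h2 : ∑ i ∈ Finset.range (D + 1), a (i + 1) *
      ((n + (D + 1) - (i + 1)).choose (D + 1 - (i + 1)) : ℤ) ≤ A * ((n + D).choose D : ℤ) := by
    rw [hA, Nat.cast_sum, Finset.sum_mul]
    refine Finset.sum_le_sum fun i hi => ?_
    have hi' : i ≤ D := by simpa [Nat.lt_succ_iff] using hi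
    have e1 : n + (D + 1) - (i + 1) = n + (D - i) := by omega
    have e2 : D + 1 - (i + 1) = D - i := by omega
    rw [e1, e2]
    have h3 : ((n + (D - i)).choose (D - i) : ℤ) ≤ ((n + D).choose D : ℤ) := by
      exact_mod_cast choose_add_le (by omega)
    have h4 : a (i + 1) ≤ ((a (i + 1)).natAbs : ℤ) := Int.le_natAbs
    calc _ ≤ ((a (i + 1)).natAbs : ℤ) * ((n + (D - i)).choose (D - i) : ℤ) :=
          mul_le_mul_of_nonneg_right h4 (by positivity)
      _ ≤ _ := mul_le_mul_of_nonneg_left h3 (by positivity)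
  have h5 : ((n + (D + 1)).choose (D + 1) : ℤ) * (D + 1) = (n + (D + 1)) * ((n + D).choose D) := by
    have := Nat.add_one_mul_choose_eq (n + D) D
    rw [← add_assoc]
    exact_mod_cast this.symm
  have h6 : (0 : ℤ) < (n + D).choose D := by exact_mod_cast Nat.choose_pos (by omega)
  simp only [Nat.sub_zero] at h1
  have h7 : a 0 ≤ -1 := by omega
  have h8 : (0 : ℤ) < (n + (D + 1)).choose (D + 1) := by exact_mod_cast Nat.choose_pos (by omega)
  have h9 : 0 ≤ (A : ℤ) * (n + D).choose D - (n + (D + 1)).choose (D + 1) := by nlinarith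
  have h10 : 0 ≤ ((A : ℤ) * (D + 1) - (n + (D + 1))) * (n + D).choose D := by
    have := mul_nonneg h9 (by positivity : (0 : ℤ) ≤ D + 1)
    linarith [this, h5]
  have h11 : (A : ℤ) * (D + 1) - (n + (D + 1)) < 0 := by
    have : (n : ℤ) = N + A * (D + 1) := by rw [hn]; push_cast; ring
    rw [this]; linarith [(by positivity : (0 : ℤ) ≤ N), (by positivity : (0 : ℤ) ≤ D)]
  exact absurd (mul_neg_of_neg_of_pos h11 h6) (not_lt.2 h10)

theorem second_nonneg {D N : ℕ} {a : ℕ → ℤ}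
    (h : ∀ n ≥ N, 0 ≤ ∑ i ∈ Finset.range (D + 1 + 1),
      a i * ((n + (D + 1) - i).choose (D + 1 - i) : ℤ)) (h0 : a 0 = 0) :
    0 ≤ a 1 := by
  refine leading_nonneg (D := D) (N := N) (a := fun i => a (i + 1)) fun n hn => ?_
  have := h n hn
  rw [Finset.sum_range_succ', h0, zero_mul, add_zero] at this
  refine this.trans_eq (Finset.sum_congr rfl fun i _ => ?_)
  rw [Nat.add_sub_add_right, ← add_assoc, Nat.add_sub_add_right]

theorem closed_form {D : ℕ} {h : ℕ → ℕ → ℤ} {W : ℕ → ℤ} (h0 : ∀ n, h 0 n = W 0)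
    (hz : ∀ r ≤ D, h r 0 = W 0)
    (hs : ∀ r < D, ∀ n, h (r + 1) (n + 1) = h r (n + 1) + h (r + 1) n - W (r + 1)) :
    ∀ r ≤ D, ∀ n, h r n =
      ∑ i ∈ Finset.range r, (W i - W (i + 1)) * ((n + r - i).choose (r - i) : ℤ) + W r := by
  intro r
  induction r with
  | zero => intro _ n; simp [h0]
  | succ r ih =>
    intro hr n
    induction n with
    | zero =>
      rw [hz _ hr]
      have : ∀ i ∈ Finset.range (r + 1), (W i - W (i + 1)) *
          ((0 + (r + 1) - i).choose (r + 1 - i) : ℤ) = W i - W (i + 1) := by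
        intro i _
        simp
      rw [Finset.sum_congr rfl this, Finset.sum_range_sub']
      ring
    | succ n ihn =>
      rw [hs r (by omega), ih (by omega), ihn, Finset.sum_range_succ, Finset.sum_range_succ]
      have : ∑ i ∈ Finset.range r, (W i - W (i + 1)) *
            ((n + 1 + (r + 1) - i).choose (r + 1 - i) : ℤ) =
          ∑ i ∈ Finset.range r, (W i - W (i + 1)) * ((n + 1 + r - i).choose (r - i) : ℤ) +
          ∑ i ∈ Finset.range r, (W i - W (i + 1)) *
            ((n + (r + 1) - i).choose (r + 1 - i) : ℤ) := by
        rw [← Finset.sum_add_distrib]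
        refine Finset.sum_congr rfl fun i hi => ?_
        have hi' : i < r := by simpa using hi
        have e1 : n + 1 + (r + 1) - i = (n + 1 + r - i) + 1 := by omega
        have e2 : r + 1 - i = (r - i) + 1 := by omega
        have e3 : n + (r + 1) - i = n + 1 + r - i := by omega
        rw [e1, e2, e3, Nat.choose_succ_succ]
        push_cast
        ring
      rw [this]
      have e1 : n + (r + 1) - r = n + 1 := by omega
      have e2 : n + 1 + (r + 1) - r = n + 1 + 1 := by omega
      have e3 : r + 1 - r = 1 := by omega
      rw [e1, e2, e3]
      simp only [Nat.choose_one_right]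
      push_cast
      ring

end Numerics

section Hilbert

variable {R : Type u} [CommRing R] [IsLocalRing R] [IsNoetherianRing R]
variable {d : ℕ} {x : ℕ → R} {b : ℕ → Ideal R}

theorem colength_head_step (H : AnnihilatesColons (d + 1) x b) (hreg : ∀ c, x d * c = 0 → c = 0)
    (hq : IsCofin (headSpan x (d + 1))) {j : ℕ} (hj : j ≤ d) (n : ℕ) :
    colength (headSpan x j ⊔ headSpan x (d + 1) ^ (n + 2)) +
        colength (headSpan x (d + 1)) =
      colength (headSpan x (j + 1) ⊔ headSpan x (d + 1) ^ (n + 2)) +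
        colength (headSpan x j ⊔ headSpan x (d + 1) ^ (n + 1)) +
        colength (colonElem (headSpan x j) (x d) ⊔ headSpan x (d + 1)) := by
  have h1 := colength_eq_add_colonElem
    ((hq.pow (n + 2)).mono (le_sup_right (a := headSpan x j))) (x j)
  have h2 := H.colon_add_pow hreg hj (n + 1)
  rw [h2, sup_right_comm, ← headSpan_succ] at h1
  have h3 := colength_sup_add_colength_inf
    ((hq.pow (n + 1)).mono (le_sup_right (a := colonElem (headSpan x j) (x d)))) hq
  have h4 : headSpan x (d + 1) ^ (n + 1) ≤ headSpan x (d + 1) := Ideal.pow_le_self (by omega)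
  have h5 : (colonElem (headSpan x j) (x d) ⊔ headSpan x (d + 1) ^ (n + 1)) ⊓ headSpan x (d + 1) =
      headSpan x j ⊔ headSpan x (d + 1) ^ (n + 1) := by
    apply le_antisymm
    · rintro c ⟨hc, hc'⟩
      obtain ⟨u, hu, v, hv, rfl⟩ := Submodule.mem_sup.1 hc
      refine Submodule.add_mem_sup (H.colon_inf_le hreg (by omega) hu ?_) hv
      have := sub_mem hc' (h4 hv)
      simpa using this
    · exact le_inf (sup_le_sup_right (le_colonElem _ _) _)
        (sup_le (headSpan_mono x (by omega)) h4)
  rw [h5, sup_assoc, sup_eq_right.2 h4] at h3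
  omega

/-- The successive drops appearing in the Hilbert function of `headSpan x (d + 1)`. -/
noncomputable def hilbertDrop (x : ℕ → R) (d r : ℕ) : ℤ :=
  if r = 0 then colength (headSpan x (d + 1)) else
    colength (headSpan x (d + 1)) -
      colength (colonElem (headSpan x (d + 1 - r)) (x d) ⊔ headSpan x (d + 1))

theorem colength_pow_eq_sum (H : AnnihilatesColons (d + 1) x b) (hreg : ∀ c, x d * c = 0 → c = 0)
    (hq : IsCofin (headSpan x (d + 1))) (n : ℕ) :
    (colength (headSpan x (d + 1) ^ (n + 1)) : ℤ) =
      ∑ i ∈ Finset.range (d + 1), (hilbertDrop x d i - hilbertDrop x d (i + 1)) *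
        ((n + (d + 1) - i).choose (d + 1 - i) : ℤ) + hilbertDrop x d (d + 1) := by
  have key := closed_form (D := d + 1)
    (h := fun r n => (colength (headSpan x (d + 1 - r) ⊔ headSpan x (d + 1) ^ (n + 1)) : ℤ))
    (W := hilbertDrop x d) ?_ ?_ ?_ (d + 1) le_rfl n
  · simpa [headSpan_zero] using key
  · intro n
    simp only [Nat.sub_zero, hilbertDrop, if_true]
    rw [sup_eq_left.2 (Ideal.pow_le_self (by omega))]
  · intro r _
    simp only [zero_add, pow_one, hilbertDrop, if_true]
    rw [sup_eq_right.2 (headSpan_mono x (by omega))]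
  · intro r hr n
    have := colength_head_step H hreg hq (j := d + 1 - (r + 1)) (by omega) n
    have e : d + 1 - (r + 1) + 1 = d + 1 - r := by omega
    rw [e] at this
    simp only [hilbertDrop, Nat.add_eq_zero_iff, one_ne_zero, and_false, if_false]
    zify at this
    linear_combination this

theorem multichoose_succ_left (d n : ℕ) : Nat.multichoose (d + 1) n = (n + d).choose d := by
  rw [Nat.multichoose_eq, show d + 1 + n - 1 = n + d by omega, Nat.choose_symm_add]

/-- The Chern number being as large as possible forces the colon inclusion below. -/
theorem colon_le_of_chern (H : AnnihilatesColons (d + 2) x b) (hreg : ∀ c, x (d + 1) * c = 0 → c = 0)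
    (hq : IsCofin (headSpan x (d + 2))) {I : Ideal R} (hqI : headSpan x (d + 2) ≤ I)
    (hI : I ^ 2 ≤ headSpan x (d + 2) * I) {r : ℕ}
    (hr : colength (headSpan x (d + 2)) ≤ colength I + r) {e : ℕ → ℤ} (he : e 1 = r) {N : ℕ}
    (h : ∀ n ≥ N, (colength (I ^ (n + 1)) : ℤ) = ∑ i ∈ Finset.range (d + 2 + 1),
      (-1) ^ i * e i * ((n + (d + 2) - i).choose (d + 2 - i) : ℤ)) :
    colonElem (headSpan x (d + 1)) (x (d + 1)) ≤
      colonElem (headSpan x d) (x (d + 1)) ⊔ Ideal.span {x d} := by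
  set q := headSpan x (d + 2) with hqdef
  have hIpow : ∀ n, I ^ (n + 1) ≤ q ^ n * I := by
    intro n
    induction n with
    | zero => simp
    | succ n ih =>
      calc I ^ (n + 1 + 1) = I ^ (n + 1) * I := pow_succ _ _
        _ ≤ q ^ n * I * I := Ideal.mul_mono_left ih
        _ = q ^ n * I ^ 2 := by rw [mul_assoc, sq]
        _ ≤ q ^ n * (q * I) := Ideal.mul_mono_right hI
        _ = _ := by rw [← mul_assoc, ← pow_succ]
  let a : ℕ → ℤ := fun i => if i = d + 2 then hilbertDrop x (d + 1) (d + 2) else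
    hilbertDrop x (d + 1) i - hilbertDrop x (d + 1) (i + 1)
  have ha : ∀ n, (colength (q ^ (n + 1)) : ℤ) = ∑ i ∈ Finset.range (d + 2 + 1),
      a i * ((n + (d + 2) - i).choose (d + 2 - i) : ℤ) := by
    intro n
    rw [hqdef, colength_pow_eq_sum H hreg hq, Finset.sum_range_succ _ (d + 2)]
    congr 1
    · refine Finset.sum_congr rfl fun i hi => ?_
      have : i ≠ d + 2 := by simp at hi; omega
      simp [a, this]
    · simp [a]
  have h1 : 0 ≤ a 0 - (-1) ^ 0 * e 0 := by
    refine leading_nonneg (D := d + 2) (N := N) (a := fun i => a i - (-1) ^ i * e i) fun n hn => ?_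
    simp only [sub_mul, Finset.sum_sub_distrib]
    rw [← ha, ← h n hn]
    have := colength_mono (hq.pow (n + 1)) (Ideal.pow_right_mono hqI (n + 1))
    omega
  have h2 : ∀ n ≥ N, 0 ≤ ∑ i ∈ Finset.range (d + 1 + 1 + 1),
      ((-1) ^ i * e i - a i + if i = 1 then (r : ℤ) else 0) *
        ((n + (d + 1 + 1) - i).choose (d + 1 + 1 - i) : ℤ) := by
    intro n hn
    simp only [sub_mul, add_mul, Finset.sum_sub_distrib, Finset.sum_add_distrib]
    have h3 : ∑ i ∈ Finset.range (d + 1 + 1 + 1), (if i = 1 then (r : ℤ) else 0) *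
        ((n + (d + 1 + 1) - i).choose (d + 1 + 1 - i) : ℤ) = r * (n + (d + 1)).choose (d + 1) := by
      rw [Finset.sum_eq_single 1]
      · simp
      · intro i _ hi; simp [hi]
      · intro hi; simp at hi
    rw [h3]
    have h4 := colength_pow_mul_le x hq hqI hq hr n
    rw [multichoose_succ_left, ← pow_succ] at h4
    have h5 := colength_mono (((hq.mono hqI)).pow (n + 1)) (hIpow n)
    have h6 := ha n
    have h7 := h n hn
    have h8 : (colength (q ^ (n + 1)) : ℤ) ≤ colength (I ^ (n + 1)) +
      r * (n + (d + 1)).choose (d + 1) := by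
      rw [mul_comm]
      exact_mod_cast h4.trans (Nat.add_le_add_right h5 _)
    rw [h6, h7] at h8
    linarith
  have h3 := leading_nonneg h2
  have h4 : 0 ≤ (-1) ^ 1 * e 1 - a 1 + if 1 = 1 then (r : ℤ) else 0 := by
    refine second_nonneg h2 ?_
    simp at h1 h3 ⊢
    omega
  have h5 : colength (colonElem (headSpan x d) (x (d + 1)) ⊔ q) ≤
      colength (colonElem (headSpan x (d + 1)) (x (d + 1)) ⊔ q) := by
    simp [a, hilbertDrop, he] at h4
    change colength (colonElem (headSpan x d) (x (d + 1)) ⊔ headSpan x (d + 1 + 1)) ≤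
      colength (colonElem (headSpan x (d + 1)) (x (d + 1)) ⊔ headSpan x (d + 1 + 1))
    omega
  have hmono : colonElem (headSpan x d) (x (d + 1)) ⊔ q ≤
      colonElem (headSpan x (d + 1)) (x (d + 1)) ⊔ q :=
    sup_le_sup_right (Submodule.comap_mono (headSpan_mono x (by omega))) _
  have h6 := eq_of_colength_le (hq.mono le_sup_right) hmono h5
  intro u hu
  have hu' : u ∈ colonElem (headSpan x d) (x (d + 1)) ⊔ q :=
    h6 ▸ Submodule.mem_sup_left hu
  obtain ⟨v, hv, w, hw, rfl⟩ := Submodule.mem_sup.1 hu'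
  have hv' : v ∈ colonElem (headSpan x (d + 1)) (x (d + 1)) :=
    (Submodule.comap_mono (headSpan_mono x (by omega))) hv
  have hw' : w ∈ colonElem (headSpan x (d + 1)) (x (d + 1)) := by
    have := sub_mem hu hv'
    simpa using this
  have hw2 := H.colon_inf_le hreg (j := d + 1) (by omega) hw' hw
  refine add_mem (Submodule.mem_sup_left hv) ?_
  rw [headSpan_succ] at hw2
  exact (sup_le_sup_right (le_colonElem _ _) _ : headSpan x d ⊔ Ideal.span {x d} ≤ _) hw2

/-- The Hilbert function of a socle ideal of a parameter ideal generated by a regular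
sequence. -/
theorem colength_socle_pow (H : AnnihilatesColons (d + 1) x b) (hreg : ∀ c, x d * c = 0 → c = 0)
    (hq : IsCofin (headSpan x (d + 1)))
    (hU : ∀ j ≤ d, colonElem (headSpan x j) (x d) ≤ headSpan x (d + 1))
    {I : Ideal R} (hqI : headSpan x (d + 1) ≤ I)
    (hI : I ^ 2 ≤ headSpan x (d + 1) * I) {r : ℕ}
    (hr : colength (headSpan x (d + 1)) = colength I + r) (n : ℕ) :
    (colength (I ^ (n + 2)) : ℤ) = colength (headSpan x (d + 1)) *
      ((n + 1 + (d + 1)).choose (d + 1) : ℤ) - r * ((n + 1 + d).choose d : ℤ) := by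
  set q := headSpan x (d + 1) with hqdef
  have hIpow : ∀ n, I ^ (n + 1) = q ^ n * I := by
    intro n
    refine le_antisymm ?_ ?_
    · induction n with
      | zero => simp
      | succ n ih =>
        calc I ^ (n + 1 + 1) = I ^ (n + 1) * I := pow_succ _ _
          _ ≤ q ^ n * I * I := Ideal.mul_mono_left ih
          _ = q ^ n * I ^ 2 := by rw [mul_assoc, sq]
          _ ≤ q ^ n * (q * I) := Ideal.mul_mono_right hI
          _ = _ := by rw [← mul_assoc, ← pow_succ]
    · rw [pow_succ]
      exact Ideal.mul_mono_left (Ideal.pow_right_mono hqI n)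
  have hdrop : ∀ i ≠ 0, i ≤ d + 1 → hilbertDrop x d i = 0 := by
    intro i hi hi'
    rw [hilbertDrop, if_neg hi, sup_eq_right.2 (hU _ (by omega)), sub_self]
  have hqpow : ∀ n, (colength (q ^ (n + 1)) : ℤ) =
      colength q * ((n + (d + 1)).choose (d + 1) : ℤ) := by
    intro n
    rw [hqdef, colength_pow_eq_sum H hreg hq, hdrop (d + 1) (by omega) le_rfl, add_zero,
      Finset.sum_eq_single 0]
    · rw [hdrop (0 + 1) (by omega) (by omega)]
      simp [hilbertDrop]
    · intro i hi hi0
      have hi' : i < d + 1 := by simpa using hi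
      rw [hdrop i hi0 (by omega), hdrop (i + 1) (by omega) (by omega)]
      simp
    · intro hi; simp at hi
  have hqc : IsCofin q := hq
  have h1 := colength_pow_mul_le x hqc hqI hqc hr.le (n + 1)
  have h2 := colength_pow_mul_le x (hqc.mono hqI) le_top hqc
    (show colength I ≤ colength (⊤ : Ideal R) + colength I by omega) (n + 1)
  rw [multichoose_succ_left] at h1 h2
  rw [← hqdef, ← pow_succ, ← hIpow] at h1
  rw [← hqdef, Ideal.mul_top, ← hIpow] at h2
  have h3 := hqpow (n + 1)
  have h4 := hqpow n
  have h5 : (n + 1 + (d + 1)).choose (d + 1) =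
      (n + 1 + d).choose d + (n + (d + 1)).choose (d + 1) := by
    rw [show n + (d + 1) = n + 1 + d by omega, show n + 1 + (d + 1) = (n + 1 + d) + 1 by omega,
      Nat.choose_succ_succ]
  zify at h1 h2 h5 hr
  rw [h3] at h1
  rw [h4] at h2
  apply le_antisymm
  · refine h2.trans_eq ?_
    rw [h5, hr]
    ring
  · linarith

end Hilbert

section Interface

variable {R : Type u} [CommRing R]

theorem smul_top_quotient (J N : Ideal R) :
    N • (⊤ : Submodule R (R ⧸ J)) = Submodule.map (Submodule.mkQ J) N := by
  have h : Submodule.map (Submodule.mkQ J) (N • (⊤ : Submodule R R)) =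
      N • Submodule.map (Submodule.mkQ J) ⊤ := Submodule.map_smul'' _ _ _
  rw [smul_eq_mul, Ideal.mul_top, Submodule.map_top, Submodule.range_mkQ] at h
  exact h.symm

theorem mk_mk_eq_zero_iff {J N : Ideal R} {a : R} :
    (Submodule.Quotient.mk (Submodule.Quotient.mk a : R ⧸ J) :
      (R ⧸ J) ⧸ (N • (⊤ : Submodule R (R ⧸ J)))) = 0 ↔ a ∈ J ⊔ N := by
  rw [Submodule.Quotient.mk_eq_zero, smul_top_quotient, ← Submodule.comap_map_mkQ,
    Submodule.mem_comap]
  rfl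

theorem mem_annihilator_torsionBy_iff {J N : Ideal R} {y β : R} :
    β ∈ (Submodule.torsionBy R ((R ⧸ J) ⧸ (N • (⊤ : Submodule R (R ⧸ J)))) y).annihilator ↔
      ∀ c, y * c ∈ J ⊔ N → β * c ∈ J ⊔ N := by
  rw [Submodule.mem_annihilator]
  constructor
  · intro h c hc
    exact mk_mk_eq_zero_iff.1 (h (Submodule.Quotient.mk (Submodule.Quotient.mk c))
      ((Submodule.mem_torsionBy_iff _ _).2 (mk_mk_eq_zero_iff.2 hc)))
  · intro h z hz
    obtain ⟨z, rfl⟩ := Submodule.Quotient.mk_surjective _ z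
    obtain ⟨c, rfl⟩ := Submodule.Quotient.mk_surjective _ z
    exact mk_mk_eq_zero_iff.2 (h c (mk_mk_eq_zero_iff.1 ((Submodule.mem_torsionBy_iff _ _).1 hz)))

theorem moduleDim_quotient (J : Ideal R) : moduleDim R (R ⧸ J) = ringKrullDim (R ⧸ J) := by
  rw [moduleDim, Ideal.annihilator_quotient]

theorem moduleDim_self : moduleDim R R = ringKrullDim R := by
  rw [moduleDim, Module.annihilator_eq_bot.2 inferInstance]
  exact ringKrullDim_eq_of_ringEquiv (RingEquiv.quotientBot R)

theorem mul_mem_of_mem_bIdeal {J : Ideal R} {β : R} (hβ : β ∈ bIdeal R (R ⧸ J)) {s : ℕ}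
    {y : Fin s → R} (hy : IsSOP R (R ⧸ J) y) (i : Fin s) {c : R}
    (hc : y i * c ∈ J ⊔ Ideal.span (y '' {j | j < i})) :
    β * c ∈ J ⊔ Ideal.span (y '' {j | j < i}) := by
  simp only [bIdeal, Submodule.mem_iInf] at hβ
  exact mem_annihilator_torsionBy_iff.1 (hβ s y hy i) c hc

theorem mem_bIdeal {J : Ideal R} {β : R}
    (h : ∀ (s : ℕ) (y : Fin s → R), IsSOP R (R ⧸ J) y → ∀ (i : Fin s) (c : R),
      y i * c ∈ J ⊔ Ideal.span (y '' {j | j < i}) → β * c ∈ J ⊔ Ideal.span (y '' {j | j < i})) :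
    β ∈ bIdeal R (R ⧸ J) := by
  simp only [bIdeal, Submodule.mem_iInf]
  exact fun s y hy i => mem_annihilator_torsionBy_iff.2 (h s y hy i)

variable [IsLocalRing R]

theorem isCofin_iff_le_radical [IsNoetherianRing R] {K : Ideal R} :
    IsCofin K ↔ maximalIdeal R ≤ K.radical := by
  constructor
  · rintro ⟨t, ht⟩ a ha
    exact ⟨t, ht (Ideal.pow_mem_pow ha t)⟩
  · intro h
    exact Ideal.exists_pow_le_of_le_radical_of_fg h (IsNoetherian.noetherian _)

theorem IsCofin.isFiniteLength_quotient [IsNoetherianRing R] {J N : Ideal R}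
    (h : IsCofin (J ⊔ N)) :
    IsFiniteLength R ((R ⧸ J) ⧸ (N • (⊤ : Submodule R (R ⧸ J)))) := by
  rw [← Module.length_ne_top_iff, ((Submodule.quotEquivOfEq _ _ (smul_top_quotient J N)).trans
    (Submodule.quotientQuotientEquivQuotientSup J N)).length_eq]
  exact Module.length_ne_top_iff.2 h.isFiniteLength

theorem isSOP_quotient [IsNoetherianRing R] {J : Ideal R} {s : ℕ} {y : Fin s → R}
    (hdim : ringKrullDim (R ⧸ J) = s)
    (hy : ∀ i, y i ∈ maximalIdeal R) (h : IsCofin (J ⊔ Ideal.span (Set.range y))) :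
    IsSOP R (R ⧸ J) y :=
  ⟨(moduleDim_quotient J).trans hdim, hy, h.isFiniteLength_quotient⟩

theorem isSOP_self_iff [IsNoetherianRing R] {s : ℕ} {y : Fin s → R} :
    IsSOP R R y ↔ ringKrullDim R = s ∧ (∀ i, y i ∈ maximalIdeal R) ∧
      IsCofin (Ideal.span (Set.range y)) := by
  rw [IsSOP, moduleDim_self, smul_eq_mul, Ideal.mul_top]
  refine and_congr_right fun _ => and_congr_right fun _ => ?_
  exact ⟨fun h => isCofin_of_isFiniteLength h, fun h => h.isFiniteLength⟩

variable [IsNoetherianRing R]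

theorem ringKrullDim_quotient_le_zero {K : Ideal R} (h : IsCofin K) : ringKrullDim (R ⧸ K) ≤ 0 := by
  have : IsArtinianRing (R ⧸ K) := by
    have := h.isFiniteLength
    rw [← Module.length_ne_top_iff, Module.length_eq_of_surjective (R := R ⧸ K) (S := R)
      (M := R ⧸ K) Ideal.Quotient.mk_surjective, Module.length_ne_top_iff] at this
    exact (isFiniteLength_iff_isNoetherian_isArtinian.1 this).2
  have := (isArtinianRing_iff_krullDimLE_zero (R := R ⧸ K)).1 inferInstance
  exact Order.krullDimLE_iff _ _ |>.1 this

theorem ringKrullDim_quotient_le_add {J : Ideal R} {s : Finset R}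
    (hs : ∀ a ∈ s, a ∈ maximalIdeal R) :
    ringKrullDim (R ⧸ J) ≤ ringKrullDim (R ⧸ (J ⊔ Ideal.span s)) + s.card := by
  classical
  by_cases hJ : J = ⊤
  · subst hJ
    have : Subsingleton (R ⧸ (⊤ : Ideal R)) := Ideal.Quotient.subsingleton_iff.2 rfl
    rw [ringKrullDim_eq_bot_of_subsingleton]
    exact bot_le
  have : Nontrivial (R ⧸ J) := Ideal.Quotient.nontrivial_iff.mpr hJ
  have := IsLocalRing.of_surjective' (Ideal.Quotient.mk J) Ideal.Quotient.mk_surjective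
  have := IsLocalHom.of_surjective (Ideal.Quotient.mk J) Ideal.Quotient.mk_surjective
  have h := ringKrullDim_le_ringKrullDim_quotient_add_card (s.image (Ideal.Quotient.mk J)) (by
    rw [IsLocalRing.ringJacobson_eq_maximalIdeal]
    intro z hz
    obtain ⟨a, ha, rfl⟩ := by simpa using hz
    have := hs a ha
    simpa using this)
  refine h.trans (add_le_add ?_ ?_)
  · rw [Finset.coe_image, ← Ideal.map_span]
    exact (ringKrullDim_eq_of_ringEquiv (DoubleQuot.quotQuotEquivQuotSup J (Ideal.span s))).le
  · exact_mod_cast Finset.card_image_le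

theorem ringKrullDim_quotient_le_card {J : Ideal R} {s : Finset R}
    (hs : ∀ a ∈ s, a ∈ maximalIdeal R) (h : IsCofin (J ⊔ Ideal.span s)) :
    ringKrullDim (R ⧸ J) ≤ s.card := by
  refine (ringKrullDim_quotient_le_add hs).trans ?_
  calc _ ≤ (0 : WithBot ℕ∞) + s.card := add_le_add_left (ringKrullDim_quotient_le_zero h) _
    _ = _ := zero_add _

theorem ringKrullDim_le_card {s : Finset R}
    (hs : ∀ a ∈ s, a ∈ maximalIdeal R) (h : IsCofin (Ideal.span (s : Set R))) :
    ringKrullDim R ≤ s.card := by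
  rw [ringKrullDim_eq_of_ringEquiv (RingEquiv.quotientBot R).symm]
  exact ringKrullDim_quotient_le_card hs (by rwa [bot_sup_eq])

theorem ringKrullDim_le_quotient_add {s : Finset R}
    (hs : ∀ a ∈ s, a ∈ maximalIdeal R) :
    ringKrullDim R ≤ ringKrullDim (R ⧸ Ideal.span (s : Set R)) + s.card :=
  ringKrullDim_le_ringKrullDim_quotient_add_card s (by
    rw [IsLocalRing.ringJacobson_eq_maximalIdeal]; exact hs)

end Interface

section Parameters

variable {R : Type u} [CommRing R] {d : ℕ}

/-- Extension by zero of a finite sequence. -/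
def extendZero {d : ℕ} (x : Fin d → R) (k : ℕ) : R := if h : k < d then x ⟨k, h⟩ else 0

theorem extendZero_coe (x : Fin d → R) (i : Fin d) : extendZero x i = x i := by
  simp [extendZero]

theorem headSpan_extendZero (x : Fin d → R) :
    headSpan (extendZero x) d = Ideal.span (Set.range x) := by
  rw [headSpan]
  congr 1
  ext a
  constructor
  · rintro ⟨k, hk, rfl⟩
    exact ⟨⟨k, hk⟩, (extendZero_coe x ⟨k, hk⟩).symm⟩
  · rintro ⟨k, rfl⟩
    exact ⟨k, k.2, extendZero_coe x k⟩

theorem span_image_lt_smul_top (x : ℕ → R) {l : ℕ} (hl : l < d) :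
    (Ideal.span ((fun j : Fin d => x j) '' {j | ⟨l, hl⟩ < j}) • (⊤ : Submodule R R)) =
      tailSpan x d (l + 1) := by
  rw [smul_eq_mul, Ideal.mul_top, tailSpan]
  congr 1
  ext a
  constructor
  · rintro ⟨k, hk, rfl⟩
    exact ⟨k, ⟨hk, k.2⟩, rfl⟩
  · rintro ⟨k, hk, rfl⟩
    exact ⟨⟨k, hk.2⟩, hk.1, rfl⟩

theorem moduleLength_eq_iff {M : Type u} [AddCommGroup M] [Module R M] {n : ℕ} :
    moduleLength R M = n ↔ Module.length R M = n := by
  rw [moduleLength, ← Module.coe_length]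
  exact_mod_cast Iff.rfl

variable [IsLocalRing R]

theorem mem_colonIdeal {q : Ideal R} {c : R} :
    c ∈ colonIdeal R q ↔ ∀ α ∈ maximalIdeal R, α * c ∈ q := Iff.rfl

theorem le_colonIdeal (q : Ideal R) : q ≤ colonIdeal R q :=
  fun _ hc _ _ => Ideal.mul_mem_left _ _ hc

variable [IsNoetherianRing R]

theorem isCofin_of_pow_mem {K L : Ideal R} (hL : IsCofin L) {T : Set R} (hT : L ≤ Ideal.span T)
    (h : ∀ a ∈ T, ∃ n, a ^ n ∈ K) : IsCofin K := by
  rw [isCofin_iff_le_radical] at hL ⊢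
  refine hL.trans ?_
  rw [Ideal.radical_le_radical_iff]
  exact hT.trans (Ideal.span_le.2 h)

variable {x : ℕ → R}

theorem ringKrullDim_quotient_tailSpan (hm : ∀ l < d, x l ∈ maximalIdeal R)
    (hq : IsCofin (headSpan x d)) (hdim : ringKrullDim R = d) {l : ℕ} (hl : l ≤ d) :
    ringKrullDim (R ⧸ tailSpan x d l) = l := by
  classical
  apply le_antisymm
  · have h := ringKrullDim_quotient_le_card (J := tailSpan x d l) (s := (Finset.range l).image x)
      (by
        intro a ha
        obtain ⟨k, hk, rfl⟩ := Finset.mem_image.1 ha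
        exact hm k ((Finset.mem_range.1 hk).trans_le hl))
      (hq.mono (by
        rw [headSpan, tailSpan, ← Ideal.span_union, Finset.coe_image, ← Set.image_union]
        apply Ideal.span_mono
        apply Set.image_mono
        intro a ha
        simp only [Set.mem_Iio, Set.mem_union, Set.mem_Ico, Finset.coe_range] at *
        omega))
    refine h.trans ?_
    exact_mod_cast Finset.card_image_le.trans (Finset.card_range l).le
  · have h := ringKrullDim_le_quotient_add (s := (Finset.Ico l d).image x)
      (by
        intro a ha
        obtain ⟨k, hk, rfl⟩ := Finset.mem_image.1 ha
        exact hm k (Finset.mem_Ico.1 hk).2)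
    have hs : Ideal.span (((Finset.Ico l d).image x : Finset R) : Set R) = tailSpan x d l := by
      rw [tailSpan, Finset.coe_image, Finset.coe_Ico]
    rw [hs, hdim] at h
    have hc : ((Finset.Ico l d).image x).card ≤ d - l :=
      Finset.card_image_le.trans (Nat.card_Ico l d).le
    generalize ringKrullDim (R ⧸ tailSpan x d l) = D at h ⊢
    generalize ((Finset.Ico l d).image x).card = c at h hc
    induction D using WithBot.recBotCoe with
    | bot => simp at h; 
    | coe D =>
      induction D using ENat.recTopCoe with
      | top => exact_mod_cast le_top
      | coe D =>
        have h' : d ≤ D + c := by exact_mod_cast h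
        have : l ≤ D := by omega
        exact_mod_cast this

theorem AnnihilatesColons.of_mem_bIdeal (hm : ∀ l < d, x l ∈ maximalIdeal R)
    (hq : IsCofin (headSpan x d)) (hdim : ringKrullDim R = d)
    (hmem : ∀ l < d, x l ∈ bIdeal R (R ⧸ tailSpan x d (l + 1))) :
    AnnihilatesColons d x (fun l => bIdeal R (R ⧸ tailSpan x d l)) := by
  classical
  refine ⟨hmem, ?_⟩
  intro l hl S hS i hi hiS e he n hn β hβ c hc
  let f : Fin l → ℕ := fun k => if (k : ℕ) ∈ S then 0 else if (k : ℕ) = i then 1 else 2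
  let E : ℕ → ℕ := fun k => if k = i then n else e k
  have hE : ∀ k, E k ≠ 0 := by intro k; simp only [E]; split_ifs; exacts [hn, he k]
  let σ := Tuple.sort f
  have hσ : Monotone (f ∘ σ) := Tuple.monotone_sort f
  let y : Fin l → R := fun k => x (σ k) ^ E (σ k)
  let k0 : Fin l := σ.symm ⟨i, hi⟩
  have hfk0 : f (σ k0) = 1 := by simp [k0, f, hiS]
  have hyk0 : y k0 = x i ^ n := by simp [y, k0, E]
  have hlt : ∀ j, j < k0 ↔ ((σ j : Fin l) : ℕ) ∈ S := by
    intro j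
    constructor
    · intro hj
      have h1 : f (σ j) ≤ 1 := hfk0 ▸ hσ hj.le
      by_contra hS'
      have h2 : ((σ j : Fin l) : ℕ) = i := by
        by_contra h2
        simp [f, hS', h2] at h1
      have : j = k0 := by
        rw [Equiv.eq_symm_apply]; exact Fin.ext h2
      exact hj.ne this
    · intro hj
      by_contra hlt
      have := hσ (not_lt.1 hlt)
      simp only [Function.comp, hfk0] at this
      simp [f, hj] at this
  have hset : y '' {j | j < k0} = (fun a => x a ^ e a) '' S := by
    ext z
    constructor
    · rintro ⟨j, hj, rfl⟩
      have hj' := (hlt j).1 hj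
      refine ⟨σ j, hj', ?_⟩
      have : ((σ j : Fin l) : ℕ) ≠ i := fun h => hiS (h ▸ hj')
      simp [y, E, this]
    · rintro ⟨a, ha, rfl⟩
      have hal := hS ha
      refine ⟨σ.symm ⟨a, hal⟩, (hlt _).2 (by simpa using ha), ?_⟩
      have : a ≠ i := fun h => hiS (h ▸ ha)
      simp [y, E, this]
  have hy : IsSOP R (R ⧸ tailSpan x d l) y := by
    refine isSOP_quotient (ringKrullDim_quotient_tailSpan hm hq hdim hl) ?_ ?_
    · intro k
      exact Ideal.pow_mem_of_mem _ (hm _ ((σ k).2.trans_le hl)) _ (Nat.pos_of_ne_zero (hE _))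
    · refine isCofin_of_pow_mem hq (T := x '' Set.Iio d) le_rfl ?_
      rintro _ ⟨k, hk, rfl⟩
      by_cases hkl : k < l
      · refine ⟨E k, Ideal.mem_sup_right (Ideal.subset_span ⟨σ.symm ⟨k, hkl⟩, ?_⟩)⟩
        simp [y]
      · refine ⟨1, Ideal.mem_sup_left ?_⟩
        rw [pow_one]
        exact Ideal.subset_span ⟨k, ⟨not_lt.1 hkl, hk⟩, rfl⟩
  have := mul_mem_of_mem_bIdeal hβ hy k0 (c := c) (by
    rw [hyk0, hset, sup_comm]; exact hc)
  rw [hset, sup_comm] at this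
  exact this

theorem pow_not_mem_headSpan {D : ℕ} (hm : ∀ l < D + 1, x l ∈ maximalIdeal R)
    (hq : IsCofin (headSpan x (D + 1))) (hdim : ringKrullDim R = (D + 1 : ℕ)) (n : ℕ) :
    x D ^ n ∉ headSpan x D := by
  classical
  intro h
  have := ringKrullDim_le_card (s := (Finset.range D).image x)
      (by
        intro a ha
        obtain ⟨k, hk, rfl⟩ := Finset.mem_image.1 ha
        exact hm k ((Finset.mem_range.1 hk).trans (Nat.lt_succ_self D)))
      (by
        rw [Finset.coe_image, Finset.coe_range, ← headSpan]
        refine isCofin_of_pow_mem hq (T := x '' Set.Iio (D + 1)) le_rfl ?_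
        rintro _ ⟨k, hk, rfl⟩
        rcases (Nat.lt_succ_iff_lt_or_eq.1 hk) with hk | rfl
        · exact ⟨1, by rw [pow_one]; exact mem_headSpan x hk⟩
        · exact ⟨n, h⟩)
  rw [hdim] at this
  have h2 : ((Finset.range D).image x).card ≤ D :=
    Finset.card_image_le.trans (Finset.card_range D).le
  have h3 : D + 1 ≤ ((Finset.range D).image x).card := by exact_mod_cast this
  omega

theorem isCSOP_iff {x : ℕ → R} :
    IsCSOP R R (fun i : Fin d => x i) ↔ ringKrullDim R = d ∧ (∀ l < d, x l ∈ maximalIdeal R) ∧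
      IsCofin (headSpan x d) ∧ ∀ l < d, x l ∈ bIdeal R (R ⧸ tailSpan x d (l + 1)) ^ 3 := by
  have hh : Ideal.span (Set.range fun i : Fin d => x i) = headSpan x d := by
    rw [headSpan]; congr 1; ext a
    exact ⟨fun ⟨k, hk⟩ => ⟨k, k.2, hk⟩, fun ⟨k, hk, h⟩ => ⟨⟨k, hk⟩, h⟩⟩
  rw [IsCSOP, isSOP_self_iff, hh, and_assoc, and_assoc]
  refine and_congr_right fun _ => and_congr ?_ (and_congr_right fun _ => ?_)
  · exact ⟨fun h l hl => h ⟨l, hl⟩, fun h i => h i i.2⟩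
  · constructor
    · intro h l hl
      have := h ⟨l, hl⟩
      rw [span_image_lt_smul_top] at this
      exact this
    · intro h i
      rw [span_image_lt_smul_top x i.2]
      exact h i i.2

theorem exists_of_isCParamIdeal {q : Ideal R} (h : IsCParamIdeal R q) :
    ∃ (d : ℕ) (x : ℕ → R), q = headSpan x d ∧ ringKrullDim R = d ∧
      (∀ l < d, x l ∈ maximalIdeal R) ∧
      IsCofin (headSpan x d) ∧ ∀ l < d, x l ∈ bIdeal R (R ⧸ tailSpan x d (l + 1)) ^ 3 := by
  obtain ⟨d, x, hx, rfl⟩ := h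
  refine ⟨d, extendZero x, (headSpan_extendZero x).symm, ?_⟩
  apply isCSOP_iff.1
  have : (fun i : Fin d => extendZero x i) = x := funext (extendZero_coe x)
  rwa [this]

theorem isCParamIdeal_of {x : ℕ → R} (hdim : ringKrullDim R = d)
    (hm : ∀ l < d, x l ∈ maximalIdeal R) (hq : IsCofin (headSpan x d))
    (hb : ∀ l < d, x l ∈ bIdeal R (R ⧸ tailSpan x d (l + 1)) ^ 3) :
    IsCParamIdeal R (headSpan x d) := by
  refine ⟨d, fun i => x i, isCSOP_iff.2 ⟨hdim, hm, hq, hb⟩, ?_⟩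
  rw [headSpan]; congr 1; ext a
  exact ⟨fun ⟨k, hk, h⟩ => ⟨⟨k, hk⟩, h⟩, fun ⟨k, hk⟩ => ⟨k, k.2, hk⟩⟩

theorem moduleLength_pow_eq_iff {I : Ideal R} (hI : IsCofin I) {n L : ℕ} :
    moduleLength R (R ⧸ (I ^ n • (⊤ : Submodule R R))) = L ↔ colength (I ^ n) = L := by
  rw [moduleLength_eq_iff, smul_eq_mul, Ideal.mul_top]
  change Module.length R (R ⧸ (I ^ n)) = L ↔ _
  rw [(hI.pow n).length_eq]
  exact_mod_cast Iff.rfl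

theorem isHilbCoeff_iff {I : Ideal R} (hI : IsCofin I) {e : ℕ → ℤ} :
    IsHilbCoeff R I d e ↔ ∃ N : ℕ, ∀ n ≥ N, (colength (I ^ (n + 1)) : ℤ) =
      ∑ i ∈ Finset.range (d + 1), (-1) ^ i * e i * ((n + d - i).choose (d - i) : ℤ) := by
  refine exists_congr fun N => forall_congr' fun n => forall_congr' fun _ => ?_
  simp only [moduleLength_pow_eq_iff hI]
  constructor
  · rintro ⟨L, hL, h⟩; rw [hL]; exact h
  · intro h; exact ⟨_, rfl, h⟩

theorem irMod_eq_iff {q : Ideal R} (hq : IsCofin q) {n : ℕ} :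
    irMod R R q = n ↔ colength q = colength (colonIdeal R q) + n := by
  have hI := hq.mono (le_colonIdeal q)
  rw [irMod, moduleLength_eq_iff, smul_eq_mul, Ideal.mul_top]
  change Module.length R (Submodule.map (Submodule.mkQ q) (colonIdeal R q)) = n ↔ _
  have h := Module.length_eq_add_of_exact (R := R)
    (Submodule.subtype (Submodule.map (Submodule.mkQ q) (colonIdeal R q)))
    (Submodule.mkQ (Submodule.map (Submodule.mkQ q) (colonIdeal R q)))
    (Submodule.subtype_injective _) (Submodule.mkQ_surjective _)
    (LinearMap.exact_subtype_mkQ _)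
  rw [(Submodule.quotientQuotientEquivQuotient q (colonIdeal R q) (le_colonIdeal q)).length_eq,
    hI.length_eq, hq.length_eq] at h
  generalize Module.length R (Submodule.map (Submodule.mkQ q) (colonIdeal R q)) = L at h ⊢
  induction L using ENat.recTopCoe with
  | top => simp at h
  | coe L =>
    have h' : colength q = L + colength (colonIdeal R q) := by exact_mod_cast h
    rw [Nat.cast_inj]
    omega

end Parameters

section CompleteNoetherian

variable {R S : Type u} [CommRing R] [CommRing S] [Algebra R S] {I : Ideal R}

theorem exists_mem_pow_sub_mem (hS : ∀ s : S, ∃ a : R, s - algebraMap R S a ∈ I.map (algebraMap R S))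
    (n : ℕ) {s : S} (hs : s ∈ I.map (algebraMap R S) ^ n) :
    ∃ a ∈ I ^ n, s - algebraMap R S a ∈ I.map (algebraMap R S) ^ (n + 1) := by
  rw [← Ideal.map_pow, Ideal.map] at hs
  induction hs using Submodule.span_induction with
  | mem s hs =>
    obtain ⟨a, ha, rfl⟩ := hs
    exact ⟨a, ha, by simp⟩
  | zero => exact ⟨0, zero_mem _, by simp⟩
  | add s t _ _ hs ht =>
    obtain ⟨a, ha, h⟩ := hs
    obtain ⟨b, hb, h'⟩ := ht
    refine ⟨a + b, add_mem ha hb, ?_⟩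
    have := add_mem h h'
    rw [map_add]
    convert this using 1
    ring
  | smul r s _ hs =>
    obtain ⟨a, ha, h⟩ := hs
    obtain ⟨b, hb⟩ := hS r
    refine ⟨b * a, Ideal.mul_mem_left _ _ ha, ?_⟩
    have h1 := Ideal.mul_mem_left _ r h
    have h2 : (r - algebraMap R S b) * algebraMap R S a ∈ I.map (algebraMap R S) ^ (n + 1) := by
      rw [pow_succ']
      refine Ideal.mul_mem_mul hb ?_
      rw [← Ideal.map_pow]
      exact Ideal.mem_map_of_mem _ ha
    have := add_mem h1 h2
    rw [map_mul, smul_eq_mul]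
    convert this using 1
    ring

theorem exists_sub_algebraMap_mem_pow
    (hS : ∀ s : S, ∃ a : R, s - algebraMap R S a ∈ I.map (algebraMap R S)) (n : ℕ) (s : S) :
    ∃ a : R, s - algebraMap R S a ∈ I.map (algebraMap R S) ^ n := by
  induction n with
  | zero => exact ⟨0, by simp⟩
  | succ n ih =>
    obtain ⟨a, ha⟩ := ih
    obtain ⟨b, -, hb⟩ := exists_mem_pow_sub_mem hS n ha
    exact ⟨a + b, by rw [map_add, ← sub_sub]; exact hb⟩

theorem IsAdicComplete.fg_of_forall_exists {J : Ideal S} [IsAdicComplete J S] {K : ℕ → Ideal S}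
    (hK : ∀ k, K k ≤ J ^ k) {t : ℕ} (g : Fin t → S) (hg : ∀ i, g i ∈ K 0)
    (h : ∀ k, ∀ f ∈ K k, ∃ c : Fin t → S, (∀ i, c i ∈ J ^ k) ∧ f - ∑ i, c i * g i ∈ K (k + 1)) :
    (K 0).FG := by
  have h' : ∀ k, ∀ f : K k, ∃ c : Fin t → S, (∀ i, c i ∈ J ^ k) ∧
    (f : S) - ∑ i, c i * g i ∈ K (k + 1) := fun k f => h k f f.2
  choose c hc hcK using h'
  have : K 0 = Ideal.span (Set.range g) := by
    apply le_antisymm _ (Ideal.span_le.2 (by rintro _ ⟨i, rfl⟩; exact hg i))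
    intro f hf
    let F : ∀ k, K k := fun k => Nat.rec (motive := fun k => K k) ⟨f, hf⟩ (fun k f => ⟨_, hcK k f⟩) k
    let C : Fin t → ℕ → S := fun i n => ∑ k ∈ Finset.range n, c k (F k) i
    have hF : ∀ n, (F n : S) = f - ∑ i, C i n * g i := by
      intro n
      induction n with
      | zero => simp [F, C]
      | succ n ih =>
        have : (F (n + 1) : S) = F n - ∑ i, c n (F n) i * g i := rfl
        rw [this, ih, sub_sub, ← Finset.sum_add_distrib]
        congr 1
        refine Finset.sum_congr rfl fun i _ => ?_
        simp only [C, Finset.sum_range_succ, add_mul]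
    have hL : ∀ i, ∃ L : S, ∀ n, C i n ≡ L [SMOD (J ^ n • ⊤ : Submodule S S)] := by
      intro i
      refine IsPrecomplete.prec' (C i) ?_
      intro m n hmn
      rw [SModEq.comm, SModEq.sub_mem, smul_eq_mul, Ideal.mul_top]
      simp only [C]
      rw [← Finset.sum_Ico_eq_sub _ hmn]
      refine Ideal.sum_mem _ fun k hk => ?_
      exact Ideal.pow_le_pow_right (Finset.mem_Ico.1 hk).1 (hc k _ i)
    choose L hL using hL
    have hfL : f - ∑ i, L i * g i = 0 := by
      refine IsHausdorff.haus' (I := J) _ fun n => ?_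
      rw [SModEq.zero, smul_eq_mul, Ideal.mul_top]
      have h1 : f - ∑ i, L i * g i = F n + ∑ i, (C i n - L i) * g i := by
        rw [hF]
        simp only [sub_mul, Finset.sum_sub_distrib]
        ring
      rw [h1]
      refine add_mem (hK n (F n).2) (Ideal.sum_mem _ fun i _ => Ideal.mul_mem_right _ _ ?_)
      have := hL i n
      rwa [SModEq.sub_mem, smul_eq_mul, Ideal.mul_top] at this
    rw [sub_eq_zero.1 hfL]
    exact Ideal.sum_mem _ fun i _ => Ideal.mul_mem_left _ _ (Ideal.subset_span ⟨i, rfl⟩)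
  rw [this]
  exact ⟨(Set.finite_range g).toFinset, by simp⟩

theorem isNoetherianRing_of_isAdicComplete [IsNoetherianRing R]
    [IsAdicComplete (I.map (algebraMap R S)) S]
    (hS : ∀ s : S, ∃ a : R, s - algebraMap R S a ∈ I.map (algebraMap R S)) :
    IsNoetherianRing S := by
  refine (isNoetherianRing_iff_ideal_fg S).2 fun J => ?_
  set M := I.map (algebraMap R S) with hM
  have hmap : ∀ {n a}, a ∈ I ^ n → algebraMap R S a ∈ M ^ n := by
    intro n a ha
    rw [hM, ← Ideal.map_pow]
    exact Ideal.mem_map_of_mem _ ha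
  let F : I.Filtration R :=
    { N := fun n => I ^ n ⊓ (J ⊔ M ^ (n + 1)).comap (algebraMap R S)
      mono := by
        intro n a ha
        exact ⟨Ideal.pow_le_pow_right n.le_succ ha.1, Ideal.mem_sup_right (hmap ha.1)⟩
      smul_le := by
        intro n
        refine Submodule.smul_le.2 fun r hr a ha => ⟨?_, ?_⟩
        · rw [pow_succ']; exact Ideal.mul_mem_mul hr ha.1
        · rw [smul_eq_mul]
          have h1 : algebraMap R S (r * a) ∈ M * (J ⊔ M ^ (n + 1)) := by
            rw [map_mul]; exact Ideal.mul_mem_mul (Ideal.mem_map_of_mem _ hr) ha.2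
          refine Ideal.mem_comap.2 ((?_ : M * (J ⊔ M ^ (n + 1)) ≤ _) h1)
          rw [Ideal.mul_sup, ← pow_succ']
          exact sup_le_sup_right Ideal.mul_le_right _ }
  have hFs : F.Stable := by
    refine (I.stableFiltration_stable (⊤ : Ideal R)).of_le ?_
    intro n a ha
    simpa using ha.1
  obtain ⟨n₀, hn₀⟩ := hFs.exists_pow_smul_eq
  obtain ⟨t, a, ha⟩ := Submodule.fg_iff_exists_fin_generating_family.1
    (IsNoetherian.noetherian (F.N n₀))
  have haF : ∀ i, a i ∈ F.N n₀ := fun i => ha ▸ Submodule.subset_span ⟨i, rfl⟩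
  have hg : ∀ i, ∃ g ∈ J, algebraMap R S (a i) - g ∈ M ^ (n₀ + 1) := by
    intro i
    obtain ⟨g, hg, h, hh, e⟩ := Submodule.mem_sup.1 (haF i).2
    refine ⟨g, hg, ?_⟩
    rw [← e, add_sub_cancel_left]
    exact hh
  choose g hgJ hga using hg
  have hK : (J ⊓ M ^ n₀).FG := by
    refine IsAdicComplete.fg_of_forall_exists (J := M) (K := fun k => J ⊓ M ^ (n₀ + k)) ?_ g ?_ ?_
    · exact fun k => inf_le_right.trans (Ideal.pow_le_pow_right (by omega))
    · intro i
      refine ⟨hgJ i, ?_⟩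
      have h1 := hmap (haF i).1
      have h2 := Ideal.pow_le_pow_right (Nat.le_succ n₀) (hga i)
      have := sub_mem h1 h2
      rwa [sub_sub_cancel] at this
    · intro k f hf
      obtain ⟨b, hb, hfb⟩ := exists_mem_pow_sub_mem hS (n₀ + k) hf.2
      have hbF : b ∈ F.N (n₀ + k) := by
        refine ⟨hb, ?_⟩
        have : algebraMap R S b = f + -(f - algebraMap R S b) := by ring
        refine Ideal.mem_comap.2 ?_
        rw [this]
        exact add_mem (Ideal.mem_sup_left hf.1) (neg_mem (Ideal.mem_sup_right hfb))
      rw [hn₀, ← ha, Submodule.mem_ideal_smul_span_iff_exists_sum] at hbF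
      obtain ⟨r, hr, rfl⟩ := hbF
      refine ⟨fun i => algebraMap R S (r i), fun i => hmap (hr i), ?_⟩
      rw [Finsupp.sum_fintype _ _ (by simp)] at hfb
      refine ⟨sub_mem hf.1 (Ideal.sum_mem _ fun i _ => Ideal.mul_mem_left _ _ (hgJ i)), ?_⟩
      have h1 : f - ∑ i, algebraMap R S (r i) * g i =
          (f - algebraMap R S (∑ i, r i • a i)) +
            ∑ i, algebraMap R S (r i) * (algebraMap R S (a i) - g i) := by
        simp only [map_sum, smul_eq_mul, map_mul, mul_sub, Finset.sum_sub_distrib]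
        ring
      rw [h1]
      refine add_mem hfb (Ideal.sum_mem _ fun i _ => ?_)
      have := Ideal.mul_mem_mul (hmap (hr i)) (hga i)
      rw [← pow_add] at this
      exact Ideal.pow_le_pow_right (by omega) this
  refine Ideal.fg_of_fg_map_of_fg_inf_ker_of_surjective (f := Ideal.Quotient.mk (M ^ n₀)) ?_
    (by rwa [Ideal.mk_ker]) Ideal.Quotient.mk_surjective
  have : IsNoetherianRing (S ⧸ M ^ n₀) := by
    refine isNoetherianRing_of_surjective R _ ((Ideal.Quotient.mk (M ^ n₀)).comp (algebraMap R S)) ?_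
    intro z
    obtain ⟨s, rfl⟩ := Ideal.Quotient.mk_surjective z
    obtain ⟨b, hb⟩ := exists_sub_algebraMap_mem_pow hS n₀ s
    exact ⟨b, ((Ideal.Quotient.mk_eq_mk_iff_sub_mem _ _).2 hb).symm⟩
  exact IsNoetherian.noetherian _

end CompleteNoetherian

section Completion

theorem exists_isCofin_span (R : Type u) [CommRing R] [IsLocalRing R] [IsNoetherianRing R] :
    ∃ s : Finset R, (∀ a ∈ s, a ∈ maximalIdeal R) ∧ IsCofin (Ideal.span (s : Set R)) ∧
      (s.card : WithBot ℕ∞) = ringKrullDim R := by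
  obtain ⟨s, hs, hc⟩ := Ideal.exists_finset_card_eq_height_of_isNoetherianRing (maximalIdeal R)
  refine ⟨s, fun a ha => hs.1.2 (Ideal.subset_span ha), ?_, ?_⟩
  · rw [isCofin_iff_le_radical, Ideal.radical_eq_sInf]
    refine le_sInf fun P hP => ?_
    exact hs.2 ⟨hP.2, hP.1⟩ (le_maximalIdeal hP.2.ne_top)
  · rw [← maximalIdeal_height_eq_ringKrullDim, ← hc]
    rfl

variable {R S : Type u} [CommRing R] [IsLocalRing R] [IsNoetherianRing R] [CommRing S]
  [IsLocalRing S] [IsNoetherianRing S] [Algebra R S]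

theorem ringKrullDim_le_of_map_maximalIdeal
    (hM : maximalIdeal S = (maximalIdeal R).map (algebraMap R S))
    (hcomap : ∀ n, (maximalIdeal S ^ n).comap (algebraMap R S) ≤ maximalIdeal R ^ n)
    (hS : ∀ s : S, ∃ a : R, s - algebraMap R S a ∈ maximalIdeal S) :
    ringKrullDim R ≤ ringKrullDim S := by
  classical
  obtain ⟨s, hs, ⟨t, ht⟩, hc⟩ := exists_isCofin_span S
  rw [← hc]
  have happ : ∀ n (s : S), ∃ a : R, s - algebraMap R S a ∈ maximalIdeal S ^ n := by
    rw [hM] at hS ⊢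
    exact exists_sub_algebraMap_mem_pow hS
  choose y hy using fun a : S => happ (t + 1) a
  have hym : ∀ a ∈ s, y a ∈ maximalIdeal R := by
    intro a ha
    have h1 := sub_mem (hs a ha) (Ideal.pow_le_self (Nat.succ_ne_zero t) (hy a))
    rw [sub_sub_cancel] at h1
    have h2 := hcomap 1 (Ideal.mem_comap.2 (by rwa [pow_one]))
    rwa [pow_one] at h2
  have h1 : maximalIdeal S ^ t ≤
      (Ideal.span ((s.image y : Finset R) : Set R)).map (algebraMap R S) := by
    refine Submodule.le_of_le_smul_of_le_jacobson_bot (I := maximalIdeal S)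
      (IsNoetherian.noetherian _) (IsLocalRing.maximalIdeal_le_jacobson _) ?_
    rw [smul_eq_mul, ← pow_succ']
    refine ht.trans (Ideal.span_le.2 fun a ha => ?_)
    have : a = algebraMap R S (y a) + (a - algebraMap R S (y a)) := by ring
    rw [this]
    exact add_mem (Ideal.mem_sup_left (Ideal.mem_map_of_mem _ (Ideal.subset_span
      (Finset.mem_coe.2 (Finset.mem_image_of_mem y ha))))) (Ideal.mem_sup_right (hy a))
  have h2 : maximalIdeal R ^ t ≤ Ideal.span ((s.image y : Finset R) : Set R) := by
    refine Submodule.le_of_le_smul_of_le_jacobson_bot (I := maximalIdeal R)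
      (IsNoetherian.noetherian _) (IsLocalRing.maximalIdeal_le_jacobson _) ?_
    rw [smul_eq_mul, ← pow_succ']
    intro r hr
    have hr' : algebraMap R S r ∈ (Ideal.span ((s.image y : Finset R) : Set R)).map
        (algebraMap R S) := by
      apply h1
      rw [hM, ← Ideal.map_pow]
      exact Ideal.mem_map_of_mem _ hr
    have key : ∀ z ∈ (Ideal.span ((s.image y : Finset R) : Set R)).map (algebraMap R S),
        ∃ b ∈ Ideal.span ((s.image y : Finset R) : Set R),
          z - algebraMap R S b ∈ maximalIdeal S ^ (t + 1) := by
      intro z hz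
      rw [Ideal.map] at hz
      induction hz using Submodule.span_induction with
      | mem z hz =>
        obtain ⟨b, hb, rfl⟩ := hz
        exact ⟨b, hb, by simp⟩
      | zero => exact ⟨0, zero_mem _, by simp⟩
      | add z w _ _ hz hw =>
        obtain ⟨a, ha, h⟩ := hz
        obtain ⟨b, hb, h'⟩ := hw
        refine ⟨a + b, add_mem ha hb, ?_⟩
        have := add_mem h h'
        rw [map_add]
        convert this using 1
        ring
      | smul c z _ hz =>
        obtain ⟨a, ha, h⟩ := hz
        obtain ⟨b, hb⟩ := happ (t + 1) c
        refine ⟨b * a, Ideal.mul_mem_left _ _ ha, ?_⟩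
        have := add_mem (Ideal.mul_mem_left _ c h) (Ideal.mul_mem_right (algebraMap R S a) _ hb)
        rw [map_mul, smul_eq_mul]
        convert this using 1
        ring
    obtain ⟨b, hb, h⟩ := key _ hr'
    have h3 : r - b ∈ maximalIdeal R ^ (t + 1) := by
      apply hcomap
      rw [Ideal.mem_comap, map_sub]
      exact h
    have : r = b + (r - b) := by ring
    rw [this]
    exact add_mem (Ideal.mem_sup_left hb) (Ideal.mem_sup_right h3)
  refine (ringKrullDim_le_card (s := s.image y) ?_ ⟨t, h2⟩).trans ?_
  · intro a ha
    obtain ⟨b, hb, rfl⟩ := Finset.mem_image.1 ha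
    exact hym b hb
  · exact_mod_cast Finset.card_image_le

variable (R) in
theorem exists_sub_algebraMap_mem_completion (s : AdicCompletion (maximalIdeal R) R) :
    ∃ a : R, s - algebraMap R _ a ∈
      (maximalIdeal R).map (algebraMap R (AdicCompletion (maximalIdeal R) R)) := by
  obtain ⟨a, ha⟩ := Ideal.Quotient.mk_surjective (AdicCompletion.evalOneₐ (maximalIdeal R) s)
  refine ⟨a, ?_⟩
  rw [← AdicCompletion.ker_evalOneₐ_eq_map _ (IsNoetherian.noetherian _), RingHom.mem_ker, map_sub,
    sub_eq_zero]
  exact ha.symm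

instance isNoetherianRing_completion :
    IsNoetherianRing (AdicCompletion (maximalIdeal R) R) := by
  have := AdicCompletion.isAdicComplete_self (maximalIdeal R) (IsNoetherian.noetherian _)
  exact isNoetherianRing_of_isAdicComplete (exists_sub_algebraMap_mem_completion R)

variable (R) in
theorem comap_maximalIdeal_completion_pow_le (n : ℕ) :
    (maximalIdeal (AdicCompletion (maximalIdeal R) R) ^ n).comap (algebraMap R _) ≤
      maximalIdeal R ^ n := by
  intro a ha
  rw [Ideal.mem_comap, AdicCompletion.maximalIdeal_eq_map, ← Ideal.map_pow] at ha
  have h : ((maximalIdeal R) ^ n).map (algebraMap R (AdicCompletion (maximalIdeal R) R)) ≤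
      RingHom.ker (AdicCompletion.evalₐ (maximalIdeal R) n) := by
    rw [Ideal.map_le_iff_le_comap]
    intro r hr
    rw [Ideal.mem_comap, RingHom.mem_ker]
    exact (AdicCompletion.evalₐ_of _ n r).trans (Ideal.Quotient.eq_zero_iff_mem.2 hr)
  have := h ha
  rw [RingHom.mem_ker] at this
  exact Ideal.Quotient.eq_zero_iff_mem.1 ((AdicCompletion.evalₐ_of _ n a).symm.trans this)

variable (R) in
theorem ringKrullDim_le_completion :
    ringKrullDim R ≤ ringKrullDim (AdicCompletion (maximalIdeal R) R) := by
  refine ringKrullDim_le_of_map_maximalIdeal AdicCompletion.maximalIdeal_eq_map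
    (comap_maximalIdeal_completion_pow_le R) ?_
  rw [AdicCompletion.maximalIdeal_eq_map]
  exact exists_sub_algebraMap_mem_completion R

/-- In an unmixed local ring, every element of a system of parameters is a nonzerodivisor. -/
theorem eq_zero_of_mul_eq_zero_of_isUnmixedRing (hum : IsUnmixedRing R) {D : ℕ} {x : ℕ → R}
    (hm : ∀ l < D + 1, x l ∈ maximalIdeal R) (hq : IsCofin (headSpan x (D + 1)))
    (hdim : ringKrullDim R = (D + 1 : ℕ)) {c : R} (hc : x D * c = 0) : c = 0 := by
  classical
  by_contra hc0
  let φ := algebraMap R (AdicCompletion (maximalIdeal R) R)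
  have hφ : φ c ≠ 0 := by
    intro h
    have : c ∈ (⨅ n, maximalIdeal R ^ n : Ideal R) := by
      rw [Ideal.mem_iInf]
      intro n
      refine comap_maximalIdeal_completion_pow_le R n ?_
      rw [Ideal.mem_comap]
      change φ c ∈ _
      rw [h]; exact zero_mem _
    rw [Ideal.iInf_pow_eq_bot_of_isLocalRing _ (Ideal.IsPrime.ne_top inferInstance)] at this
    exact hc0 this
  have hmem : φ (x D) ∈ ⋃ p ∈ associatedPrimes (AdicCompletion (maximalIdeal R) R)
      (AdicCompletion (maximalIdeal R) R), (p : Set (AdicCompletion (maximalIdeal R) R)) := by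
    rw [biUnion_associatedPrimes_eq_zero_divisors]
    refine ⟨φ c, hφ, ?_⟩
    rw [smul_eq_mul, ← map_mul, hc, map_zero]
  obtain ⟨P, hP, hxP⟩ := Set.mem_iUnion₂.1 hmem
  have h1 := hum P hP
  have h2 := ringKrullDim_le_completion R
  have h3 := ringKrullDim_quotient_le_card (J := P) (s := (Finset.range D).image (φ ∘ x))
    (by
      intro a ha
      obtain ⟨k, hk, rfl⟩ := Finset.mem_image.1 ha
      rw [AdicCompletion.maximalIdeal_eq_map]
      exact Ideal.mem_map_of_mem _ (hm k ((Finset.mem_range.1 hk).trans (Nat.lt_succ_self D))))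
    (by
      obtain ⟨t, ht⟩ := hq
      refine ⟨t, ?_⟩
      rw [AdicCompletion.maximalIdeal_eq_map, ← Ideal.map_pow]
      refine (Ideal.map_mono ht).trans ?_
      rw [headSpan, Ideal.map_span, Ideal.span_le]
      rintro _ ⟨_, ⟨k, hk, rfl⟩, rfl⟩
      rcases (Nat.lt_succ_iff_lt_or_eq.1 hk) with hk | rfl
      · refine Ideal.mem_sup_right (Ideal.subset_span ?_)
        exact Finset.mem_coe.2 (Finset.mem_image.2 ⟨k, Finset.mem_range.2 hk, rfl⟩)
      · exact Ideal.mem_sup_left hxP)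
  rw [h1] at h3
  have h4 := h2.trans h3
  rw [hdim] at h4
  have h5 : ((Finset.range D).image (φ ∘ x)).card ≤ D :=
    Finset.card_image_le.trans (Finset.card_range D).le
  have h6 : D + 1 ≤ ((Finset.range D).image (φ ∘ x)).card := by exact_mod_cast h4
  omega

end Completion

section ExtComparison

variable {R : Type u} [CommRing R]

theorem extMk_eq_zero_iff_exists_next {X Y : ModuleCat.{u} R} (P : ProjectiveResolution X) {n : ℕ}
    (f : P.complex.X n ⟶ Y) (hf : P.complex.d (n + 1) n ≫ f = 0) :
    P.extMk f (n + 1) rfl hf = 0 ↔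
      ∃ g : P.complex.X ((ComplexShape.down ℕ).next n) ⟶ Y,
        P.complex.d n ((ComplexShape.down ℕ).next n) ≫ g = f := by
  obtain _ | p := n
  · have h0 : (ComplexShape.down ℕ).next 0 = 0 := ChainComplex.next_nat_zero
    have hz : IsZero (P.cochainComplex.X 1) :=
      CochainComplex.isZero_of_isStrictlyLE _ 0 _
    have hd : P.complex.d 0 ((ComplexShape.down ℕ).next 0) = 0 :=
      P.complex.shape _ _ (by simp)
    rw [hd]
    simp only [Limits.zero_comp, exists_const]
    constructor
    · intro h
      rw [← P.extEquivCohomologyClass.apply_eq_iff_eq,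
        ProjectiveResolution.extEquivCohomologyClass_extMk,
        ProjectiveResolution.extEquivCohomologyClass_zero,
        CochainComplex.HomComplex.CohomologyClass.mk_eq_zero_iff,
        CochainComplex.HomComplex.Cocycle.toSingleMk_mem_coboundaries_iff _ _ _ _ _ 1 (by simp)] at h
      obtain ⟨g, hg⟩ := h
      rw [hz.eq_of_src g 0, Limits.comp_zero] at hg
      rw [← cancel_epi (P.cochainComplexXIso (-(0 : ℕ)) 0 rfl).hom, ← hg, Limits.comp_zero]
    · intro h
      subst h
      simp
  · have h0 : (ComplexShape.down ℕ).next (p + 1) = p := by simp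
    rw [P.extMk_eq_zero_iff f (p + 1 + 1) rfl hf p rfl, h0]

theorem injective_homologyMap {ι : Type*} {c : ComplexShape ι}
    {K L : HomologicalComplex (ModuleCat.{u} R) c} (φ : K ⟶ L) (i : ι)
    (h : ∀ z : K.X i, K.d i (c.next i) z = 0 →
      (∃ w, L.d (c.prev i) i w = φ.f i z) → ∃ w, K.d (c.prev i) i w = z) :
    Function.Injective (HomologicalComplex.homologyMap φ i) := by
  have hπ : ∀ M : HomologicalComplex (ModuleCat.{u} R) c,
      Function.Surjective (M.homologyπ i) := fun M =>
    (ModuleCat.epi_iff_surjective _).1 inferInstance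
  have hι : ∀ M : HomologicalComplex (ModuleCat.{u} R) c,
      Function.Injective (M.iCycles i) := fun M =>
    (ModuleCat.mono_iff_injective _).1 inferInstance
  rw [← AddMonoidHom.coe_coe, injective_iff_map_eq_zero]
  intro y hy
  obtain ⟨z, rfl⟩ := hπ K y
  have hz0 : K.d i (c.next i) (K.iCycles i z) = 0 := by
    rw [← ModuleCat.comp_apply, K.iCycles_d]; rfl
  have hex : ∀ (M : HomologicalComplex (ModuleCat.{u} R) c) (z : M.cycles i),
      M.homologyπ i z = 0 ↔ ∃ w, M.d (c.prev i) i w = M.iCycles i z := by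
    intro M z
    have hS : (ShortComplex.mk _ _ (M.toCycles_comp_homologyπ (c.prev i) i)).Exact :=
      ShortComplex.exact_of_g_is_cokernel _ (M.homologyIsCokernel (c.prev i) i rfl)
    rw [ShortComplex.moduleCat_exact_iff] at hS
    constructor
    · intro hz
      obtain ⟨w, hw⟩ := hS z hz
      refine ⟨w, ?_⟩
      rw [← hw, ← ModuleCat.comp_apply]
      simp
    · rintro ⟨w, hw⟩
      have : M.toCycles (c.prev i) i w = z := by
        apply hι M
        rw [← hw, ← ModuleCat.comp_apply]
        simp
      rw [← this, ← ModuleCat.comp_apply, M.toCycles_comp_homologyπ]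
      rfl
  rw [hex]
  refine h _ hz0 ?_
  have h1 : L.homologyπ i (HomologicalComplex.cyclesMap φ i z) = 0 := by
    rw [← ModuleCat.comp_apply, ← HomologicalComplex.homologyπ_naturality]
    exact hy
  obtain ⟨w, hw⟩ := (hex L _).1 h1
  refine ⟨w, ?_⟩
  rw [hw, ← ModuleCat.comp_apply, HomologicalComplex.cyclesMap_i]
  rfl

theorem isZero_homology_iff {ι : Type*} {c : ComplexShape ι}
    (K : HomologicalComplex (ModuleCat.{u} R) c) (i : ι) :
    IsZero (K.homology i) ↔
      ∀ z : K.X i, K.d i (c.next i) z = 0 → ∃ w, K.d (c.prev i) i w = z := by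
  rw [← HomologicalComplex.exactAt_iff_isZero_homology, HomologicalComplex.exactAt_iff,
    ShortComplex.moduleCat_exact_iff]
  rfl

theorem isZero_Ext_obj_iff {X : ModuleCat.{u} R} (Y : ModuleCat.{u} R) (n : ℕ) :
    IsZero (((Ext R (ModuleCat.{u} R) n).obj (op X)).obj Y) ↔
      Subsingleton (Abelian.Ext X Y n) := by
  let P : ProjectiveResolution X := projectiveResolution X
  rw [(P.isoExt (R := R) n Y).isZero_iff, isZero_homology_iff]
  have hn : (ComplexShape.down ℕ).prev n = n + 1 := by simp
  constructor
  · intro h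
    rw [subsingleton_iff_forall_eq 0]
    intro e
    obtain ⟨f, hf, rfl⟩ := P.extMk_surjective e (n + 1) rfl
    rw [extMk_eq_zero_iff_exists_next]
    exact h f (by
      change P.complex.d ((ComplexShape.down ℕ).prev n) n ≫ f = 0
      rw [hn, hf])
  · intro h z hz
    have hf : P.complex.d (n + 1) n ≫ z = 0 := by
      change P.complex.d ((ComplexShape.down ℕ).prev n) n ≫ z = 0 at hz
      rwa [hn] at hz
    exact (extMk_eq_zero_iff_exists_next P z hf).1 (Subsingleton.elim _ _)

theorem epi_of_comp_iso_eq {D : Type*} [Category* D] {X X' Y Y' : D} (x : X ⟶ Y) (e : Y ≅ Y')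
    (e' : X ≅ X') (y : X' ⟶ Y') [Epi y] (h : x ≫ e.hom = e'.hom ≫ y) : Epi x := by
  rw [← Iso.eq_comp_inv] at h
  rw [h]
  infer_instance

theorem epi_homologyMap_opFunctor_map {ι : Type*} {c : ComplexShape ι}
    {K L : HomologicalComplex (ModuleCat.{u} R) c} (φ : K ⟶ L) (i : ι)
    [Mono (HomologicalComplex.homologyMap φ i)] :
    Epi (HomologicalComplex.homologyMap ((HomologicalComplex.opFunctor _ _).map φ.op) i) := by
  exact epi_of_comp_iso_eq _ (K.homologyOp i) (L.homologyOp i)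
    (HomologicalComplex.homologyMap φ i).op (HomologicalComplex.homologyOp_hom_naturality φ i)

theorem injective_Ext_map {A B : ModuleCat.{u} R} (f : A ⟶ B) (Y : ModuleCat.{u} R) (n : ℕ)
    (h : ∀ e : Abelian.Ext B Y n, (Abelian.Ext.mk₀ f).comp e (zero_add n) = 0 → e = 0) :
    Function.Injective (((Ext R (ModuleCat.{u} R) n).map f.op).app Y) := by
  let P : ProjectiveResolution A := projectiveResolution A
  let Q : ProjectiveResolution B := projectiveResolution B
  let g : P.complex ⟶ Q.complex := ProjectiveResolution.lift f P Q
  have hg : g ≫ Q.π = P.π ≫ (ChainComplex.single₀ _).map f := ProjectiveResolution.lift_commutes f P Q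
  let φ : ProjectiveResolution.Hom P Q f := ⟨g, by
    have := congrArg (fun t => t.f 0) hg
    simpa using this⟩
  let F := ((linearYoneda R (ModuleCat.{u} R)).obj Y).rightOp
  let G := F.mapHomologicalComplex (ComplexShape.down ℕ)
  have hn : (ComplexShape.down ℕ).prev n = n + 1 := by simp
  have h1 : Function.Injective (HomologicalComplex.homologyMap
      ((HomologicalComplex.unopFunctor _ _).map (G.map g).op) n) := by
    refine injective_homologyMap _ n ?_
    intro z hz hw
    have hf : Q.complex.d (n + 1) n ≫ z = 0 := by
      change Q.complex.d ((ComplexShape.down ℕ).prev n) n ≫ z = 0 at hz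
      rwa [hn] at hz
    refine (extMk_eq_zero_iff_exists_next Q z hf).1 (h _ ?_)
    rw [ProjectiveResolution.mk₀_comp_extMk z (n + 1) rfl hf φ, extMk_eq_zero_iff_exists_next]
    exact hw
  have h3 : Mono (HomologicalComplex.homologyMap
      ((HomologicalComplex.unopFunctor _ _).map (G.map g).op) n) :=
    (ModuleCat.mono_iff_injective _).2 h1
  have h4 : Epi (HomologicalComplex.homologyMap (G.map g) n) := by
    exact epi_homologyMap_opFunctor_map
      ((HomologicalComplex.unopFunctor _ _).map (G.map g).op) n
  have h5 : Epi ((F.leftDerived n).map f) := by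
    rw [Functor.leftDerived_map_eq F n f g hg]
    have : Epi ((F.mapHomologicalComplex (ComplexShape.down ℕ) ⋙
                HomologicalComplex.homologyFunctor _ (ComplexShape.down ℕ) n).map g) := h4
    infer_instance
  have h6 : Mono (((F.leftDerived n).map f).unop) := inferInstance
  exact (ModuleCat.mono_iff_injective _).1 h6

end ExtComparison

section LocalCohomologyVanishing

variable {R : Type u} [CommRing R]

theorem exists_isColimit_localCohomology (J : Ideal R) (i : ℕ) (M : ModuleCat.{u} R) :
    ∃ c : Cocone (localCohomology.diagram (localCohomology.idealPowersDiagram J) i ⋙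
      (evaluation _ _).obj M), c.pt = (localCohomology J i).obj M ∧ Nonempty (IsColimit c) := by
  have := localCohomology.hasColimitDiagram.{u, 0} (localCohomology.idealPowersDiagram J) i
  exact ⟨((evaluation _ _).obj M).mapCocone
    (colimit.cocone (localCohomology.diagram (localCohomology.idealPowersDiagram J) i)),
    rfl, ⟨isColimitOfPreserves _ (colimit.isColimit _)⟩⟩

theorem subsingleton_localCohomology (J : Ideal R) (i : ℕ) (M : ModuleCat.{u} R)
    (h : ∀ t : ℕ, Subsingleton (Abelian.Ext (ModuleCat.of R (R ⧸ J ^ t)) M i)) :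
    Subsingleton ((localCohomology J i).obj M) := by
  obtain ⟨c, hc, ⟨hl⟩⟩ := exists_isColimit_localCohomology J i M
  rw [← hc]
  apply ModuleCat.subsingleton_of_isZero
  rw [IsZero.iff_id_eq_zero]
  refine hl.hom_ext fun j => ?_
  have hz : IsZero ((localCohomology.diagram (localCohomology.idealPowersDiagram J) i ⋙
      (evaluation _ _).obj M).obj j) := (isZero_Ext_obj_iff M i).2 (h _)
  exact hz.eq_of_src _ _

theorem ext_comp_injective {A B : ModuleCat.{u} R} (f : A ⟶ B) [Epi f] (Y : ModuleCat.{u} R)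
    (n : ℕ) (h : ∀ m, m + 1 = n → Subsingleton (Abelian.Ext (kernel f) Y m))
    (e : Abelian.Ext B Y n) (he : (Abelian.Ext.mk₀ f).comp e (zero_add n) = 0) : e = 0 := by
  obtain _ | m := n
  · refine Abelian.Ext.precomp_mk₀_injective_of_epi Y f ?_
    simpa using he
  · have hS : (ShortComplex.mk (kernel.ι f) f (kernel.condition f)).ShortExact :=
      { exact := ShortComplex.exact_of_f_is_kernel _ (kernelIsKernel f) }
    obtain ⟨x, rfl⟩ := Abelian.Ext.contravariant_sequence_exact₃ hS Y e he (add_comm 1 m)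
    have := h m rfl
    rw [Subsingleton.elim x 0, Abelian.Ext.comp_zero]

theorem subsingleton_ext_of_localCohomology (J : Ideal R) (i : ℕ) (M : ModuleCat.{u} R)
    (h : Subsingleton ((localCohomology J i).obj M))
    (hJ : ∀ N : ModuleCat.{u} R, ∀ t : ℕ, (∀ a ∈ J ^ t, ∀ x : N, a • x = 0) →
      Module.Finite R N →
      ∀ m, m + 1 = i → Subsingleton (Abelian.Ext N M m)) [IsNoetherianRing R] (s : ℕ) :
    Subsingleton (Abelian.Ext (ModuleCat.of R (R ⧸ J ^ s)) M i) := by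
  obtain ⟨c, hc, ⟨hl⟩⟩ := exists_isColimit_localCohomology J i M
  rw [← hc] at h
  rw [← isZero_Ext_obj_iff]
  let D := localCohomology.diagram (localCohomology.idealPowersDiagram J) i ⋙
      (evaluation _ _).obj M
  have := preservesFilteredColimitsOfSize_shrink.{0, u, 0, u} (forget (ModuleCat.{u} R))
  have : PreservesColimit D (forget (ModuleCat.{u} R)) := inferInstance
  have key : Subsingleton (D.obj (op (op s))) := by
    rw [subsingleton_iff_forall_eq 0]
    intro x
    obtain ⟨k, f, g, hfg⟩ := Concrete.isColimit_exists_of_rep_eq D hl x (0 : D.obj (op (op s)))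
      (@Subsingleton.elim _ h _ _)
    rw [Subsingleton.elim g f] at hfg
    refine injective_Ext_map ((localCohomology.ringModIdeals
      (localCohomology.idealPowersDiagram J)).map f.unop) M i ?_ hfg
    let φ := (localCohomology.ringModIdeals (localCohomology.idealPowersDiagram J)).map f.unop
    have : Epi φ := by
      rw [ModuleCat.epi_iff_surjective]
      intro y
      obtain ⟨y, rfl⟩ := Submodule.Quotient.mk_surjective _ y
      exact ⟨Submodule.Quotient.mk y, rfl⟩
    refine ext_comp_injective φ M i (hJ _ (unop (unop k)) ?_ ?_)
    · intro a ha x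
      apply (ModuleCat.mono_iff_injective (kernel.ι φ)).1 inferInstance
      rw [map_smul, map_zero]
      generalize (kernel.ι φ) x = z
      change R ⧸ J ^ (unop (unop k)) at z
      obtain ⟨z, rfl⟩ := Submodule.Quotient.mk_surjective _ z
      exact (Submodule.Quotient.mk_eq_zero _).2 (Ideal.mul_mem_right z _ ha)
    · have : IsNoetherian R ↑((localCohomology.ringModIdeals
          (localCohomology.idealPowersDiagram J)).obj k.unop) :=
        inferInstanceAs (IsNoetherian R (R ⧸ J ^ (unop (unop k))))
      exact Module.Finite.of_injective (kernel.ι φ).hom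
        ((ModuleCat.mono_iff_injective (kernel.ι φ)).1 inferInstance)
  exact @ModuleCat.isZero_of_subsingleton _ _ _ key

end LocalCohomologyVanishing

section DepthOfQuotients

variable {R : Type u} [CommRing R]

theorem subsingleton_ext_quotient_sup (N : ModuleCat.{u} R) {J : Ideal R} {x : R}
    (hx : ∀ c, x * c ∈ J → c ∈ J) (i : ℕ)
    (h0 : Subsingleton (Abelian.Ext N (ModuleCat.of R (R ⧸ J)) i))
    (h1 : Subsingleton (Abelian.Ext N (ModuleCat.of R (R ⧸ J)) (i + 1))) :
    Subsingleton (Abelian.Ext N (ModuleCat.of R (R ⧸ (J ⊔ Ideal.span {x}))) i) := by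
  let f : (R ⧸ J) →ₗ[R] (R ⧸ J) := LinearMap.lsmul R (R ⧸ J) x
  let g : (R ⧸ J) →ₗ[R] (R ⧸ (J ⊔ Ideal.span {x})) := Submodule.factor le_sup_left
  have hfg : ∀ z, g z = 0 → ∃ w, f w = z := by
    intro z hz
    obtain ⟨z, rfl⟩ := Submodule.Quotient.mk_surjective _ z
    have : z ∈ J ⊔ Ideal.span {x} := (Submodule.Quotient.mk_eq_zero _).1 hz
    obtain ⟨a, ha, b, hb, rfl⟩ := Submodule.mem_sup.1 this
    obtain ⟨c, rfl⟩ := Ideal.mem_span_singleton'.1 hb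
    refine ⟨Submodule.Quotient.mk c, ?_⟩
    refine (Submodule.Quotient.eq _).2 ?_
    have : x • c - (a + c * x) = -a := by simp only [smul_eq_mul]; ring
    rw [this]
    exact neg_mem ha
  have hgf : g ∘ₗ f = 0 := by
    ext
    refine (Submodule.Quotient.mk_eq_zero _).2 ?_
    exact Ideal.mem_sup_right (Ideal.mul_mem_right _ _ (Ideal.mem_span_singleton_self x))
  let S : ShortComplex (ModuleCat.{u} R) := ShortComplex.mk (ModuleCat.ofHom f) (ModuleCat.ofHom g)
    (by rw [← ModuleCat.ofHom_comp, hgf]; rfl)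
  have hS : S.ShortExact :=
    { exact := by
        rw [ShortComplex.moduleCat_exact_iff]
        exact hfg
      mono_f := by
        rw [ModuleCat.mono_iff_injective]
        refine (injective_iff_map_eq_zero f).2 ?_
        intro z hz
        obtain ⟨z, rfl⟩ := Submodule.Quotient.mk_surjective _ z
        exact (Submodule.Quotient.mk_eq_zero _).2 (hx z ((Submodule.Quotient.mk_eq_zero _).1 hz))
      epi_g := by
        rw [ModuleCat.epi_iff_surjective]
        exact Submodule.factor_surjective (p := J) le_sup_left }
  rw [subsingleton_iff_forall_eq 0]
  intro e
  obtain ⟨y, rfl⟩ := Abelian.Ext.covariant_sequence_exact₃ N hS e rfl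
    (@Subsingleton.elim _ h1 _ _)
  rw [@Subsingleton.elim _ h0 y 0, Abelian.Ext.zero_comp]

variable [IsLocalRing R] [IsNoetherianRing R]

theorem exists_mem_maximalIdeal_isRegular {J : Ideal R}
    (h : Subsingleton (Abelian.Ext (ModuleCat.of R (ResidueField R))
      (ModuleCat.of R (R ⧸ J)) 0)) :
    ∃ y ∈ maximalIdeal R, ∀ c, y * c ∈ J → c ∈ J := by
  have h1 : Subsingleton (ModuleCat.of R (ResidueField R) ⟶ ModuleCat.of R (R ⧸ J)) :=
    Abelian.Ext.addEquiv₀.subsingleton_congr.mp h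
  have h2 : Subsingleton (ResidueField R →ₗ[R] (R ⧸ J)) :=
    (ModuleCat.homAddEquiv (M := ModuleCat.of R (ResidueField R))
      (N := ModuleCat.of R (R ⧸ J))).symm.subsingleton
  obtain ⟨x, hx, hr⟩ := IsSMulRegular.subsingleton_linearMap_iff.mp h2
  refine ⟨x, ?_, fun c hc => ?_⟩
  · have : Module.annihilator R (ResidueField R) = maximalIdeal R :=
      Ideal.annihilator_quotient
    rwa [← this]
  · rw [← Ideal.Quotient.eq_zero_iff_mem]
    refine hr ?_
    change x • Ideal.Quotient.mk J c = x • 0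
    rw [smul_zero, Algebra.smul_def, Ideal.Quotient.algebraMap_eq, ← map_mul]
    exact Ideal.Quotient.eq_zero_iff_mem.2 hc

theorem le_ringKrullDim_quotient_colonElem {n : ℕ} : ∀ {J : Ideal R},
    (∀ i < n, Subsingleton (Abelian.Ext (ModuleCat.of R (ResidueField R))
      (ModuleCat.of R (R ⧸ J)) i)) → ∀ {c : R}, c ∉ J →
    (n : WithBot ℕ∞) ≤ ringKrullDim (R ⧸ colonElem J c) := by
  induction n with
  | zero =>
    intro J _ c hc
    have : Nontrivial (R ⧸ colonElem J c) := by
      refine Ideal.Quotient.nontrivial_iff.2 ?_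
      rw [Ideal.ne_top_iff_one, mem_colonElem, mul_one]
      exact hc
    simpa using ringKrullDim_nonneg_of_nontrivial
  | succ n ih =>
    intro J h c hc
    obtain ⟨y, hy, hreg⟩ := exists_mem_maximalIdeal_isRegular (h 0 n.succ_pos)
    have hpow : ∀ k b, y ^ k * b ∈ J → b ∈ J := by
      intro k
      induction k with
      | zero => intro b hb; simpa using hb
      | succ k ihk =>
        intro b hb
        exact hreg b (ihk _ (by rwa [pow_succ, mul_assoc] at hb))
    obtain ⟨k, c', hcc, hc'⟩ : ∃ k c', c - y ^ k * c' ∈ J ∧ c' ∉ J ⊔ Ideal.span {y} := by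
      by_contra! hcon
      have hall : ∀ k, ∃ c', c - y ^ k * c' ∈ J := by
        intro k
        induction k with
        | zero => exact ⟨c, by simp⟩
        | succ k ihk =>
          obtain ⟨c', hc'⟩ := ihk
          obtain ⟨a, ha, b, hb, hab⟩ := Submodule.mem_sup.1 (hcon k c' hc')
          obtain ⟨e, rfl⟩ := Ideal.mem_span_singleton'.1 hb
          refine ⟨e, ?_⟩
          have : c - y ^ (k + 1) * e = (c - y ^ k * c') + y ^ k * a := by
            rw [← hab]; ring
          rw [this]
          exact add_mem hc' (J.mul_mem_left _ ha)
      apply hc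
      by_cases hJ : J = ⊤
      · rw [hJ]; trivial
      have hne : maximalIdeal R ≠ ⊤ := (maximalIdeal.isMaximal R).ne_top
      have hK := Ideal.iInf_pow_smul_eq_bot_of_isLocalRing (M := R ⧸ J) (maximalIdeal R) hne
      rw [← Ideal.Quotient.eq_zero_iff_mem, ← Submodule.mem_bot R, ← hK, Submodule.mem_iInf]
      intro k
      obtain ⟨c', hc'⟩ := hall k
      have : (Ideal.Quotient.mk J c) = (y ^ k) • Ideal.Quotient.mk J c' := by
        rw [Algebra.smul_def, Ideal.Quotient.algebraMap_eq, ← map_mul]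
        exact Ideal.Quotient.eq.2 hc'
      rw [this]
      exact Submodule.smul_mem_smul (Ideal.pow_mem_pow hy k) trivial
    have ih' := ih (J := J ⊔ Ideal.span {y}) (fun i hi =>
      subsingleton_ext_quotient_sup _ hreg i (h i (by omega)) (h (i + 1) (by omega))) hc'
    have hle : colonElem J c ⊔ Ideal.span {y} ≤ colonElem (J ⊔ Ideal.span {y}) c' := by
      refine sup_le ?_ ?_
      · intro r hr
        rw [mem_colonElem] at hr ⊢
        refine Ideal.mem_sup_left (hpow k _ ?_)
        have : y ^ k * (c' * r) = c * r - (c - y ^ k * c') * r := by ring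
        rw [this]
        exact sub_mem hr (J.mul_mem_right _ hcc)
      · rw [Ideal.span_singleton_le_iff_mem, mem_colonElem]
        exact Ideal.mem_sup_right (Ideal.mul_mem_left _ _ (Ideal.mem_span_singleton_self y))
    have h1 : ringKrullDim (R ⧸ colonElem (J ⊔ Ideal.span {y}) c') ≤
        ringKrullDim (R ⧸ (colonElem J c ⊔ Ideal.span {y})) :=
      ringKrullDim_le_of_surjective _ (Ideal.Quotient.factor_surjective hle)
    have h2 : ringKrullDim (R ⧸ (colonElem J c ⊔ Ideal.span {y})) + 1 ≤
        ringKrullDim (R ⧸ colonElem J c) := by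
      have hnz : Ideal.Quotient.mk (colonElem J c) y ∈ nonZeroDivisors (R ⧸ colonElem J c) := by
        rw [mem_nonZeroDivisors_iff_right]
        intro z hz
        obtain ⟨z, rfl⟩ := Ideal.Quotient.mk_surjective z
        rw [← map_mul, Ideal.Quotient.eq_zero_iff_mem, mem_colonElem] at hz
        rw [Ideal.Quotient.eq_zero_iff_mem, mem_colonElem]
        refine hreg _ ?_
        have : y * (c * z) = c * (z * y) := by ring
        rwa [this]
      have h3 := ringKrullDim_quotient_succ_le_of_nonZeroDivisor hnz
      have h4 : Ideal.span {Ideal.Quotient.mk (colonElem J c) y} =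
          (Ideal.span {y}).map (Ideal.Quotient.mk (colonElem J c)) := by
        rw [Ideal.map_span, Set.image_singleton]
      rw [h4, ringKrullDim_eq_of_ringEquiv
        (DoubleQuot.quotQuotEquivQuotSup (colonElem J c) (Ideal.span {y}))] at h3
      exact h3
    refine le_trans ?_ h2
    push_cast
    exact add_le_add (ih'.trans h1) le_rfl

end DepthOfQuotients

section CohenMacaulay

variable {R : Type u} [CommRing R] [IsLocalRing R] {d : ℕ}

theorem maximalIdeal_smul_top_lt (M : Type u) [AddCommGroup M] [Module R M] [Module.Finite R M]
    [Nontrivial M] : maximalIdeal R • (⊤ : Submodule R M) < ⊤ := by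
  refine lt_top_iff_ne_top.2 fun h => ?_
  exact (Submodule.top_ne_ideal_smul_of_le_jacobson_annihilator
    (IsLocalRing.maximalIdeal_le_jacobson (Module.annihilator R M))) h.symm

theorem support_subset_zeroLocus (N : Type u) [AddCommGroup N] [Module R N] [Module.Finite R N]
    {t : ℕ} (h : ∀ a ∈ maximalIdeal R ^ t, ∀ x : N, a • x = 0) :
    Module.support R N ⊆ PrimeSpectrum.zeroLocus (maximalIdeal R : Set R) := by
  rw [Module.support_eq_zeroLocus]
  intro p hp
  rw [PrimeSpectrum.mem_zeroLocus] at hp ⊢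
  refine p.2.le_of_pow_le (n := t) fun a ha => hp ?_
  exact Module.mem_annihilator.2 (h a ha)

variable [IsNoetherianRing R]

theorem exists_isRegular_of_isCMLocal (hdim : ringKrullDim R = d) (h : IsCMLocal R) :
    ∃ rs : List R, rs.length = d ∧ (∀ r ∈ rs, r ∈ maximalIdeal R) ∧
      RingTheory.Sequence.IsRegular R rs := by
  have hlt := maximalIdeal_smul_top_lt (R := R) R
  have hsup : Module.support R (ModuleCat.of R (R ⧸ maximalIdeal R ^ 1)) =
      PrimeSpectrum.zeroLocus (maximalIdeal R : Set R) := by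
    change Module.support R (R ⧸ maximalIdeal R ^ 1) = _
    rw [Module.support_eq_zeroLocus, Ideal.annihilator_quotient, pow_one]
  have hfin : Module.Finite R (ModuleCat.of R (R ⧸ maximalIdeal R ^ 1)) :=
    inferInstanceAs (Module.Finite R (R ⧸ maximalIdeal R ^ 1))
  have hfin' : Module.Finite R (ModuleCat.of R R) := inferInstanceAs (Module.Finite R R)
  have key : ∀ n ≤ d, ∀ i < n, Subsingleton
      (Abelian.Ext (ModuleCat.of R (R ⧸ maximalIdeal R ^ 1)) (ModuleCat.of R R) i) := by
    intro n
    induction n with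
    | zero => intro _ i hi; omega
    | succ n ih =>
      intro hn i hi
      rcases Nat.lt_succ_iff_lt_or_eq.1 hi with hi | rfl
      · exact ih (by omega) i hi
      obtain ⟨rs, hl, hmem, hreg⟩ := ModuleCat.exists_isRegular_of_exists_subsingleton_ext
        (maximalIdeal R) i (ModuleCat.of R R) hlt _ hsup (ih (by omega))
      refine subsingleton_ext_of_localCohomology (maximalIdeal R) i (ModuleCat.of R R)
        (h i ?_) ?_ 1
      · rw [hdim]
        exact_mod_cast hn
      · intro N t hN hNf m hm
        exact ModuleCat.subsingleton_ext_of_exists_isRegular (maximalIdeal R) N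
          (support_subset_zeroLocus N hN) (ModuleCat.of R R) hlt rs hmem hreg m (by omega)
  exact ModuleCat.exists_isRegular_of_exists_subsingleton_ext
    (maximalIdeal R) d (ModuleCat.of R R) hlt _ hsup (key d le_rfl)

theorem isCMLocal_of_exists_isRegular (hdim : ringKrullDim R = d) {rs : List R}
    (hl : rs.length = d) (hmem : ∀ r ∈ rs, r ∈ maximalIdeal R)
    (hreg : RingTheory.Sequence.IsRegular R rs) : IsCMLocal R := by
  intro i hi
  rw [hdim] at hi
  have hi : i < d := by exact_mod_cast hi
  refine subsingleton_localCohomology (maximalIdeal R) i (ModuleCat.of R R) fun t => ?_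
  have hfin : Module.Finite R (ModuleCat.of R (R ⧸ maximalIdeal R ^ t)) :=
    inferInstanceAs (Module.Finite R (R ⧸ maximalIdeal R ^ t))
  have hfin' : Module.Finite R (ModuleCat.of R R) := inferInstanceAs (Module.Finite R R)
  refine ModuleCat.subsingleton_ext_of_exists_isRegular (maximalIdeal R) _
    (support_subset_zeroLocus (R ⧸ maximalIdeal R ^ t) (t := t) fun a ha x => ?_)
    (ModuleCat.of R R) (maximalIdeal_smul_top_lt (R := R) R) rs hmem hreg i (by omega)
  have : a ∈ Module.annihilator R (R ⧸ maximalIdeal R ^ t) := by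
    rwa [Ideal.annihilator_quotient]
  exact Module.mem_annihilator.1 this x

theorem isCMLocal_of_forall_mem_headSpan {x : ℕ → R} (hdim : ringKrullDim R = d)
    (hm : ∀ l < d, x l ∈ maximalIdeal R)
    (h : ∀ j < d, ∀ c, x j * c ∈ headSpan x j → c ∈ headSpan x j) : IsCMLocal R := by
  have hof : ∀ i ≤ d, Ideal.ofList (((List.range d).map x).take i) = headSpan x i := by
    intro i hi
    rw [← List.map_take, List.take_range, min_eq_left hi, headSpan, Ideal.ofList]
    congr 1
    ext a
    simp
  have hmem : ∀ r ∈ (List.range d).map x, r ∈ maximalIdeal R := by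
    intro r hr
    obtain ⟨l, hl, rfl⟩ := List.mem_map.1 hr
    exact hm l (List.mem_range.1 hl)
  refine isCMLocal_of_exists_isRegular hdim (rs := (List.range d).map x) (by simp) hmem ?_
  refine ⟨⟨fun i hi => ?_⟩, ?_⟩
  · have hid : i < d := by simpa using hi
    rw [hof i hid.le, smul_eq_mul, Ideal.mul_top]
    simp only [List.getElem_map, List.getElem_range]
    refine (isSMulRegular_iff_right_eq_zero_of_smul ..).2 fun z hz => ?_
    obtain ⟨c, rfl⟩ := Submodule.Quotient.mk_surjective _ z
    exact (Submodule.Quotient.mk_eq_zero _).2 (h i hid c ((Submodule.Quotient.mk_eq_zero _).1 hz))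
  · refine (lt_of_le_of_lt ?_ (maximalIdeal_smul_top_lt (R := R) R)).ne'
    exact Submodule.smul_mono_left (Ideal.span_le.2 hmem)

theorem mem_headSpan_of_isCMLocal (hdim : ringKrullDim R = d) (h : IsCMLocal R) {x : ℕ → R}
    (hm : ∀ l < d, x l ∈ maximalIdeal R) (hq : IsCofin (headSpan x d)) :
    ∀ j < d, ∀ c, x j * c ∈ headSpan x j → c ∈ headSpan x j := by
  classical
  obtain ⟨rs, hl, hmem, hreg⟩ := exists_isRegular_of_isCMLocal hdim h
  have step : ∀ j < d, (∀ i < d - j, Subsingleton (Abelian.Ext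
      (ModuleCat.of R (ResidueField R)) (ModuleCat.of R (R ⧸ headSpan x j)) i)) →
      ∀ c, x j * c ∈ headSpan x j → c ∈ headSpan x j := by
    intro j hj hext c hc
    by_contra hcon
    have h1 := le_ringKrullDim_quotient_colonElem hext hcon
    have h2 : headSpan x (j + 1) ≤ colonElem (headSpan x j) c := by
      rw [headSpan_succ]
      refine sup_le (le_colonElem _ _) ?_
      rw [Ideal.span_singleton_le_iff_mem, mem_colonElem, mul_comm]
      exact hc
    have h3 := ringKrullDim_le_of_surjective _ (Ideal.Quotient.factor_surjective h2)
    have h4 := ringKrullDim_quotient_le_card (J := headSpan x (j + 1))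
      (s := (Finset.Ico (j + 1) d).image x) (by
        intro a ha
        obtain ⟨k, hk, rfl⟩ := Finset.mem_image.1 ha
        exact hm k (Finset.mem_Ico.1 hk).2) (by
        refine hq.mono ?_
        rw [headSpan, Ideal.span_le]
        rintro _ ⟨k, hk, rfl⟩
        rcases lt_or_ge k (j + 1) with h | h
        · exact Ideal.mem_sup_left (mem_headSpan x h)
        · refine Ideal.mem_sup_right (Ideal.subset_span ?_)
          exact Finset.mem_coe.2 (Finset.mem_image_of_mem _ (Finset.mem_Ico.2 ⟨h, hk⟩)))
    have h5 : ((Finset.Ico (j + 1) d).image x).card ≤ d - (j + 1) :=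
      Finset.card_image_le.trans (by simp)
    have h6 := h1.trans (h3.trans h4)
    have h7 : d - j ≤ ((Finset.Ico (j + 1) d).image x).card := by exact_mod_cast h6
    omega
  have hext : ∀ j ≤ d, ∀ i < d - j, Subsingleton (Abelian.Ext
      (ModuleCat.of R (ResidueField R)) (ModuleCat.of R (R ⧸ headSpan x j)) i) := by
    intro j
    induction j with
    | zero =>
      intro _ i hi
      have e : R ≃ₗ[R] (R ⧸ headSpan x 0) :=
        (Submodule.quotEquivOfEqBot (headSpan x 0) (headSpan_zero x)).symm
      have hnt : Nontrivial (R ⧸ headSpan x 0) := e.symm.toEquiv.nontrivial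
      have hfin : Module.Finite R (ModuleCat.of R (R ⧸ headSpan x 0)) :=
        inferInstanceAs (Module.Finite R (R ⧸ headSpan x 0))
      have hfin' : Module.Finite R (ModuleCat.of R (ResidueField R)) :=
        inferInstanceAs (Module.Finite R (R ⧸ maximalIdeal R))
      refine ModuleCat.subsingleton_ext_of_exists_isRegular (maximalIdeal R) _ ?_
        (ModuleCat.of R (R ⧸ headSpan x 0)) (maximalIdeal_smul_top_lt (R := R) (R ⧸ headSpan x 0))
        rs hmem ((e.isRegular_congr rs).1 hreg) i (by omega)
      change Module.support R (R ⧸ maximalIdeal R) ⊆ _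
      rw [Module.support_eq_zeroLocus, Ideal.annihilator_quotient]
    | succ j ih =>
      intro hj i hi
      have ihj := ih (by omega)
      rw [headSpan_succ]
      exact subsingleton_ext_quotient_sup _ (step j (by omega) ihj) i (ihj i (by omega))
        (ihj (i + 1) (by omega))
  exact fun j hj => step j hj (hext j hj.le)

theorem bIdeal_quotient_tailSpan_eq_top (hdim : ringKrullDim R = d) (h : IsCMLocal R) {x : ℕ → R}
    (hm : ∀ l < d, x l ∈ maximalIdeal R) (hq : IsCofin (headSpan x d)) {l : ℕ} (hl : l ≤ d) :
    bIdeal R (R ⧸ tailSpan x d l) = ⊤ := by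
  rw [Ideal.eq_top_iff_one]
  refine mem_bIdeal fun s y hy i c hc => ?_
  rw [one_mul]
  obtain ⟨hs, hym, hfin⟩ := hy
  rw [moduleDim_quotient, ringKrullDim_quotient_tailSpan hm hq hdim hl] at hs
  obtain rfl : l = s := by exact_mod_cast hs
  have hcof : IsCofin (tailSpan x d l ⊔ Ideal.span (Set.range y)) := by
    refine isCofin_of_isFiniteLength ?_
    rw [← Module.length_ne_top_iff, ((Submodule.quotEquivOfEq _ _ (smul_top_quotient
      (tailSpan x d l) (Ideal.span (Set.range y)))).trans
      (Submodule.quotientQuotientEquivQuotientSup _ _)).length_eq] at hfin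
    exact Module.length_ne_top_iff.1 hfin
  let z : ℕ → R := fun k => if k < d - l then x (l + k) else extendZero y (k - (d - l))
  have hz1 : ∀ k, k < d - l → z k = x (l + k) := fun k hk => if_pos hk
  have hz2 : ∀ j : Fin l, z (d - l + j) = y j := by
    intro j
    have : ¬ (d - l + (j : ℕ) < d - l) := by omega
    simp only [z, if_neg this, Nat.add_sub_cancel_left, extendZero_coe]
  have hz : ∀ k ≤ l, headSpan z (d - l + k) =
      tailSpan x d l ⊔ Ideal.span (y '' {j | (j : ℕ) < k}) := by
    intro k hk
    rw [headSpan, tailSpan, ← Ideal.span_union]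
    congr 1
    ext a
    constructor
    · rintro ⟨t, ht, rfl⟩
      rw [Set.mem_Iio] at ht
      rcases lt_or_ge t (d - l) with h' | h'
      · exact Or.inl ⟨l + t, ⟨by omega, by omega⟩, (hz1 t h').symm⟩
      · refine Or.inr ⟨⟨t - (d - l), by omega⟩, ?_, ?_⟩
        · change t - (d - l) < k
          omega
        · rw [← hz2]
          congr 1
          change d - l + (t - (d - l)) = t
          omega
    · rintro (⟨t, ht, rfl⟩ | ⟨j, hj, rfl⟩)
      · rw [Set.mem_Ico] at ht
        refine ⟨t - l, Set.mem_Iio.2 (by omega), ?_⟩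
        rw [hz1 _ (by omega)]
        congr 1
        omega
      · have hj : (j : ℕ) < k := hj
        exact ⟨d - l + j, Set.mem_Iio.2 (by omega), hz2 j⟩
  have hi := hz i i.2.le
  have hr := mem_headSpan_of_isCMLocal hdim h (x := z) (by
    intro t ht
    rcases lt_or_ge t (d - l) with h' | h'
    · rw [hz1 t h']
      exact hm _ (by omega)
    · have := hz2 ⟨t - (d - l), by omega⟩
      rw [show d - l + (t - (d - l)) = t by omega] at this
      rw [this]
      exact hym _) (by
    have := hz l le_rfl
    rw [Nat.sub_add_cancel hl] at this
    rw [this]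
    refine hcof.mono (sup_le_sup_left (Ideal.span_mono ?_) _)
    rintro _ ⟨j, rfl⟩
    exact ⟨j, j.2, rfl⟩) (d - l + i) (by have := i.2; omega) c
  rw [hi, hz2] at hr
  exact hr hc

end CohenMacaulay

section ChernNumberOfSocleIdeal

variable {R : Type u} [CommRing R] [IsLocalRing R] {d : ℕ} {x : ℕ → R}

theorem headSpan_le_maximalIdeal (hm : ∀ l < d, x l ∈ maximalIdeal R) :
    headSpan x d ≤ maximalIdeal R := by
  rw [headSpan, Ideal.span_le]
  rintro _ ⟨k, hk, rfl⟩
  exact hm k hk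

theorem mem_mul_maximalIdeal {b : Ideal R} {a : R} (hb : a ∈ b ^ 3) (ha : a ∈ maximalIdeal R) :
    a ∈ b * maximalIdeal R := by
  by_cases h : b = ⊤
  · rwa [h, Ideal.top_mul]
  · rw [pow_succ] at hb
    rw [mul_comm]
    exact Ideal.mul_mono ((Ideal.pow_le_self two_ne_zero).trans (le_maximalIdeal h)) le_rfl hb

variable [IsNoetherianRing R]

theorem colonIdeal_sq_le {d : ℕ} {b : ℕ → Ideal R} (H : AnnihilatesColons (d + 1) x b)
    (hreg : ∀ c, x d * c = 0 → c = 0) (hm : ∀ l < d + 1, x l ∈ maximalIdeal R)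
    (hb : ∀ l < d + 1, x l ∈ b (l + 1) ^ 3)
    (hmI : maximalIdeal R * colonIdeal R (headSpan x (d + 1)) ≤
      maximalIdeal R * headSpan x (d + 1)) :
    colonIdeal R (headSpan x (d + 1)) ^ 2 ≤
      headSpan x (d + 1) * colonIdeal R (headSpan x (d + 1)) := by
  have hI : colonIdeal R (headSpan x (d + 1)) ≤ maximalIdeal R := by
    refine le_maximalIdeal fun htop => ?_
    rw [htop, Ideal.mul_top] at hmI
    have h1 : maximalIdeal R ≤ maximalIdeal R • maximalIdeal R :=
      hmI.trans (Ideal.mul_mono_right (headSpan_le_maximalIdeal hm))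
    have h2 := Submodule.eq_bot_of_le_smul_of_le_jacobson_bot _ _
      (IsNoetherian.noetherian _) h1 (IsLocalRing.maximalIdeal_le_jacobson _)
    have h3 : x d = 0 := by
      rw [← Ideal.mem_bot, ← h2]
      exact hm d (by omega)
    exact one_ne_zero (hreg 1 (by rw [h3, zero_mul]))
  exact H.socle_sq_le hreg hI (fun l hl => hm l (by omega))
    (fun l hl => mem_mul_maximalIdeal (hb l (by omega)) (hm l (by omega)))
    (fun c => mem_colonIdeal) hmI

theorem isCMLocal_of_chern {D : ℕ} (hdim : ringKrullDim R = (D + 2 : ℕ))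
    (hum : IsUnmixedRing R) {r : ℕ} (hm : ∀ l < D + 2, x l ∈ maximalIdeal R)
    (hq : IsCofin (headSpan x (D + 2)))
    (hb : ∀ l < D + 2, x l ∈ bIdeal R (R ⧸ tailSpan x (D + 2) (l + 1)) ^ 3)
    (hr : irMod R R (headSpan x (D + 2)) = r) {e : ℕ → ℤ}
    (he : IsHilbCoeff R (colonIdeal R (headSpan x (D + 2))) (D + 2) e) (he1 : e 1 = r) :
    IsCMLocal R := by
  have H := AnnihilatesColons.of_mem_bIdeal hm hq hdim fun l hl => Ideal.pow_le_self three_ne_zero (hb l hl)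
  have hreg : ∀ c, x (D + 1) * c = 0 → c = 0 := fun c hc =>
    eq_zero_of_mul_eq_zero_of_isUnmixedRing hum hm hq hdim hc
  refine isCMLocal_of_forall_mem_headSpan hdim hm fun j hj c hc => ?_
  by_cases htop : bIdeal R (R ⧸ tailSpan x (D + 2) (D + 2)) = ⊤
  · have := H.ax_head (i := j) (j := j) (k := D + 1) le_rfl (by omega) (by omega) one_ne_zero (β := 1)
      (c := c)
      (by change (1 : R) ∈ bIdeal R (R ⧸ tailSpan x (D + 2) (D + 2)); rw [htop]; trivial)
      (by rwa [pow_one])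
    rwa [one_mul] at this
  have hstar : colonElem (headSpan x (D + 1)) (x (D + 1)) ≤
      colonElem (headSpan x D) (x (D + 1)) ⊔ Ideal.span {x D} := by
    rcases H.mul_socle_le_or hreg (fun l hl => hm l (by omega))
      (pow_not_mem_headSpan hm hq hdim) (le_maximalIdeal htop) (hb (D + 1) (by omega))
      (I := colonIdeal R (headSpan x (D + 2))) (fun c hc => mem_colonIdeal.1 hc) with h | h
    · obtain ⟨N, hN⟩ := (isHilbCoeff_iff (hq.mono (le_colonIdeal _))).1 he
      exact colon_le_of_chern H hreg hq (le_colonIdeal _) (colonIdeal_sq_le H hreg hm hb h)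
        ((irMod_eq_iff hq).1 hr).le he1 hN
    · exact h
  have hx : x (D + 1) * c ∈ headSpan x j :=
    H.ax_head (k := D + 1) le_rfl (by omega) (by omega) one_ne_zero
      (H.mem (D + 1) (by omega)) (by rwa [pow_one])
  rwa [← mem_colonElem, H.colon_eq_of_le hreg hstar (by omega)] at hx

theorem exists_isCofin_headSpan_sq (hdim : ringKrullDim R = d) :
    ∃ x : ℕ → R, (∀ l, x l ∈ maximalIdeal R ^ 2) ∧ IsCofin (headSpan x d) := by
  obtain ⟨s, hs, hc, hcard⟩ := exists_isCofin_span R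
  rw [hdim] at hcard
  have hcard : s.card = d := by exact_mod_cast hcard
  let e : Fin d ≃ s := (finCongr hcard.symm).trans s.equivFin.symm
  refine ⟨extendZero fun i => (e i : R) ^ 2, fun l => ?_, ?_⟩
  · rw [extendZero]
    split_ifs with h
    · exact Ideal.pow_mem_pow (hs _ (e ⟨l, h⟩).2) 2
    · exact zero_mem _
  · rw [headSpan_extendZero]
    refine isCofin_of_pow_mem hc le_rfl fun a ha => ⟨2, Ideal.subset_span ⟨e.symm ⟨a, ha⟩, ?_⟩⟩
    simp

theorem mul_colonIdeal_le_of_sq {D : ℕ} (hdim : ringKrullDim R = (D + 2 : ℕ))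
    {b : ℕ → Ideal R} (H : AnnihilatesColons (D + 2) x b) (hb : b (D + 2) = ⊤)
    (hm : ∀ l, x l ∈ maximalIdeal R ^ 2) :
    maximalIdeal R * colonIdeal R (headSpan x (D + 2)) ≤
      maximalIdeal R * headSpan x (D + 2) := by
  have hspan : ∀ d, headSpan x d = Ideal.span (x '' (Finset.range d : Set ℕ)) := by
    intro d
    rw [headSpan, Finset.coe_range]
  rw [Ideal.mul_le]
  intro α hα a ha
  have hαa := mem_colonIdeal.1 ha α hα
  rw [hspan] at hαa ⊢
  rcases mem_mul_span_or hαa with h | ⟨j, hj, v, hv, hjv⟩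
  · exact h
  exfalso
  set Z := Ideal.span (x '' ((Finset.range (D + 2) : Set ℕ) \ {j})) with hZ
  have hjD : j < D + 2 := Finset.mem_range.1 hj
  have hZreg : ∀ c, x j * c ∈ Z → c ∈ Z := by
    intro c hc
    have hp : powSpan x ((Finset.range (D + 2) : Set ℕ) \ {j}) (fun _ => 1) = Z := by
      simp [powSpan, hZ]
    have := H.ax_bot (l := D + 2) le_rfl (S := (Finset.range (D + 2) : Set ℕ) \ {j})
      (fun k hk => by simpa using hk.1) hjD (by simp) (e := fun _ => 1) (by simp) one_ne_zero
      (β := 1) (by rw [hb]; trivial) (c := c) (by rwa [hp, pow_one])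
    rwa [hp, one_mul] at this
  have hZm : Z ≤ maximalIdeal R • maximalIdeal R := by
    rw [smul_eq_mul, ← pow_two, hZ, Ideal.span_le]
    rintro _ ⟨k, -, rfl⟩
    exact hm k
  have hmle : maximalIdeal R ≤ Ideal.span {α} ⊔ maximalIdeal R • maximalIdeal R := by
    intro γ hγ
    have h1 : γ * a ∈ Z ⊔ Ideal.span {x j} := by
      have h0 := mem_colonIdeal.1 ha γ hγ
      rw [hspan] at h0
      refine Ideal.span_le.2 ?_ h0
      rintro _ ⟨k, hk, rfl⟩
      by_cases hkj : k = j
      · exact Ideal.mem_sup_right (hkj ▸ Ideal.mem_span_singleton_self _)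
      · exact Ideal.mem_sup_left (Ideal.subset_span ⟨k, ⟨hk, hkj⟩, rfl⟩)
    obtain ⟨z, hz, y, hy, hzy⟩ := Submodule.mem_sup.1 h1
    obtain ⟨f, rfl⟩ := Ideal.mem_span_singleton'.1 hy
    have h2 : γ * v - α * f ∈ Z := by
      refine hZreg _ ?_
      have : x j * (γ * v - α * f) = α * z - γ * (α * a - v * x j) := by
        linear_combination (-α) * hzy
      rw [this]
      exact sub_mem (Z.mul_mem_left _ hz) (Z.mul_mem_left _ hjv)
    have h3 : γ * v ∈ Ideal.span {α} ⊔ maximalIdeal R • maximalIdeal R := by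
      have : γ * v = α * f + (γ * v - α * f) := by ring
      rw [this]
      exact add_mem (Ideal.mem_sup_left (Ideal.mul_mem_right _ _ (Ideal.mem_span_singleton_self α)))
        (Ideal.mem_sup_right (hZm h2))
    exact (Ideal.mul_unit_mem_iff_mem _ hv).1 h3
  have hle := Submodule.le_of_le_smul_of_le_jacobson_bot (IsNoetherian.noetherian _)
    (IsLocalRing.maximalIdeal_le_jacobson _) hmle
  have hcard := ringKrullDim_le_card (s := {α}) (by simpa using hα)
    ⟨1, by simpa using hle⟩
  rw [hdim, Finset.card_singleton] at hcard
  have : D + 2 ≤ 1 := by exact_mod_cast hcard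
  omega

theorem exists_chern_eq_of_isCMLocal {D : ℕ} (hdim : ringKrullDim R = (D + 2 : ℕ))
    (h : IsCMLocal R) {r : ℕ} (hr : IsStableValue R r) :
    ∃ q : Ideal R, IsCParamIdeal R q ∧ ∃ e : ℕ → ℤ,
      IsHilbCoeff R (colonIdeal R q) (D + 2) e ∧ e 1 = r := by
  obtain ⟨x, hx, hq⟩ := exists_isCofin_headSpan_sq hdim
  have hm : ∀ l < D + 2, x l ∈ maximalIdeal R := fun l _ => Ideal.pow_le_self two_ne_zero (hx l)
  have htop : ∀ l ≤ D + 2, bIdeal R (R ⧸ tailSpan x (D + 2) l) = ⊤ := fun l hl =>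
    bIdeal_quotient_tailSpan_eq_top hdim h hm hq hl
  have hb : ∀ l < D + 2, x l ∈ bIdeal R (R ⧸ tailSpan x (D + 2) (l + 1)) ^ 3 := by
    intro l hl
    rw [htop (l + 1) hl, Ideal.top_pow]
    trivial
  have H := AnnihilatesColons.of_mem_bIdeal hm hq hdim fun l hl => Ideal.pow_le_self three_ne_zero (hb l hl)
  have hcolon : ∀ j ≤ D + 1, ∀ c, x (D + 1) * c ∈ headSpan x j → c ∈ headSpan x j := by
    intro j hj c hc
    have := H.ax_head (k := D + 1) hj le_rfl (by omega) one_ne_zero (β := 1) (c := c)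
      (by change (1 : R) ∈ bIdeal R (R ⧸ tailSpan x (D + 2) (D + 2)); rw [htop _ le_rfl]; trivial)
      (by rwa [pow_one])
    rwa [one_mul] at this
  have hreg : ∀ c, x (D + 1) * c = 0 → c = 0 := by
    intro c hc
    have := hcolon 0 (by omega) c (by rw [hc]; exact zero_mem _)
    rwa [headSpan_zero] at this
  have hC := isCParamIdeal_of hdim hm hq hb
  refine ⟨_, hC, fun i => if i = 0 then colength (headSpan x (D + 2)) else if i = 1 then r else 0,
    ?_, rfl⟩
  rw [isHilbCoeff_iff (hq.mono (le_colonIdeal _))]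
  refine ⟨1, fun n hn => ?_⟩
  obtain ⟨n, rfl⟩ := Nat.exists_eq_succ_of_ne_zero (Nat.one_le_iff_ne_zero.1 hn)
  have hsq := colonIdeal_sq_le H hreg hm hb
    (mul_colonIdeal_le_of_sq hdim H (htop _ le_rfl) hx)
  rw [colength_socle_pow H hreg hq (fun j hj c hc => headSpan_mono x (by omega) (hcolon j hj c hc))
    (le_colonIdeal _) hsq ((irMod_eq_iff hq).1 (hr _ hC)) n]
  rw [Finset.sum_range_succ', Finset.sum_range_succ', Finset.sum_eq_zero]
  · simp
    ring_nf
  · intro i _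
    simp

end ChernNumberOfSocleIdeal

/-- For `R` unmixed of dimension `d ≥ 2`, `𝒩(R) ∈ Ξ_1(R)` (there is a
C-parameter ideal `q` with `e_1(q :_R m, R) = 𝒩(R)`) iff `R` is Cohen-Macaulay. -/
theorem statement_6 {R : Type u} [CommRing R] [IsLocalRing R] [IsNoetherianRing R]
    (hres : IsHomImageOfCM R)
    (d : ℕ) (hd : 2 ≤ d) (hdim : ringKrullDim R = (d : WithBot ℕ∞))
    (hum : IsUnmixedRing R)
    (NR : ℕ) (hNR : IsStableValue R NR) :
    (∃ q : Ideal R, IsCParamIdeal R q ∧ ∃ e : ℕ → ℤ,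
        IsHilbCoeff R (colonIdeal R q) d e ∧ e 1 = (NR : ℤ)) ↔ IsCMLocal R := by
  obtain ⟨D, rfl⟩ := Nat.exists_eq_add_of_le' hd
  constructor
  · rintro ⟨q, hC, e, he, he1⟩
    have hr := hNR q hC
    obtain ⟨d, x, rfl, hdim', hm, hq, hb⟩ := exists_of_isCParamIdeal hC
    obtain rfl : D + 2 = d := by
      rw [hdim] at hdim'
      exact_mod_cast hdim'
    exact isCMLocal_of_chern hdim hum hm hq hb hr he he1
  · exact fun h => exists_chern_eq_of_isCMLocal hdim h hNR
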